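/- Suppose q₁ : ℝⁿ → (1,∞) satisfies the log-Hölder conditions (C1),(C2), m ∈ ℕ, 0 < p₁ ≤ p₂ < ∞, λ > 0, 0 < β < n/(q₁)_+, and define q₂ by 1/q₁ - 1/q₂ = β/n. Let δ₁ ∈ (0, 1/(q₁')_+) and δ₂ ∈ (0, 1/(q₂)_+) be as in the characteristic-function estimate, and assume λ - nδ₂ < α < λ + nδ₁. Then the m-th order commutator I^m_{β,b} is bounded from MK̇^{α,λ}_{p₁,q₁(·)}(ℝⁿ) to MK̇^{α,λ}_{p₂,q₂(·)}(ℝⁿ) for every b ∈ BMO(ℝⁿ), with ‖I^m_{β,b} f‖ ≤ C ‖b‖_{BMO}^m ‖f‖. -/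

import Mathlib

open MeasureTheory Metric
open scoped ENNReal

/-- The Luxemburg norm of `f` in the variable exponent Lebesgue space `L^{q(·)}(ℝⁿ)`. -/
noncomputable def vLpNorm {n : ℕ} (q : EuclideanSpace ℝ (Fin n) → ℝ)
    (f : EuclideanSpace ℝ (Fin n) → ℝ) : ℝ≥0∞ :=
  sInf {η : ℝ≥0∞ | η ≠ 0 ∧ ∫⁻ x, ((‖f x‖₊ : ℝ≥0∞) / η) ^ (q x) ≤ 1}

/-- The log-Hölder conditions (C1) and (C2) for a variable exponent. -/
def LogHolder {n : ℕ} (q : EuclideanSpace ℝ (Fin n) → ℝ) : Prop :=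
  ∃ C > 0,
    (∀ x y : EuclideanSpace ℝ (Fin n), dist x y ≤ 1/2 →
      |q x - q y| ≤ C / (-Real.log (dist x y))) ∧
    (∀ x y : EuclideanSpace ℝ (Fin n), ‖x‖ ≤ ‖y‖ →
      |q x - q y| ≤ C / Real.log (Real.exp 1 + ‖x‖))

/-- The dyadic annulus `A_k = B(0,2^k) \ B(0,2^{k-1})` in `ℝⁿ`. -/
def annulus (n : ℕ) (k : ℤ) : Set (EuclideanSpace ℝ (Fin n)) :=
  closedBall 0 ((2:ℝ) ^ k) \ closedBall 0 ((2:ℝ) ^ (k - 1))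

/-- The Herz–Morrey norm `‖f‖_{MK̇^{α,λ}_{p,q(·)}} =
`sup_{k₀} 2^{-k₀λ} (∑_{k ≤ k₀} 2^{kαp} ‖f χ_{A_k}‖^p_{L^{q(·)}})^{1/p}`. -/
noncomputable def herzMorreyNorm {n : ℕ} (q : EuclideanSpace ℝ (Fin n) → ℝ)
    (α lam p : ℝ) (f : EuclideanSpace ℝ (Fin n) → ℝ) : ℝ≥0∞ :=
  ⨆ k₀ : ℤ, ENNReal.ofReal ((2:ℝ) ^ (-(k₀:ℝ) * lam)) *
    (∑' k : {k : ℤ // k ≤ k₀},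
      (ENNReal.ofReal ((2:ℝ) ^ (((k:ℤ):ℝ) * α)) *
        vLpNorm q ((annulus n (k:ℤ)).indicator f)) ^ p) ^ (1 / p)

/-- The `m`-th order commutator of the fractional integral,
`I^m_{β,b} f(x) = ∫ f(y) (b(x) - b(y))^m |x-y|^{β-n} dy`. -/
noncomputable def commFracInt {n : ℕ} (β : ℝ) (m : ℕ)
    (b f : EuclideanSpace ℝ (Fin n) → ℝ) (x : EuclideanSpace ℝ (Fin n)) : ℝ :=
  ∫ y, f y * (b x - b y) ^ m * ‖x - y‖ ^ (β - (n:ℝ))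

namespace HM

/-- shorthand for Euclidean space -/
abbrev Eu (n : ℕ) := EuclideanSpace ℝ (Fin n)

/-- `2 ^ x` in `ℝ≥0∞`. -/
noncomputable def tw (x : ℝ) : ℝ≥0∞ := (2:ℝ≥0∞) ^ x

lemma tw_add (x y : ℝ) : tw (x + y) = tw x * tw y :=
  ENNReal.rpow_add _ _ (by norm_num) (by norm_num)

lemma tw_ne_zero (x : ℝ) : tw x ≠ 0 := by
  unfold tw; simp [ENNReal.rpow_eq_zero_iff]

lemma tw_ne_top (x : ℝ) : tw x ≠ ⊤ := by
  unfold tw; simp [ENNReal.rpow_eq_top_iff]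

lemma tw_pos (x : ℝ) : 0 < tw x := pos_iff_ne_zero.2 (tw_ne_zero x)

lemma tw_rpow (x a : ℝ) : tw x ^ a = tw (x * a) := by
  unfold tw; rw [ENNReal.rpow_mul]

lemma tw_pow (x : ℝ) (a : ℕ) : tw x ^ a = tw (x * a) := by
  rw [← tw_rpow, ENNReal.rpow_natCast]

lemma tw_zero : tw 0 = 1 := by simp [tw]

lemma tw_inv (x : ℝ) : (tw x)⁻¹ = tw (-x) := by
  unfold tw; rw [ENNReal.rpow_neg]

lemma tw_mono {x y : ℝ} (h : x ≤ y) : tw x ≤ tw y :=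
  ENNReal.rpow_le_rpow_of_exponent_le (by norm_num) h

lemma tw_strictMono {x y : ℝ} (h : x < y) : tw x < tw y :=
  ENNReal.rpow_lt_rpow_of_exponent_lt (by norm_num) (by norm_num) h

lemma tw_le_iff {x y : ℝ} : tw x ≤ tw y ↔ x ≤ y := by
  constructor
  · intro h; by_contra hc; push Not at hc
    exact absurd h (not_le.2 (tw_strictMono hc))
  · exact tw_mono

lemma ofReal_two_rpow (x : ℝ) : ENNReal.ofReal ((2:ℝ) ^ x) = tw x := by
  unfold tw
  rw [← ENNReal.ofReal_rpow_of_pos (by norm_num)]; simp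

lemma ofReal_two_zpow (k : ℤ) : ENNReal.ofReal ((2:ℝ) ^ k) = tw k := by
  rw [← Real.rpow_intCast, ofReal_two_rpow]

lemma tw_zpow (i : ℤ) : (2:ℝ≥0∞) ^ i = tw i := by
  unfold tw; rw [ENNReal.rpow_intCast]

lemma tw_mul_tw_neg (x : ℝ) : tw x * tw (-x) = 1 := by
  rw [← tw_add]; simp [tw_zero]

lemma one_le_tw {x : ℝ} (h : 0 ≤ x) : 1 ≤ tw x := by
  rw [← tw_zero]; exact tw_mono h

/-- bracket an `ℝ≥0∞` number between powers of two -/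
lemma exists_tw_bracket {X : ℝ≥0∞} (h0 : X ≠ 0) (ht : X ≠ ⊤) :
    ∃ i : ℤ, tw i ≤ X ∧ X < tw ((i:ℝ) + 1) := by
  obtain ⟨i, hi⟩ := ENNReal.exists_mem_Ico_zpow h0 ht (by norm_num : (1:ℝ≥0∞) < 2) (by norm_num)
  refine ⟨i, ?_, ?_⟩
  · rw [← tw_zpow]; exact hi.1
  · have := hi.2
    rw [tw_zpow] at this; push_cast at this; exact this

lemma exists_tw_bracket' {X : ℝ≥0∞} (h0 : X ≠ 0) (ht : X ≠ ⊤) :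
    ∃ i : ℤ, tw i < X ∧ X ≤ tw ((i:ℝ) + 1) := by
  obtain ⟨i, hi⟩ := ENNReal.exists_mem_Ioc_zpow h0 ht (by norm_num : (1:ℝ≥0∞) < 2) (by norm_num)
  refine ⟨i, ?_, ?_⟩
  · rw [← tw_zpow]; exact hi.1
  · have := hi.2
    rw [tw_zpow] at this; push_cast at this; exact this

/-- constant of the geometric sum -/
noncomputable def Cg (a : ℝ) : ℝ≥0∞ := (1 - tw (-a))⁻¹

lemma Cg_ne_top {a : ℝ} (ha : 0 < a) : Cg a ≠ ⊤ := by
  unfold Cg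
  rw [ENNReal.inv_ne_top]
  have : tw (-a) < 1 := by rw [← tw_zero]; exact tw_strictMono (by linarith)
  exact (tsub_pos_of_lt this).ne'

lemma Cg_ne_zero (a : ℝ) : Cg a ≠ 0 := by
  unfold Cg
  rw [ENNReal.inv_ne_zero]
  exact ne_top_of_le_ne_top ENNReal.one_ne_top tsub_le_self

lemma tsum_geom_le_int (a : ℝ) (i0 : ℤ) :
    ∑' i : ℤ, (if i ≤ i0 then tw (i * a) else 0) = Cg a * tw (i0 * a) := by
  have hinj : Function.Injective (fun l : ℕ => i0 - (l:ℤ)) := by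
    intro l l' h; simp at h; exact h
  rw [← hinj.tsum_eq]
  · have : ∀ l : ℕ, (if (i0 - (l:ℤ)) ≤ i0 then tw (((i0 - (l:ℤ) : ℤ):ℝ) * a) else 0)
        = tw (i0 * a) * tw (-a) ^ l := by
      intro l
      rw [if_pos (by omega), tw_pow, ← tw_add]; congr 1; push_cast; ring
    simp_rw [this]
    rw [ENNReal.tsum_mul_left, ENNReal.tsum_geometric, mul_comm]; rfl
  · intro i hi
    simp only [Function.mem_support, ne_eq, ite_eq_right_iff, Classical.not_imp] at hi
    exact ⟨(i0 - i).toNat, by have := hi.1; simp; omega⟩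

/-- geometric sum, small scales -/
lemma geom_small {a : ℝ} (ha : 0 < a) (X : ℝ≥0∞) :
    ∑' i : ℤ, (if tw i ≤ X then tw (i * a) else 0) ≤ Cg a * X ^ a := by
  by_cases h0 : X = 0
  · subst h0
    have : ∀ i : ℤ, (if tw i ≤ 0 then tw (i * a) else 0) = 0 := by
      intro i; rw [if_neg]; simp [tw_ne_zero]
    rw [tsum_congr this]; simp
  by_cases ht : X = ⊤
  · subst ht
    rw [ENNReal.top_rpow_of_pos ha, ENNReal.mul_top (Cg_ne_zero a)]; exact le_top
  obtain ⟨i0, h1, h2⟩ := exists_tw_bracket h0 ht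
  have key : ∀ i : ℤ, (if tw i ≤ X then tw (i * a) else 0) ≤ (if i ≤ i0 then tw (i * a) else 0) := by
    intro i
    split_ifs with h h'
    · exact le_rfl
    · exfalso
      have : tw i < tw ((i0:ℝ) + 1) := lt_of_le_of_lt h h2
      have h3 : ¬ ((i0:ℝ) + 1 ≤ i) := fun hh => absurd (tw_mono hh) (not_le.2 this)
      apply h3; exact_mod_cast (by omega : i0 + 1 ≤ i)
    · exact zero_le
    · exact le_rfl
  refine (ENNReal.tsum_le_tsum key).trans ?_
  rw [tsum_geom_le_int]
  gcongr
  rw [← tw_rpow]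
  exact ENNReal.rpow_le_rpow h1 ha.le

/-- geometric sum, large scales -/
lemma geom_large {a : ℝ} (ha : 0 < a) (X : ℝ≥0∞) :
    ∑' i : ℤ, (if X ≤ tw i then tw (-(i * a)) else 0) ≤ Cg a * X ^ (-a) := by
  have h := geom_small ha X⁻¹
  rw [← (Equiv.neg ℤ).tsum_eq] at h
  have h2 : (X⁻¹) ^ a = X ^ (-a) := by rw [ENNReal.rpow_neg, ENNReal.inv_rpow]
  rw [h2] at h
  refine le_trans (ENNReal.tsum_le_tsum ?_) h
  intro i
  have e1 : ((Equiv.neg ℤ i : ℤ) : ℝ) = -(i:ℝ) := by simp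
  rw [e1]
  have : (tw (-(i:ℝ)) ≤ X⁻¹) ↔ X ≤ tw i := by
    rw [← tw_inv, ENNReal.inv_le_inv]
  simp only [this]
  rw [neg_mul]

/-- the rapidly decaying sum -/
lemma decay_sum_ne_top (m : ℕ) {ε : ℝ} (hε : 0 < ε) :
    ∑' l : ℤ, ((1 + (l.natAbs : ℝ≥0∞)) ^ m * tw (-(l.natAbs * ε))) ≠ ⊤ := by
  have hr : (2:ℝ) ^ (-ε) < 1 := Real.rpow_lt_one_of_one_lt_of_neg (by norm_num) (by linarith)
  have hr0 : 0 < (2:ℝ) ^ (-ε) := by positivity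
  have hs : Summable (fun l : ℕ => (1 + (l:ℝ)) ^ m * ((2:ℝ) ^ (-ε)) ^ l) := by
    have h := summable_pow_mul_geometric_of_norm_lt_one m (r := (2:ℝ) ^ (-ε))
      (by rw [Real.norm_of_nonneg hr0.le]; exact hr)
    have h' := (summable_nat_add_iff 1).2 h
    have h'' := h'.mul_right ((2:ℝ) ^ (-ε))⁻¹
    refine h''.congr ?_
    intro l
    push_cast
    rw [pow_succ]; field_simp; ring
  have hs2 : Summable (fun l : ℤ => (1 + (l.natAbs:ℝ)) ^ m * ((2:ℝ) ^ (-ε)) ^ l.natAbs) := by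
    apply Summable.of_nat_of_neg
    · simpa using hs
    · simpa using hs
  have := hs2.tsum_ofReal_ne_top
  convert this using 3 with l
  rw [ENNReal.ofReal_mul (by positivity), ENNReal.ofReal_pow (by positivity),
    ENNReal.ofReal_add (by norm_num) (by positivity), ENNReal.ofReal_pow (by positivity),
    ofReal_two_rpow, tw_pow]
  rw [ENNReal.ofReal_one, ENNReal.ofReal_natCast]
  congr 2; ring

/-- positive powers: `x^a ≤ x^b + 1` for `a ≤ b` -/
lemma rpow_le_rpow_add_one {x : ℝ≥0∞} {a b : ℝ} (ha : 0 ≤ a) (h : a ≤ b) : x ^ a ≤ x ^ b + 1 := by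
  rcases le_total x 1 with hx | hx
  · exact (ENNReal.rpow_le_one hx ha).trans le_add_self
  · exact (ENNReal.rpow_le_rpow_of_exponent_le hx h).trans le_self_add

lemma rpow_le_self_of_one_le {x : ℝ≥0∞} (hx : 1 ≤ x) {a b : ℝ} (h : a ≤ b) : x ^ a ≤ x ^ b :=
  ENNReal.rpow_le_rpow_of_exponent_le hx h

/-- `(x/C)^q ≤ x^q / C` for `C ≥ 1`, `q ≥ 1` -/
lemma div_rpow_le {x C : ℝ≥0∞} {q : ℝ} (hC : 1 ≤ C) (hq : 1 ≤ q) : (x / C) ^ q ≤ C⁻¹ * x ^ q := by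
  rw [ENNReal.div_rpow_of_nonneg _ _ (by linarith), div_eq_mul_inv, mul_comm]
  gcongr
  calc C = C ^ (1:ℝ) := by simp
    _ ≤ C ^ q := ENNReal.rpow_le_rpow_of_exponent_le hC hq

/-- from modular `≤ C V` to modular `≤ V` -/
lemma modular_div_le {α : Type*} [MeasurableSpace α] {μ : Measure α} {F : α → ℝ≥0∞} {q : α → ℝ}
    {C V : ℝ≥0∞} (hC : 1 ≤ C) (hCt : C ≠ ⊤) (hq : ∀ x, 1 ≤ q x)
    (h : ∫⁻ x, (F x) ^ (q x) ∂μ ≤ C * V) : ∫⁻ x, (F x / C) ^ (q x) ∂μ ≤ V := by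
  have hC0 : C ≠ 0 := (lt_of_lt_of_le one_pos hC).ne'
  calc ∫⁻ x, (F x / C) ^ (q x) ∂μ ≤ ∫⁻ x, C⁻¹ * (F x) ^ (q x) ∂μ :=
        lintegral_mono fun x => div_rpow_le hC (hq x)
    _ = C⁻¹ * ∫⁻ x, (F x) ^ (q x) ∂μ := lintegral_const_mul' _ _ (ENNReal.inv_ne_top.2 hC0)
    _ ≤ C⁻¹ * (C * V) := by gcongr
    _ = V := by rw [← mul_assoc, ENNReal.inv_mul_cancel hC0 hCt, one_mul]

end HM

namespace HM

/-- volume of the unit ball -/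
noncomputable def vb (n : ℕ) : ℝ≥0∞ := volume (ball (0:Eu n) 1)

lemma vb_ne_top (n : ℕ) : vb n ≠ ⊤ := measure_ball_lt_top.ne

lemma vb_ne_zero (n : ℕ) : vb n ≠ 0 := (measure_ball_pos _ _ one_pos).ne'

lemma vol_closedBall {n : ℕ} (c : Eu n) {r : ℝ} (hr : 0 ≤ r) :
    volume (closedBall c r) = ENNReal.ofReal r ^ n * vb n := by
  rw [Measure.addHaar_closedBall _ _ hr, finrank_euclideanSpace_fin, ENNReal.ofReal_pow hr]; rfl

lemma vol_closedBall_two {n : ℕ} (c : Eu n) (i : ℤ) :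
    volume (closedBall c ((2:ℝ) ^ i)) = tw (i * n) * vb n := by
  rw [vol_closedBall _ (by positivity), ofReal_two_zpow, tw_pow]

lemma vitali {n : ℕ} (S : Set (Eu n)) (r : Eu n → ℝ) (R : ℝ)
    (hr : ∀ a ∈ S, 0 < r a ∧ r a ≤ R) :
    ∃ u ⊆ S, u.Countable ∧ u.PairwiseDisjoint (fun a => closedBall a (r a)) ∧
      S ⊆ ⋃ a ∈ u, closedBall a (5 * r a) := by
  obtain ⟨u, hu, hd, hc⟩ := Vitali.exists_disjoint_subfamily_covering_enlargement_closedBall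
    S (fun a => a) r R (fun a ha => (hr a ha).2) 5 (by norm_num)
  refine ⟨u, hu, ?_, hd, ?_⟩
  · apply hd.countable_of_nonempty_interior
    intro a ha
    refine ⟨a, ?_⟩
    exact mem_interior_iff_mem_nhds.2 (closedBall_mem_nhds _ (hr a (hu ha)).1)
  · intro a ha
    obtain ⟨b, hb, hab⟩ := hc a ha
    exact Set.mem_biUnion hb (hab (mem_closedBall_self (hr a ha).1.le))

/-- normalized average over a dyadic ball -/
noncomputable def av {n : ℕ} (i : ℤ) (u : Eu n → ℝ≥0∞) (z : Eu n) : ℝ≥0∞ :=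
  tw (-(i * n)) * ∫⁻ y in closedBall z ((2:ℝ) ^ i), u y

lemma av_mono {n : ℕ} (i : ℤ) {u v : Eu n → ℝ≥0∞} (h : ∀ y, u y ≤ v y) (z : Eu n) :
    av i u z ≤ av i v z := by
  unfold av; gcongr with y; exact h y

lemma measurableSet_near {n : ℕ} (r : ℝ) :
    MeasurableSet {p : Eu n × Eu n | p.2 ∈ closedBall p.1 r} := by
  simp only [mem_closedBall]
  exact measurableSet_le (by fun_prop) measurable_const

lemma measurable_av {n : ℕ} (i : ℤ) {u : Eu n → ℝ≥0∞} (hu : Measurable u) :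
    Measurable (av i u) := by
  unfold av
  refine Measurable.const_mul ?_ _
  have : (fun z : Eu n => ∫⁻ y in closedBall z ((2:ℝ) ^ i), u y) =
      fun z => ∫⁻ y, ({p : Eu n × Eu n | p.2 ∈ closedBall p.1 ((2:ℝ) ^ i)}.indicator
        (fun p => u p.2)) (z, y) := by
    funext z
    rw [← lintegral_indicator measurableSet_closedBall]
    rfl
  rw [this]
  apply Measurable.lintegral_prod_right'
  exact (hu.comp measurable_snd).indicator (measurableSet_near _)

/-- dyadic-radius centered maximal function -/
noncomputable def mx {n : ℕ} (u : Eu n → ℝ≥0∞) (z : Eu n) : ℝ≥0∞ := ⨆ i : ℤ, av i u z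

lemma measurable_mx {n : ℕ} {u : Eu n → ℝ≥0∞} (hu : Measurable u) : Measurable (mx u) :=
  Measurable.iSup fun i => measurable_av i hu

lemma av_le_mx {n : ℕ} (i : ℤ) (u : Eu n → ℝ≥0∞) (z : Eu n) : av i u z ≤ mx u z :=
  le_iSup (fun i : ℤ => av i u z) i

/-- weak type (1,1) -/
lemma weak11 {n : ℕ} (hn : 0 < n) (u : Eu n → ℝ≥0∞) {L : ℝ≥0∞} (hL : L ≠ 0) (hLt : L ≠ ⊤) :
    volume {z | L < mx u z} ≤ 5 ^ n * vb n * L⁻¹ * ∫⁻ y, u y := by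
  by_cases hI : ∫⁻ y, u y = ⊤
  · rw [hI, ENNReal.mul_top]
    · exact le_top
    · simp [vb_ne_zero, hLt]
  have hex : ∀ z ∈ {z | L < mx u z}, ∃ i : ℤ, L < av i u z := by
    intro z hz; exact lt_iSup_iff.1 hz
  choose! I hI2 using hex
  set X : ℝ≥0∞ := L⁻¹ * ∫⁻ y, u y with hX
  have hXt : X ≠ ⊤ := ENNReal.mul_ne_top (ENNReal.inv_ne_top.2 hL) hI
  have hlow : ∀ z ∈ {z | L < mx u z},
      tw (I z * n) ≤ L⁻¹ * ∫⁻ y in closedBall z ((2:ℝ) ^ (I z)), u y := by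
    intro z hz
    have h1 := (hI2 z hz).le
    unfold av at h1
    have h2 : tw (I z * n) * L ≤ ∫⁻ y in closedBall z ((2:ℝ) ^ (I z)), u y := by
      calc tw (I z * n) * L ≤ tw (I z * n) * (tw (-(I z * n)) *
            ∫⁻ y in closedBall z ((2:ℝ) ^ (I z)), u y) := by gcongr
        _ = _ := by rw [← mul_assoc, tw_mul_tw_neg, one_mul]
    calc tw (I z * n) = L⁻¹ * (tw (I z * n) * L) := by
          rw [mul_comm (tw _), ← mul_assoc, ENNReal.inv_mul_cancel hL hLt, one_mul]
      _ ≤ _ := by gcongr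
  have hR : ∀ a ∈ {z | L < mx u z}, 0 < (2:ℝ) ^ (I a) ∧ (2:ℝ) ^ (I a) ≤ (X + 1).toReal := by
    intro z hz
    refine ⟨by positivity, ?_⟩
    rw [← ENNReal.ofReal_le_iff_le_toReal (by simp [hXt]), ofReal_two_zpow]
    rcases le_total 0 (I z) with h | h
    · calc tw (I z) ≤ tw (I z * n) := by
            apply tw_mono
            have h1 : (0:ℝ) ≤ I z := by exact_mod_cast h
            have h2 : (1:ℝ) ≤ n := by exact_mod_cast hn
            nlinarith
        _ ≤ X := (hlow z hz).trans (by rw [hX]; gcongr; exact Measure.restrict_le_self)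
        _ ≤ X + 1 := le_self_add
    · calc tw (I z) ≤ tw 0 := tw_mono (by exact_mod_cast h)
        _ = 1 := tw_zero
        _ ≤ X + 1 := le_add_self
  obtain ⟨s, hs, hc, hd, hcov⟩ := vitali _ (fun z => (2:ℝ) ^ (I z)) _ hR
  have : Countable s := hc.to_subtype
  calc volume {z | L < mx u z} ≤ volume (⋃ a ∈ s, closedBall a (5 * (2:ℝ) ^ (I a))) :=
        measure_mono hcov
    _ ≤ ∑' a : s, volume (closedBall (a:Eu n) (5 * (2:ℝ) ^ (I a))) :=
        measure_biUnion_le _ hc _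
    _ ≤ ∑' a : s, 5 ^ n * vb n * L⁻¹ * ∫⁻ y in closedBall (a:Eu n) ((2:ℝ) ^ (I a)), u y := by
        refine ENNReal.tsum_le_tsum fun a => ?_
        rw [vol_closedBall _ (by positivity), ENNReal.ofReal_mul (by norm_num), ofReal_two_zpow,
          mul_pow, tw_pow]
        have := hlow a (hs a.2)
        calc ENNReal.ofReal 5 ^ n * tw (I a * n) * vb n
            = 5 ^ n * vb n * tw (I a * n) := by simp; ring
          _ ≤ 5 ^ n * vb n * (L⁻¹ * ∫⁻ y in closedBall (a:Eu n) ((2:ℝ) ^ (I a)), u y) := by gcongr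
          _ = _ := by ring
    _ = 5 ^ n * vb n * L⁻¹ * ∑' a : s, ∫⁻ y in closedBall (a:Eu n) ((2:ℝ) ^ (I a)), u y :=
        ENNReal.tsum_mul_left
    _ = 5 ^ n * vb n * L⁻¹ * ∫⁻ y in ⋃ a ∈ s, closedBall (a:Eu n) ((2:ℝ) ^ (I a)), u y := by
        rw [lintegral_biUnion hc (fun a _ => measurableSet_closedBall) hd]
    _ ≤ _ := by gcongr; exact Measure.restrict_le_self

/-- dyadic layer cake -/
lemma layer_cake {t : ℝ} (ht : 0 < t) (X : ℝ≥0∞) :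
    X ^ t ≤ tw t * ∑' i : ℤ, (if tw i < X then tw (i * t) else 0) := by
  by_cases h0 : X = 0
  · subst h0; simp [ht]
  by_cases hX : X = ⊤
  · subst hX
    have : ∑' i : ℤ, (if tw i < ⊤ then tw (i * t) else 0) = ⊤ := by
      rw [eq_top_iff]
      have h1 : ∀ N : ℕ, (N:ℝ≥0∞) ≤ ∑' i : ℤ, (if tw i < ⊤ then tw (i * t) else 0) := by
        intro N
        have := ENNReal.sum_le_tsum (f := fun i : ℤ => (if tw i < ⊤ then tw (i * t) else 0))
          ((Finset.range N).map ⟨fun l : ℕ => (l:ℤ), Int.ofNat_injective⟩)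
        refine le_trans ?_ this
        rw [Finset.sum_map]
        calc (N:ℝ≥0∞) = ∑ _i ∈ Finset.range N, (1:ℝ≥0∞) := by simp
          _ ≤ _ := by
            apply Finset.sum_le_sum
            intro i _
            simp only [Function.Embedding.coeFn_mk, lt_top_iff_ne_top.2 (tw_ne_top _), if_true]
            apply one_le_tw; push_cast; positivity
      exact ENNReal.le_of_forall_nnreal_lt fun r _ => by
        obtain ⟨N, hN⟩ := exists_nat_ge r
        exact le_trans (by exact_mod_cast hN) (h1 N)
    rw [this, ENNReal.mul_top (tw_ne_zero _)]; exact le_top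
  obtain ⟨i, h1, h2⟩ := exists_tw_bracket' h0 hX
  calc X ^ t ≤ tw ((i:ℝ) + 1) ^ t := ENNReal.rpow_le_rpow h2 ht.le
    _ = tw t * (if tw i < X then tw (i * t) else 0) := by
        rw [if_pos h1, tw_rpow, ← tw_add]; congr 1; ring
    _ ≤ _ := by
        gcongr
        exact ENNReal.le_tsum (f := fun i : ℤ => (if tw i < X then tw (i * t) else 0)) i

/-- Constant of the strong type inequality. -/
noncomputable def Cmx (n : ℕ) (t : ℝ) : ℝ≥0∞ :=
  (vb n + 1) ^ t * (tw t * (5 ^ n * vb n * Cg (t - 1)))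

lemma Cmx_ne_top (n : ℕ) {t : ℝ} (ht : 1 < t) : Cmx n t ≠ ⊤ := by
  unfold Cmx
  have h1 := vb_ne_top n
  have h2 := Cg_ne_top (a := t - 1) (by linarith)
  have h3 := tw_ne_top t
  have h4 : (vb n + 1) ^ t ≠ ⊤ := ENNReal.rpow_ne_top_of_nonneg (by linarith) (by simp [h1])
  finiteness

/-- strong type (t,t) -/
lemma strong_type {n : ℕ} (hn : 0 < n) {t : ℝ} (ht : 1 < t) {u : Eu n → ℝ≥0∞}
    (hu : Measurable u) :
    ∫⁻ z, (mx u z) ^ t ≤ Cmx n t * ∫⁻ z, (u z) ^ t := by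
  set A : ℝ≥0∞ := vb n + 1 with hA
  have hA0 : A ≠ 0 := by simp [hA]
  have hAt : A ≠ ⊤ := by simp [hA, vb_ne_top]
  -- level sets
  have hlev : ∀ i : ℤ, volume {z | tw i < mx u z / A} ≤
      5 ^ n * vb n * tw (-i) * ∫⁻ y, ({y | tw i ≤ u y}.indicator u) y := by
    intro i
    have hsub : {z | tw i < mx u z / A} ⊆ {z | tw i < mx ({y | tw i ≤ u y}.indicator u) z} := by
      intro z hz
      simp only [Set.mem_ofPred_eq] at hz ⊢
      have h1 : mx u z ≤ mx ({y | tw i ≤ u y}.indicator u) z + vb n * tw i := by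
        apply iSup_le
        intro l
        calc av l u z ≤ tw (-(l * n)) * ∫⁻ y in closedBall z ((2:ℝ) ^ l),
              (({y | tw i ≤ u y}.indicator u) y + tw i) := by
              unfold av; gcongr with y
              by_cases h : tw i ≤ u y
              · rw [Set.indicator_of_mem (by exact h)]; exact le_self_add
              · exact (not_le.1 h).le.trans le_add_self
          _ = av l ({y | tw i ≤ u y}.indicator u) z + vb n * tw i := by
              rw [lintegral_add_right _ measurable_const, mul_add, setLIntegral_const,
                vol_closedBall_two]
              unfold av; congr 1
              calc tw (-(l * n)) * (tw i * (tw (l * n) * vb n))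
                  = (tw (l * n) * tw (-(l * n))) * (vb n * tw i) := by ring
                _ = _ := by rw [tw_mul_tw_neg, one_mul]
          _ ≤ _ := by gcongr; exact av_le_mx _ _ _
      have h2 : tw i * A < mx u z := by
        rwa [ENNReal.lt_div_iff_mul_lt (Or.inl hA0) (Or.inl hAt)] at hz
      by_contra hc
      push Not at hc
      have : mx u z ≤ tw i * A := by
        calc mx u z ≤ tw i + vb n * tw i := h1.trans (by gcongr)
          _ = tw i * A := by rw [hA]; ring
      exact absurd h2 (not_lt.2 this)
    refine (measure_mono hsub).trans ?_
    have := weak11 hn ({y | tw i ≤ u y}.indicator u) (tw_ne_zero i) (tw_ne_top i)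
    rwa [tw_inv] at this
  have hms : ∀ i : ℤ, MeasurableSet {y | tw i ≤ u y} := fun i => measurableSet_le measurable_const hu
  have hmm : Measurable fun z => mx u z / A := (measurable_mx hu).div_const _
  calc ∫⁻ z, (mx u z) ^ t = ∫⁻ z, A ^ t * (mx u z / A) ^ t := by
        congr 1; funext z
        rw [← ENNReal.mul_rpow_of_nonneg _ _ (by linarith), ENNReal.mul_div_cancel hA0 hAt]
    _ = A ^ t * ∫⁻ z, (mx u z / A) ^ t :=
        lintegral_const_mul' _ _ (ENNReal.rpow_ne_top_of_nonneg (by linarith) hAt)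
    _ ≤ A ^ t * ∫⁻ z, tw t * ∑' i : ℤ, (if tw i < mx u z / A then tw (i * t) else 0) := by
        gcongr with z; exact layer_cake (by linarith) _
    _ = A ^ t * (tw t * ∑' i : ℤ, tw (i * t) * volume {z | tw i < mx u z / A}) := by
        rw [lintegral_const_mul' _ _ (tw_ne_top _), lintegral_tsum]
        · congr 3; funext i
          have : (fun z => if tw i < mx u z / A then tw (i * t) else 0) =
              {z | tw i < mx u z / A}.indicator (fun _ => tw (i * t)) := by
            funext z; simp [Set.indicator_apply]
          rw [this, lintegral_indicator_const (measurableSet_lt measurable_const hmm)]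
        · intro i
          exact (Measurable.ite (measurableSet_lt measurable_const hmm)
            measurable_const measurable_const).aemeasurable
    _ ≤ A ^ t * (tw t * ∑' i : ℤ, tw (i * t) * (5 ^ n * vb n * tw (-i) *
          ∫⁻ y, ({y | tw i ≤ u y}.indicator u) y)) := by
        gcongr with i; exact hlev i
    _ = A ^ t * (tw t * (5 ^ n * vb n * ∫⁻ y, u y * ∑' i : ℤ,
          (if tw i ≤ u y then tw (i * (t - 1)) else 0))) := by
        congr 2
        rw [← lintegral_const_mul' _ _ (by have := vb_ne_top n; finiteness)]
        have : ∀ i : ℤ, tw (i * t) * (5 ^ n * vb n * tw (-i) *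
          ∫⁻ y, ({y | tw i ≤ u y}.indicator u) y) = ∫⁻ y, 5 ^ n * vb n * (u y *
            (if tw i ≤ u y then tw (i * (t - 1)) else 0)) := by
          intro i
          calc _ = (5 ^ n * vb n * tw (i * (t - 1))) * ∫⁻ y, ({y | tw i ≤ u y}.indicator u) y := by
                have : tw (i * (t - 1)) = tw (i * t) * tw (-i) := by
                  rw [← tw_add]; congr 1; ring
                rw [this]; ring
            _ = _ := by
                rw [← lintegral_const_mul' _ _
                  (by have := vb_ne_top n; have := tw_ne_top (i * (t-1)); finiteness)]
                congr 1; funext y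
                by_cases h : tw i ≤ u y
                · rw [if_pos h, Set.indicator_of_mem (by exact h)]; ring
                · rw [if_neg h, Set.indicator_of_notMem (by exact h)]; ring
        rw [tsum_congr this, ← lintegral_tsum]
        · congr 1; funext y
          rw [← ENNReal.tsum_mul_left, ← ENNReal.tsum_mul_left]
        · intro i
          refine Measurable.aemeasurable ?_
          exact (hu.mul (Measurable.ite (hms i) measurable_const measurable_const)).const_mul _
    _ ≤ A ^ t * (tw t * (5 ^ n * vb n * ∫⁻ y, Cg (t - 1) * (u y) ^ t)) := by
        gcongr A ^ t * (tw t * (5 ^ n * vb n * ?_))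
        refine lintegral_mono fun y => ?_
        calc u y * ∑' i : ℤ, (if tw i ≤ u y then tw (i * (t - 1)) else 0)
            ≤ u y * (Cg (t - 1) * (u y) ^ (t - 1)) := by gcongr; exact geom_small (by linarith) _
          _ = Cg (t - 1) * ((u y) ^ (1:ℝ) * (u y) ^ (t - 1)) := by rw [ENNReal.rpow_one]; ring
          _ = Cg (t - 1) * (u y) ^ t := by
              rw [← ENNReal.rpow_add_of_nonneg _ _ (by norm_num) (by linarith)]; congr 2; ring
    _ = _ := by
        rw [lintegral_const_mul' _ _ (Cg_ne_top (by linarith))]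
        unfold Cmx; ring

end HM

namespace HM

/-- mean value over a ball -/
noncomputable def bB {n : ℕ} (b : Eu n → ℝ) (c : Eu n) (r : ℝ) : ℝ := ⨍ y in closedBall c r, b y

/-- BMO seminorm at most one -/
def BMO1 {n : ℕ} (b : Eu n → ℝ) : Prop :=
  LocallyIntegrable b ∧ ∀ (c : Eu n) (r : ℝ), 0 < r →
    (⨍ x in closedBall c r, |b x - ⨍ y in closedBall c r, b y|) ≤ 1

lemma vol_cb_pos {n : ℕ} (c : Eu n) {r : ℝ} (hr : 0 < r) : volume (closedBall c r) ≠ 0 :=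
  (measure_closedBall_pos _ _ hr).ne'

lemma vol_cb_ne_top {n : ℕ} (c : Eu n) (r : ℝ) : volume (closedBall c r) ≠ ⊤ :=
  measure_closedBall_lt_top.ne

lemma integrableOn_sub {n : ℕ} {b : Eu n → ℝ} (hb : LocallyIntegrable b) (c : Eu n) (r a : ℝ) :
    IntegrableOn (fun x => b x - a) (closedBall c r) := by
  have h1 := hb.integrableOn_isCompact (isCompact_closedBall c r)
  exact h1.sub (integrableOn_const (vol_cb_ne_top c r))

lemma osc_le {n : ℕ} {b : Eu n → ℝ} (hb : BMO1 b) (c : Eu n) {r : ℝ} (hr : 0 < r) :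
    ∫⁻ x in closedBall c r, ‖b x - bB b c r‖ₑ ≤ volume (closedBall c r) := by
  have h1 := hb.2 c r hr
  have hi := integrableOn_sub hb.1 c r (bB b c r)
  rw [setAverage_eq] at h1
  have hv : 0 < (volume : Measure (Eu n)).real (closedBall c r) :=
    ENNReal.toReal_pos (vol_cb_pos c hr) (vol_cb_ne_top c r)
  rw [smul_eq_mul, inv_mul_le_iff₀ hv, mul_one] at h1
  rw [← ofReal_integral_norm_eq_lintegral_enorm hi]
  calc _ ≤ ENNReal.ofReal ((volume : Measure (Eu n)).real (closedBall c r)) :=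
        ENNReal.ofReal_le_ofReal h1
    _ = _ := ENNReal.ofReal_toReal (vol_cb_ne_top c r)

lemma mean_sub_le {n : ℕ} {b : Eu n → ℝ} (hb : LocallyIntegrable b) (c : Eu n) {r : ℝ} (hr : 0 < r)
    (a : ℝ) :
    ‖bB b c r - a‖ₑ * volume (closedBall c r) ≤ ∫⁻ x in closedBall c r, ‖b x - a‖ₑ := by
  have hv : 0 < (volume : Measure (Eu n)).real (closedBall c r) :=
    ENNReal.toReal_pos (vol_cb_pos c hr) (vol_cb_ne_top c r)
  have h1 : bB b c r - a = ((volume : Measure (Eu n)).real (closedBall c r))⁻¹ *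
      ∫ x in closedBall c r, (b x - a) := by
    rw [integral_sub (hb.integrableOn_isCompact (isCompact_closedBall c r))
      (integrableOn_const (vol_cb_ne_top c r)), setIntegral_const, bB, setAverage_eq]
    simp only [smul_eq_mul]
    field_simp
  rw [h1, enorm_mul]
  have h2 : ‖((volume : Measure (Eu n)).real (closedBall c r))⁻¹‖ₑ * volume (closedBall c r) = 1 := by
    rw [Real.enorm_of_nonneg (inv_nonneg.2 hv.le), ENNReal.ofReal_inv_of_pos hv]
    have : ENNReal.ofReal ((volume : Measure (Eu n)).real (closedBall c r)) =
      volume (closedBall c r) := ENNReal.ofReal_toReal (vol_cb_ne_top c r)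
    rw [this, ENNReal.inv_mul_cancel (vol_cb_pos c hr) (vol_cb_ne_top c r)]
  calc _ = (‖((volume : Measure (Eu n)).real (closedBall c r))⁻¹‖ₑ * volume (closedBall c r)) *
        ‖∫ x in closedBall c r, (b x - a)‖ₑ := by ring
    _ = ‖∫ x in closedBall c r, (b x - a)‖ₑ := by rw [h2, one_mul]
    _ ≤ _ := enorm_integral_le_lintegral_enorm _

lemma mean_diff_le {n : ℕ} {b : Eu n → ℝ} (hb : BMO1 b) {c c' : Eu n} {r r' : ℝ} (hr : 0 < r)
    (hr' : 0 < r') (hsub : closedBall c r ⊆ closedBall c' r') :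
    ‖bB b c r - bB b c' r'‖ₑ * volume (closedBall c r) ≤ volume (closedBall c' r') :=
  (mean_sub_le hb.1 c hr _).trans ((lintegral_mono_set hsub).trans (osc_le hb c' hr'))

lemma vol_scale {n : ℕ} (c c' : Eu n) {r : ℝ} (hr : 0 ≤ r) (a : ℕ) :
    volume (closedBall c (a * r)) = a ^ n * volume (closedBall c' r) := by
  rw [vol_closedBall _ (by positivity), vol_closedBall _ hr, ENNReal.ofReal_mul (by positivity),
    mul_pow, ENNReal.ofReal_natCast, mul_assoc]

/-- doubling of means -/
lemma mean_scale_le {n : ℕ} {b : Eu n → ℝ} (hb : BMO1 b) (c : Eu n) {r : ℝ} (hr : 0 < r)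
    (a : ℕ) (ha : 1 ≤ a) : ‖bB b c r - bB b c (a * r)‖ₑ ≤ a ^ n := by
  have ha' : (1:ℝ) ≤ a := by exact_mod_cast ha
  have h := mean_diff_le hb hr (r' := a * r) (c := c) (c' := c) (by positivity)
    (closedBall_subset_closedBall (by nlinarith))
  rw [vol_scale c c hr.le] at h
  exact (ENNReal.mul_le_mul_iff_left (vol_cb_pos c hr) (vol_cb_ne_top c r)).1 h

/-- constant -/
noncomputable def D9 (n : ℕ) : ℝ≥0∞ := (1 + 9 ^ n) * 9 ^ n

lemma big_osc {n : ℕ} {b : Eu n → ℝ} (hb : BMO1 b) (c : Eu n) {r : ℝ} (hr : 0 < r) :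
    ∫⁻ x in closedBall c (9 * r), ‖b x - bB b c r‖ₑ ≤ D9 n * volume (closedBall c r) := by
  have h9 : volume (closedBall c (9 * r)) = 9 ^ n * volume (closedBall c r) := by
    have := vol_scale c c hr.le 9; exact_mod_cast this
  calc ∫⁻ x in closedBall c (9 * r), ‖b x - bB b c r‖ₑ
      ≤ ∫⁻ x in closedBall c (9 * r), (‖b x - bB b c (9 * r)‖ₑ + 9 ^ n) := by
        refine lintegral_mono fun x => ?_
        have h2 : ‖bB b c (9 * r) - bB b c r‖ₑ ≤ 9 ^ n := by
          have := mean_scale_le hb c hr 9 (by norm_num)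
          rw [← enorm_neg, neg_sub]; exact_mod_cast this
        calc ‖b x - bB b c r‖ₑ = ‖(b x - bB b c (9 * r)) + (bB b c (9 * r) - bB b c r)‖ₑ := by
              congr 1; ring
          _ ≤ _ := (enorm_add_le _ _).trans (by gcongr)
    _ ≤ volume (closedBall c (9 * r)) + 9 ^ n * volume (closedBall c (9 * r)) := by
        rw [lintegral_add_right _ measurable_const, setLIntegral_const]
        gcongr; exact osc_le hb c (by positivity)
    _ = _ := by rw [h9, D9]; ring

/-- John–Nirenberg step constant -/
noncomputable def K0 (n : ℕ) : ℝ≥0∞ := 2 * 9 ^ n * D9 n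

lemma K0_ne_top (n : ℕ) : K0 n ≠ ⊤ := by unfold K0 D9; finiteness

lemma one_le_D9 (n : ℕ) : 1 ≤ D9 n := by
  unfold D9
  have h : (1:ℝ≥0∞) ≤ 9 ^ n := one_le_pow₀ (by norm_num)
  calc (1:ℝ≥0∞) = 1 * 1 := by simp
    _ ≤ _ := by gcongr; exact le_self_add

lemma D9_le_K0 (n : ℕ) : D9 n ≤ K0 n := by
  unfold K0
  have h : (1:ℝ≥0∞) ≤ 9 ^ n := one_le_pow₀ (by norm_num)
  calc D9 n = 1 * 1 * D9 n := by simp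
    _ ≤ _ := by gcongr; norm_num

lemma jn_step {n : ℕ} {b : Eu n → ℝ} (hb : BMO1 b) (L φ : ℝ≥0∞) (hφt : φ ≠ ⊤)
    (h : ∀ (c : Eu n) (r : ℝ), 0 < r →
      volume (closedBall c r ∩ {x | L < ‖b x - bB b c r‖ₑ}) ≤ φ * volume (closedBall c r)) :
    ∀ (c : Eu n) (r : ℝ), 0 < r →
      volume (closedBall c r ∩ {x | L + K0 n < ‖b x - bB b c r‖ₑ}) ≤
        φ * 2⁻¹ * volume (closedBall c r) := by
  intro c R hR
  set a := bB b c R with ha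
  let ρ : ℕ → ℝ := fun i => 8 * R * (1/2) ^ i
  have hρ : ∀ i, 0 < ρ i := fun i => by positivity
  let P : Eu n → ℕ → Prop := fun x i =>
    K0 n * volume (closedBall x (ρ i)) < ∫⁻ y in closedBall x (ρ i), ‖b y - a‖ₑ
  set S : Set (Eu n) := {x | x ∈ closedBall c R ∧ ∃ i, P x i} with hS
  have hKt := K0_ne_top n
  -- no large scales
  have hlarge : ∀ x ∈ closedBall c R, ∀ i ≤ 3, ¬ P x i := by
    intro x hx i hi hP
    have h8 : ρ i ≤ 8 * R := by
      have : (1/2:ℝ) ^ i ≤ 1 := pow_le_one₀ (by norm_num) (by norm_num)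
      simp only [ρ]; nlinarith
    have h1 : R ≤ ρ i := by
      have : (1/2:ℝ) ^ 3 ≤ (1/2:ℝ) ^ i := pow_le_pow_of_le_one (by norm_num) (by norm_num) hi
      simp only [ρ]; nlinarith
    have hsub : closedBall x (ρ i) ⊆ closedBall c (9 * R) := by
      apply closedBall_subset_closedBall'
      have : dist x c ≤ R := hx
      linarith
    have hv : volume (closedBall c R) ≤ volume (closedBall x (ρ i)) := by
      rw [vol_closedBall _ hR.le, vol_closedBall _ (hρ i).le]; gcongr
    have : ∫⁻ y in closedBall x (ρ i), ‖b y - a‖ₑ ≤ K0 n * volume (closedBall x (ρ i)) :=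
      calc _ ≤ ∫⁻ y in closedBall c (9 * R), ‖b y - a‖ₑ := lintegral_mono_set hsub
        _ ≤ D9 n * volume (closedBall c R) := big_osc hb c hR
        _ ≤ _ := by gcongr; exact D9_le_K0 n
    exact absurd hP (not_lt.2 this)
  -- choose the first scale
  have hfirst : ∀ x ∈ S, ∃ i, P x (i + 4) ∧ ¬ P x (i + 1) := by
    classical
    intro x hx
    have hex := hx.2
    have h4 : 4 ≤ Nat.find hex := by
      by_contra hc
      exact hlarge x hx.1 (Nat.find hex) (by omega) (Nat.find_spec hex)
    refine ⟨Nat.find hex - 4, ?_, ?_⟩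
    · rw [Nat.sub_add_cancel h4]; exact Nat.find_spec hex
    · exact Nat.find_min hex (by omega)
  choose! I hI using hfirst
  have hρ8 : ∀ i, ρ (i + 1) = (8:ℕ) * ρ (i + 4) := by
    intro i; simp only [ρ, pow_add]; push_cast; ring
  obtain ⟨u, hu, huc, hd, hcov⟩ := vitali S (fun x => ρ (I x + 4)) R (by
    intro x _
    refine ⟨hρ _, ?_⟩
    have : (1/2:ℝ) ^ (I x + 4) ≤ (1/2:ℝ) ^ 3 :=
      pow_le_pow_of_le_one (by norm_num) (by norm_num) (by omega)
    simp only [ρ]; nlinarith)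
  have huct : Countable u := huc.to_subtype
  -- Lebesgue differentiation
  have hleb : ∀ᵐ x, x ∈ closedBall c R ∩ {x | L + K0 n < ‖b x - a‖ₑ} → x ∈ S := by
    have hint : LocallyIntegrable (fun x => ‖b x - a‖) := by
      have : LocallyIntegrable (fun x => b x - a) := hb.1.sub (locallyIntegrable_const a)
      exact fun x => (this x).norm
    filter_upwards [IsUnifLocDoublingMeasure.ae_tendsto_average volume hint 0] with x hx hxm
    refine ⟨hxm.1, ?_⟩
    have htend : Filter.Tendsto ρ Filter.atTop (nhdsWithin 0 (Set.Ioi 0)) := by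
      rw [tendsto_nhdsWithin_iff]
      refine ⟨?_, Filter.Eventually.of_forall hρ⟩
      have := (tendsto_pow_atTop_nhds_zero_of_lt_one (r := (1/2:ℝ)) (by norm_num)
        (by norm_num)).const_mul (8 * R)
      simpa [ρ] using this
    have hlim := hx (fun _ : ℕ => x) ρ htend (Filter.Eventually.of_forall fun i => by simp)
    have hlt : (K0 n).toReal < ‖b x - a‖ := by
      have h1 : K0 n < ‖b x - a‖ₑ := lt_of_le_of_lt le_add_self hxm.2
      rw [← ofReal_norm] at h1
      exact (ENNReal.lt_ofReal_iff_toReal_lt hKt).1 h1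
    obtain ⟨i, hi⟩ := (hlim.eventually (lt_mem_nhds hlt)).exists
    refine ⟨i, ?_⟩
    have hii : IntegrableOn (fun y => b y - a) (closedBall x (ρ i)) := integrableOn_sub hb.1 _ _ _
    have hv : 0 < (volume : Measure (Eu n)).real (closedBall x (ρ i)) :=
      ENNReal.toReal_pos (vol_cb_pos x (hρ i)) (vol_cb_ne_top x _)
    rw [setAverage_eq, smul_eq_mul, ← div_eq_inv_mul, lt_div_iff₀ hv] at hi
    show K0 n * volume (closedBall x (ρ i)) < ∫⁻ y in closedBall x (ρ i), ‖b y - a‖ₑ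
    rw [← ofReal_integral_norm_eq_lintegral_enorm hii]
    rw [ENNReal.lt_ofReal_iff_toReal_lt (ENNReal.mul_ne_top hKt (vol_cb_ne_top _ _)),
      ENNReal.toReal_mul]
    exact hi
  -- selected balls
  have hsel : ∀ x ∈ u, volume (closedBall x (5 * ρ (I x + 4)) ∩ {y | L + K0 n < ‖b y - a‖ₑ}) ≤
      φ * 8 ^ n * (K0 n)⁻¹ * ∫⁻ y in closedBall x (ρ (I x + 4)), ‖b y - a‖ₑ := by
    intro x hx
    have hP := (hI x (hu hx)).1
    have hnP := (hI x (hu hx)).2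
    have hm : ‖bB b x (ρ (I x + 1)) - a‖ₑ ≤ K0 n := by
      have h1 := mean_sub_le hb.1 x (hρ (I x + 1)) a
      have h2 := h1.trans (not_lt.1 hnP)
      exact (ENNReal.mul_le_mul_iff_left (vol_cb_pos x (hρ _)) (vol_cb_ne_top x _)).1 h2
    calc _ ≤ volume (closedBall x (ρ (I x + 1)) ∩ {y | L < ‖b y - bB b x (ρ (I x + 1))‖ₑ}) := by
          apply measure_mono
          intro y hy
          refine ⟨?_, ?_⟩
          · refine closedBall_subset_closedBall ?_ hy.1
            have h8 := hρ8 (I x)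
            push_cast at h8
            have := hρ (I x + 4); linarith
          · have h1 : L + K0 n < ‖b y - a‖ₑ := hy.2
            by_contra hc
            have hc' : ‖b y - bB b x (ρ (I x + 1))‖ₑ ≤ L := not_lt.1 hc
            have : ‖b y - a‖ₑ ≤ L + K0 n :=
              calc ‖b y - a‖ₑ = ‖(b y - bB b x (ρ (I x + 1))) + (bB b x (ρ (I x + 1)) - a)‖ₑ := by
                    congr 1; ring
                _ ≤ _ := (enorm_add_le _ _).trans (by gcongr)
            exact absurd h1 (not_lt.2 this)
      _ ≤ φ * volume (closedBall x (ρ (I x + 1))) := h x _ (hρ _)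
      _ = φ * 8 ^ n * volume (closedBall x (ρ (I x + 4))) := by
          rw [hρ8, vol_scale x x (hρ _).le]; push_cast; ring
      _ ≤ φ * 8 ^ n * ((K0 n)⁻¹ * ∫⁻ y in closedBall x (ρ (I x + 4)), ‖b y - a‖ₑ) := by
          gcongr
          have hK00 : K0 n ≠ 0 := (lt_of_lt_of_le one_pos ((one_le_D9 n).trans (D9_le_K0 n))).ne'
          rw [← ENNReal.div_eq_inv_mul, ENNReal.le_div_iff_mul_le (Or.inl hK00) (Or.inl hKt),
            mul_comm]
          exact hP.le
      _ = _ := by ring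
  calc _ ≤ volume (S ∩ {x | L + K0 n < ‖b x - a‖ₑ}) := by
        apply measure_mono_ae
        filter_upwards [hleb] with x hx hxm
        exact ⟨hx hxm, hxm.2⟩
    _ ≤ volume (⋃ x ∈ u, (closedBall x (5 * ρ (I x + 4)) ∩ {y | L + K0 n < ‖b y - a‖ₑ})) := by
        apply measure_mono
        intro y hy
        obtain ⟨x, hx, hxy⟩ := Set.mem_iUnion₂.1 (hcov hy.1)
        exact Set.mem_iUnion₂.2 ⟨x, hx, hxy, hy.2⟩
    _ ≤ ∑' x : u, volume (closedBall (x:Eu n) (5 * ρ (I x + 4)) ∩ {y | L + K0 n < ‖b y - a‖ₑ}) :=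
        measure_biUnion_le _ huc _
    _ ≤ ∑' x : u, φ * 8 ^ n * (K0 n)⁻¹ *
          ∫⁻ y in closedBall (x:Eu n) (ρ (I x + 4)), ‖b y - a‖ₑ :=
        ENNReal.tsum_le_tsum fun x => hsel x x.2
    _ = φ * 8 ^ n * (K0 n)⁻¹ * ∫⁻ y in ⋃ x ∈ u, closedBall x (ρ (I x + 4)), ‖b y - a‖ₑ := by
        rw [ENNReal.tsum_mul_left, lintegral_biUnion huc (fun _ _ => measurableSet_closedBall) hd]
    _ ≤ φ * 8 ^ n * (K0 n)⁻¹ * ∫⁻ y in closedBall c (9 * R), ‖b y - a‖ₑ := by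
        gcongr
        refine Set.iUnion₂_subset fun x hx => closedBall_subset_closedBall' ?_
        have h1 : dist x c ≤ R := (hu hx).1
        have : (1/2:ℝ) ^ (I x + 4) ≤ 1 := pow_le_one₀ (by norm_num) (by norm_num)
        simp only [ρ]; nlinarith
    _ ≤ φ * 9 ^ n * (K0 n)⁻¹ * (D9 n * volume (closedBall c R)) := by
        gcongr
        · norm_num
        · exact big_osc hb c hR
    _ = φ * 2⁻¹ * volume (closedBall c R) := by
        have hD0 : D9 n ≠ 0 := (lt_of_lt_of_le one_pos (one_le_D9 n)).ne'
        have hDt : D9 n ≠ ⊤ := by unfold D9; finiteness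
        have h90 : (9:ℝ≥0∞) ^ n ≠ 0 := by positivity
        have h9t : (9:ℝ≥0∞) ^ n ≠ ⊤ := by finiteness
        have : (K0 n)⁻¹ = 2⁻¹ * (9 ^ n)⁻¹ * (D9 n)⁻¹ := by
          unfold K0
          rw [ENNReal.mul_inv (Or.inr hDt) (Or.inr hD0), ENNReal.mul_inv (Or.inr h9t) (Or.inr h90)]
        rw [this]
        calc φ * 9 ^ n * (2⁻¹ * (9 ^ n)⁻¹ * (D9 n)⁻¹) * (D9 n * volume (closedBall c R))
            = φ * 2⁻¹ * (9 ^ n * (9 ^ n)⁻¹) * (D9 n * (D9 n)⁻¹) * volume (closedBall c R) := by ring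
          _ = _ := by
            rw [ENNReal.mul_inv_cancel h90 h9t, ENNReal.mul_inv_cancel hD0 hDt]; ring

lemma jn_iter {n : ℕ} {b : Eu n → ℝ} (hb : BMO1 b) (l : ℕ) :
    ∀ (c : Eu n) (r : ℝ), 0 < r →
      volume (closedBall c r ∩ {x | l * K0 n < ‖b x - bB b c r‖ₑ}) ≤
        (2⁻¹) ^ l * volume (closedBall c r) := by
  induction l with
  | zero =>
    intro c r _
    simp only [pow_zero, one_mul]
    exact measure_mono Set.inter_subset_left
  | succ l ih =>
    have h := jn_step hb _ _ (by finiteness) ih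
    intro c r hr
    have h2 := h c r hr
    rw [pow_succ]
    convert h2 using 6
    push_cast; ring

/-- moment constant -/
noncomputable def Cjn (n N : ℕ) : ℝ≥0∞ := ∑' l : ℕ, ((l + 1) * K0 n) ^ N * (2⁻¹) ^ l

lemma Cjn_ne_top (n N : ℕ) : Cjn n N ≠ ⊤ := by
  have h1 := decay_sum_ne_top N (ε := 1) one_pos
  have h2 : ∑' l : ℕ, ((1 + (l : ℝ≥0∞)) ^ N * tw (-(l * 1))) ≠ ⊤ := by
    refine ne_top_of_le_ne_top h1 ?_
    have := ENNReal.tsum_comp_le_tsum_of_injective (f := fun l : ℕ => (l:ℤ)) Int.ofNat_injective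
      (fun l : ℤ => ((1 + (l.natAbs : ℝ≥0∞)) ^ N * tw (-(l.natAbs * 1))))
    simpa using this
  have h3 : Cjn n N = (K0 n) ^ N * ∑' l : ℕ, ((1 + (l : ℝ≥0∞)) ^ N * tw (-(l * 1))) := by
    unfold Cjn
    rw [← ENNReal.tsum_mul_left]
    congr 1; funext l
    have : (2⁻¹ : ℝ≥0∞) ^ l = tw (-(l * 1)) := by
      rw [← tw_inv, mul_one, tw, ENNReal.rpow_natCast, ENNReal.inv_pow]
    rw [this, mul_pow, add_comm (1:ℝ≥0∞)]; ring
  rw [h3]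
  have := K0_ne_top n
  finiteness

/-- John–Nirenberg moments -/
lemma jn_moment {n : ℕ} {b : Eu n → ℝ} (hb : BMO1 b) (hbm : Measurable b) (N : ℕ) (c : Eu n) {r : ℝ}
    (hr : 0 < r) :
    ∫⁻ x in closedBall c r, ‖b x - bB b c r‖ₑ ^ N ≤ (1 + Cjn n N) * volume (closedBall c r) := by
  have hms : ∀ l : ℕ, MeasurableSet {x | l * K0 n < ‖b x - bB b c r‖ₑ} := fun l =>
    measurableSet_lt measurable_const (by fun_prop)
  have hK00 : K0 n ≠ 0 := (lt_of_lt_of_le one_pos ((one_le_D9 n).trans (D9_le_K0 n))).ne'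
  have hpt : ∀ x, ‖b x - bB b c r‖ₑ ^ N ≤ 1 + ∑' l : ℕ,
      {x | l * K0 n < ‖b x - bB b c r‖ₑ}.indicator (fun _ => ((l + 1) * K0 n) ^ N) x := by
    intro x
    by_cases h0 : ‖b x - bB b c r‖ₑ = 0
    · rw [h0]
      refine le_trans ?_ le_self_add
      exact pow_le_one₀ (by simp) (by simp)
    refine le_trans ?_ le_add_self
    set Y := ‖b x - bB b c r‖ₑ with hY
    have hYt : Y ≠ ⊤ := enorm_ne_top
    have hex : ∃ l : ℕ, Y ≤ (l + 1) * K0 n := by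
      obtain ⟨l, hl⟩ := ENNReal.exists_nat_gt hYt
      refine ⟨l, hl.le.trans ?_⟩
      calc (l:ℝ≥0∞) ≤ (l + 1) * 1 := by simp
        _ ≤ _ := by gcongr; exact (one_le_D9 n).trans (D9_le_K0 n)
    classical
    have hs := Nat.find_spec hex
    have hlow : (Nat.find hex : ℝ≥0∞) * K0 n < Y := by
      by_cases hz : Nat.find hex = 0
      · rw [hz]; simpa using pos_iff_ne_zero.2 h0
      · have := Nat.find_min hex (m := Nat.find hex - 1) (by omega)
        rw [not_le] at this
        convert this using 2
        have h1 : Nat.find hex = (Nat.find hex - 1) + 1 := by omega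
        exact_mod_cast h1
    calc Y ^ N ≤ ((Nat.find hex + 1) * K0 n) ^ N := by gcongr
      _ = {x | (Nat.find hex : ℕ) * K0 n < ‖b x - bB b c r‖ₑ}.indicator
          (fun _ => (((Nat.find hex : ℕ) + 1) * K0 n) ^ N) x := by
          rw [Set.indicator_of_mem]; exact hlow
      _ ≤ _ := ENNReal.le_tsum (f := fun l : ℕ => {x | l * K0 n < ‖b x - bB b c r‖ₑ}.indicator
          (fun _ => (((l:ℝ≥0∞) + 1) * K0 n) ^ N) x) (Nat.find hex)
  calc _ ≤ ∫⁻ x in closedBall c r, (1 + ∑' l : ℕ,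
      {x | l * K0 n < ‖b x - bB b c r‖ₑ}.indicator (fun _ => ((l + 1) * K0 n) ^ N) x) :=
        lintegral_mono hpt
    _ = volume (closedBall c r) + ∑' l : ℕ, ((l + 1) * K0 n) ^ N *
        volume (closedBall c r ∩ {x | l * K0 n < ‖b x - bB b c r‖ₑ}) := by
        rw [lintegral_add_left measurable_const, setLIntegral_const, one_mul, lintegral_tsum]
        · congr 2; funext l
          rw [lintegral_indicator_const (hms l), Measure.restrict_apply (hms l), Set.inter_comm]
        · intro l; exact (measurable_const.indicator (hms l)).aemeasurable
    _ ≤ volume (closedBall c r) + ∑' l : ℕ, ((l + 1) * K0 n) ^ N *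
        ((2⁻¹) ^ l * volume (closedBall c r)) := by
        gcongr with l; exact jn_iter hb l c r hr
    _ = _ := by
        rw [add_mul, one_mul, Cjn, ← ENNReal.tsum_mul_right]
        congr 2; funext l; ring

end HM

namespace HM

lemma add3_pow_le (a b c : ℝ≥0∞) (M : ℕ) : (a + b + c) ^ M ≤ 3 ^ M * (a ^ M + b ^ M + c ^ M) := by
  have h : a + b + c ≤ 3 * max (max a b) c := by
    have h1 : a ≤ max (max a b) c := (le_max_left _ _).trans (le_max_left _ _)
    have h2 : b ≤ max (max a b) c := (le_max_right _ _).trans (le_max_left _ _)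
    have h3 : c ≤ max (max a b) c := le_max_right _ _
    calc a + b + c ≤ max (max a b) c + max (max a b) c + max (max a b) c := by gcongr
      _ = _ := by ring
  calc (a + b + c) ^ M ≤ (3 * max (max a b) c) ^ M := by gcongr
    _ = 3 ^ M * (max (max a b) c) ^ M := mul_pow _ _ _
    _ ≤ _ := by
      gcongr
      rcases max_choice (max a b) c with h | h
      · rw [h]
        rcases max_choice a b with h' | h'
        · rw [h', add_assoc]; exact le_self_add
        · rw [h', add_right_comm]; exact le_add_self
      · rw [h]; exact le_add_self

/-- double moments over two balls -/
lemma double_moment {n : ℕ} {b : Eu n → ℝ} (hb : BMO1 b) (hbm : Measurable b) (M : ℕ)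
    (c c' : Eu n) {r r' : ℝ} (hr : 0 < r) (hr' : 0 < r') :
    ∫⁻ x in closedBall c r, ∫⁻ y in closedBall c' r', ‖b x - b y‖ₑ ^ M ≤
      3 ^ M * (2 * (1 + Cjn n M) + ‖bB b c r - bB b c' r'‖ₑ ^ M) *
        (volume (closedBall c r) * volume (closedBall c' r')) := by
  set B := closedBall c r
  set B' := closedBall c' r'
  set D := ‖bB b c r - bB b c' r'‖ₑ
  calc _ ≤ ∫⁻ x in B, ∫⁻ y in B', 3 ^ M * (‖b x - bB b c r‖ₑ ^ M + D ^ M +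
            ‖b y - bB b c' r'‖ₑ ^ M) := by
        refine lintegral_mono fun x => lintegral_mono fun y => ?_
        refine le_trans ?_ (add3_pow_le _ _ _ _)
        gcongr
        calc ‖b x - b y‖ₑ = ‖(b x - bB b c r) + (bB b c r - bB b c' r') + -(b y - bB b c' r')‖ₑ := by
              congr 1; ring
          _ ≤ _ := by
              refine (enorm_add_le _ _).trans ?_
              rw [enorm_neg]
              gcongr
              exact enorm_add_le _ _
    _ = 3 ^ M * ∫⁻ x in B, ((‖b x - bB b c r‖ₑ ^ M + D ^ M) * volume B' +
            ∫⁻ y in B', ‖b y - bB b c' r'‖ₑ ^ M) := by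
        rw [← lintegral_const_mul' _ _ (by finiteness)]
        congr 1; funext x
        rw [lintegral_const_mul' _ _ (by finiteness), lintegral_add_left measurable_const,
          setLIntegral_const]
    _ = 3 ^ M * ((∫⁻ x in B, ‖b x - bB b c r‖ₑ ^ M) * volume B' + D ^ M * volume B * volume B' +
            (∫⁻ y in B', ‖b y - bB b c' r'‖ₑ ^ M) * volume B) := by
        rw [lintegral_add_right _ measurable_const, setLIntegral_const,
          lintegral_mul_const' _ _ (vol_cb_ne_top _ _), lintegral_add_right _ measurable_const,
          setLIntegral_const, add_mul]
    _ ≤ 3 ^ M * (((1 + Cjn n M) * volume B) * volume B' + D ^ M * volume B * volume B' +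
            ((1 + Cjn n M) * volume B') * volume B) := by
        gcongr
        · exact jn_moment hb hbm M c hr
        · exact jn_moment hb hbm M c' hr'
    _ = _ := by ring

/-- double moment constant -/
noncomputable def Cw (n M : ℕ) : ℝ≥0∞ := 3 ^ M * (2 * (1 + Cjn n M) + (2 ^ n) ^ M + 1)

lemma Cw_ne_top (n M : ℕ) : Cw n M ≠ ⊤ := by
  have := Cjn_ne_top n M
  unfold Cw; finiteness

lemma double_moment_ball {n : ℕ} {b : Eu n → ℝ} (hb : BMO1 b) (hbm : Measurable b) (M : ℕ)
    (c : Eu n) {r : ℝ} (hr : 0 < r) :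
    ∫⁻ x in closedBall c r, ∫⁻ y in closedBall c r, ‖b x - b y‖ₑ ^ M ≤
      Cw n M * (volume (closedBall c r) * volume (closedBall c r)) := by
  refine (double_moment hb hbm M c c hr hr).trans ?_
  rw [sub_self, enorm_zero]
  refine mul_le_mul' ?_ le_rfl
  unfold Cw
  refine mul_le_mul' le_rfl ?_
  rw [add_assoc]
  refine add_le_add le_rfl ?_
  exact (pow_le_one₀ (by simp) (by simp)).trans le_add_self

lemma mean_dyadic_nat {n : ℕ} {b : Eu n → ℝ} (hb : BMO1 b) (k : ℤ) (l : ℕ) :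
    ‖bB b 0 ((2:ℝ) ^ k) - bB b 0 ((2:ℝ) ^ (k + l))‖ₑ ≤ l * 2 ^ n := by
  induction l with
  | zero => simp
  | succ l ih =>
    have h := mean_scale_le hb 0 (r := (2:ℝ) ^ (k + l)) (by positivity) 2 (by norm_num)
    have e : ((2:ℕ):ℝ) * (2:ℝ) ^ (k + l) = (2:ℝ) ^ (k + ((l + 1 : ℕ):ℤ)) := by
      push_cast; rw [← add_assoc, zpow_add_one₀ (by norm_num)]; ring
    rw [e] at h
    calc _ = ‖(bB b 0 ((2:ℝ) ^ k) - bB b 0 ((2:ℝ) ^ (k + l))) +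
          (bB b 0 ((2:ℝ) ^ (k + l)) - bB b 0 ((2:ℝ) ^ (k + ((l + 1 : ℕ):ℤ))))‖ₑ := by
          congr 1; ring
      _ ≤ l * 2 ^ n + 2 ^ n := (enorm_add_le _ _).trans (by gcongr; exact_mod_cast h)
      _ = _ := by push_cast; ring

lemma mean_dyadic {n : ℕ} {b : Eu n → ℝ} (hb : BMO1 b) (k j : ℤ) :
    ‖bB b 0 ((2:ℝ) ^ k) - bB b 0 ((2:ℝ) ^ j)‖ₑ ≤ (j - k).natAbs * 2 ^ n := by
  rcases le_total k j with h | h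
  · have := mean_dyadic_nat hb k (j - k).natAbs
    rwa [show k + ((j - k).natAbs : ℤ) = j by omega] at this
  · have := mean_dyadic_nat hb j (j - k).natAbs
    rw [show j + ((j - k).natAbs : ℤ) = k by omega] at this
    rwa [← enorm_neg, neg_sub]

lemma double_moment_dyadic {n : ℕ} {b : Eu n → ℝ} (hb : BMO1 b) (hbm : Measurable b) (M : ℕ)
    (k j : ℤ) :
    ∫⁻ x in closedBall (0:Eu n) ((2:ℝ) ^ k), ∫⁻ y in closedBall (0:Eu n) ((2:ℝ) ^ j),
        ‖b x - b y‖ₑ ^ M ≤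
      Cw n M * (1 + ((j - k).natAbs : ℝ≥0∞)) ^ M *
        (volume (closedBall (0:Eu n) ((2:ℝ) ^ k)) * volume (closedBall (0:Eu n) ((2:ℝ) ^ j))) := by
  refine (double_moment hb hbm M 0 0 (by positivity) (by positivity)).trans ?_
  refine mul_le_mul' ?_ le_rfl
  unfold Cw
  rw [mul_assoc]
  refine mul_le_mul' le_rfl ?_
  set t : ℝ≥0∞ := ((j - k).natAbs : ℝ≥0∞)
  have ht : (1:ℝ≥0∞) ≤ (1 + t) ^ M := one_le_pow₀ le_self_add
  calc _ ≤ 2 * (1 + Cjn n M) * 1 + (t * 2 ^ n) ^ M := by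
        rw [mul_one]; gcongr; exact mean_dyadic hb k j
    _ ≤ 2 * (1 + Cjn n M) * (1 + t) ^ M + ((1 + t) * 2 ^ n) ^ M := by
        gcongr; exact le_add_self
    _ ≤ _ := by
        rw [mul_pow, add_mul, add_mul, mul_comm ((1 + t) ^ M) ((2 ^ n) ^ M)]
        exact le_self_add

end HM

namespace HM

/-- enlarged annulus -/
def Ek (n : ℕ) (k : ℤ) : Set (Eu n) := {x | (2:ℝ) ^ (k - 2) ≤ ‖x‖ ∧ ‖x‖ ≤ (2:ℝ) ^ (k + 2)}

lemma log2_pos : 0 < Real.log 2 := Real.log_pos (by norm_num)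
lemma log2_le : Real.log 2 ≤ 1 := by
  have := Real.log_le_sub_one_of_pos (x := 2) (by norm_num); linarith

lemma c1_use {n : ℕ} {q : Eu n → ℝ} {C : ℝ} (hC : 0 < C)
    (h : ∀ x y : Eu n, dist x y ≤ 1/2 → |q x - q y| ≤ C / (-Real.log (dist x y)))
    (x y : Eu n) (i : ℤ) (hi : i ≤ -1) (hd : dist x y ≤ (2:ℝ) ^ i) :
    |q x - q y| * (-(i:ℝ)) ≤ C / Real.log 2 := by
  have hi' : (i:ℝ) ≤ -1 := by exact_mod_cast hi
  rcases eq_or_ne x y with rfl | hxy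
  · rw [sub_self, abs_zero, zero_mul]; have := log2_pos; positivity
  have hdp : 0 < dist x y := dist_pos.2 hxy
  have h2 : (2:ℝ) ^ i ≤ 1/2 := by
    calc (2:ℝ) ^ i ≤ 2 ^ (-1:ℤ) := zpow_le_zpow_right₀ (by norm_num) hi
      _ = _ := by norm_num
  have h1 := h x y (hd.trans h2)
  have hl : Real.log (dist x y) ≤ i * Real.log 2 := by
    rw [← Real.log_zpow]; exact Real.log_le_log hdp hd
  have hl2 := log2_pos
  have hneg : -(i:ℝ) * Real.log 2 ≤ -Real.log (dist x y) := by linarith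
  have hp : 0 < -(i:ℝ) * Real.log 2 := by nlinarith
  rw [le_div_iff₀ (by linarith)] at h1
  rw [le_div_iff₀ hl2]
  have := abs_nonneg (q x - q y)
  nlinarith

lemma c2_use {n : ℕ} {q : Eu n → ℝ} {C : ℝ} (hC : 0 < C)
    (h : ∀ x y : Eu n, ‖x‖ ≤ ‖y‖ → |q x - q y| ≤ C / Real.log (Real.exp 1 + ‖x‖))
    (x y : Eu n) (k : ℤ) (hk : 0 ≤ k) (hx : (2:ℝ) ^ (k - 2) ≤ ‖x‖) (hy : (2:ℝ) ^ (k - 2) ≤ ‖y‖) :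
    |q x - q y| * k ≤ 3 * C / Real.log 2 := by
  wlog hxy : ‖x‖ ≤ ‖y‖ generalizing x y
  · rw [abs_sub_comm]; exact this y x hy hx (not_le.1 hxy).le
  have h1 := h x y hxy
  have hk' : (0:ℝ) ≤ k := by exact_mod_cast hk
  have hl2 := log2_pos
  have hl2' := log2_le
  set L := Real.log (Real.exp 1 + ‖x‖)
  have hL1 : 1 ≤ L := by
    rw [Real.le_log_iff_exp_le (by positivity)]
    linarith [norm_nonneg x]
  have hL2 : (k - 2) * Real.log 2 ≤ L := by
    have : ((k - 2 : ℤ):ℝ) * Real.log 2 = Real.log ((2:ℝ) ^ (k - 2)) := by rw [Real.log_zpow]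
    push_cast at this
    rw [this]
    apply Real.log_le_log (by positivity)
    linarith [Real.exp_pos 1]
  rw [le_div_iff₀ (by linarith)] at h1
  rw [le_div_iff₀ hl2]
  have h3 := abs_nonneg (q x - q y)
  have : k * Real.log 2 ≤ 3 * L := by linarith
  nlinarith

lemma c0_use {n : ℕ} {q : Eu n → ℝ} {C : ℝ} (hC : 0 < C)
    (h : ∀ x y : Eu n, ‖x‖ ≤ ‖y‖ → |q x - q y| ≤ C / Real.log (Real.exp 1 + ‖x‖))
    (x y : Eu n) : |q x - q y| ≤ C := by
  wlog hxy : ‖x‖ ≤ ‖y‖ generalizing x y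
  · rw [abs_sub_comm]; exact this y x (not_le.1 hxy).le
  refine (h x y hxy).trans (div_le_self hC.le ?_)
  rw [Real.le_log_iff_exp_le (by positivity)]
  linarith [norm_nonneg x]

/-- regularity used in the local (Diening type) estimates -/
def RegA {n : ℕ} (q : Eu n → ℝ) (C : ℝ) : Prop :=
  ∀ (k i : ℤ) (x y : Eu n), x ∈ Ek n k → y ∈ Ek n k → i ≤ k - 4 → dist x y ≤ (2:ℝ) ^ i →
    |q x - q y| * ((k:ℝ) - i) ≤ C

/-- regularity used for comparison with a fixed exponent on annuli -/
def RegB {n : ℕ} (q : Eu n → ℝ) (C : ℝ) : Prop :=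
  (∀ (k : ℤ) (x y : Eu n), 0 ≤ k → (2:ℝ) ^ (k - 1) ≤ ‖x‖ → (2:ℝ) ^ (k - 1) ≤ ‖y‖ →
    |q x - q y| * k ≤ C) ∧
  (∀ (k : ℤ) (x y : Eu n), k ≤ 0 → ‖x‖ ≤ (2:ℝ) ^ k → ‖y‖ ≤ (2:ℝ) ^ k →
    |q x - q y| * (-k) ≤ C)

lemma regA_of_logHolder {n : ℕ} {q : Eu n → ℝ} (h : LogHolder q) : ∃ C > 0, RegA q C := by
  obtain ⟨C, hC, h1, h2⟩ := h
  have hl2 := log2_pos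
  have hl2' := log2_le
  refine ⟨6 * C / Real.log 2, by positivity, ?_⟩
  intro k i x y hx hy hik hd
  have h3 := abs_nonneg (q x - q y)
  have hik' : (i:ℝ) ≤ k - 4 := by exact_mod_cast hik
  have key : 6 * C / Real.log 2 = 2 * (3 * C / Real.log 2) := by ring
  have hcp : 0 < C / Real.log 2 := by positivity
  by_cases hcase : i < -k ∨ k ≤ 1
  · have hi : i ≤ -1 := by omega
    have hA := c1_use hC h1 x y i hi hd
    have : (k:ℝ) - i ≤ 2 * (-i) := by
      rcases hcase with h | h
      · have : (i:ℝ) < -k := by exact_mod_cast h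
        linarith
      · have : (k:ℝ) ≤ 1 := by exact_mod_cast h
        linarith
    calc _ ≤ |q x - q y| * (2 * (-i)) := by gcongr
      _ ≤ 2 * (C / Real.log 2) := by linarith
      _ ≤ 6 * (C / Real.log 2) := by linarith
      _ = _ := by ring
  · push Not at hcase
    have hA := c2_use hC h2 x y k (by omega) hx.1 hy.1
    have : (k:ℝ) - i ≤ 2 * k := by
      have : (-k:ℝ) ≤ i := by exact_mod_cast hcase.1
      linarith
    calc _ ≤ |q x - q y| * (2 * k) := by gcongr
      _ ≤ _ := by rw [key]; linarith

lemma regB_of_logHolder {n : ℕ} {q : Eu n → ℝ} (h : LogHolder q) : ∃ C > 0, RegB q C := by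
  obtain ⟨C, hC, h1, h2⟩ := h
  have hl2 := log2_pos
  have hl2' := log2_le
  have hcp : 0 < C / Real.log 2 := by positivity
  have hcc : C ≤ C / Real.log 2 := by rw [le_div_iff₀ hl2]; nlinarith
  have key : 3 * C / Real.log 2 = 3 * (C / Real.log 2) := by ring
  refine ⟨3 * C / Real.log 2, by positivity, ?_, ?_⟩
  · intro k x y hk hx hy
    have : (2:ℝ) ^ (k - 2) ≤ 2 ^ (k - 1) := zpow_le_zpow_right₀ (by norm_num) (by omega)
    exact c2_use hC h2 x y k hk (this.trans hx) (this.trans hy)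
  · intro k x y hk hx hy
    have h3 := abs_nonneg (q x - q y)
    by_cases hk2 : k ≤ -2
    · have hd : dist x y ≤ (2:ℝ) ^ (k + 1) := by
        rw [dist_eq_norm, zpow_add_one₀ (by norm_num)]
        linarith [norm_sub_le x y]
      have hA := c1_use hC h1 x y (k + 1) (by omega) hd
      push_cast at hA
      have : (k:ℝ) ≤ -2 := by exact_mod_cast hk2
      calc _ ≤ |q x - q y| * (2 * (-((k:ℝ) + 1))) := by gcongr; linarith
        _ ≤ _ := by linarith
    · have h0 := c0_use hC h2 x y
      have : (-1:ℝ) ≤ k := by exact_mod_cast (by omega : -1 ≤ k)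
      nlinarith

lemma regA_trans {n : ℕ} {q p : Eu n → ℝ} {C L : ℝ} (h : RegA q C) (hL : 0 ≤ L)
    (hp : ∀ x y, |p x - p y| ≤ L * |q x - q y|) : RegA p (L * C) := by
  intro k i x y hx hy hik hd
  have hik' : (i:ℝ) ≤ k - 4 := by exact_mod_cast hik
  have hpos : (0:ℝ) ≤ k - i := by linarith
  calc _ ≤ (L * |q x - q y|) * ((k:ℝ) - i) := by gcongr; exact hp x y
    _ = L * (|q x - q y| * ((k:ℝ) - i)) := by ring
    _ ≤ _ := by gcongr; exact h k i x y hx hy hik hd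

lemma regB_trans {n : ℕ} {q p : Eu n → ℝ} {C L : ℝ} (h : RegB q C) (hL : 0 ≤ L)
    (hp : ∀ x y, |p x - p y| ≤ L * |q x - q y|) : RegB p (L * C) := by
  constructor
  · intro k x y hk hx hy
    have : (0:ℝ) ≤ k := by exact_mod_cast hk
    calc _ ≤ (L * |q x - q y|) * (k:ℝ) := by gcongr; exact hp x y
      _ = L * (|q x - q y| * (k:ℝ)) := by ring
      _ ≤ _ := by gcongr; exact h.1 k x y hk hx hy
  · intro k x y hk hx hy
    have : (0:ℝ) ≤ -k := by have : (k:ℝ) ≤ 0 := by exact_mod_cast hk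
                            linarith
    calc _ ≤ (L * |q x - q y|) * (-k:ℝ) := by gcongr; exact hp x y
      _ = L * (|q x - q y| * (-k:ℝ)) := by ring
      _ ≤ _ := by gcongr; exact h.2 k x y hk hx hy

lemma regB_annulus {n : ℕ} {s : Eu n → ℝ} {C : ℝ} (h : RegB s C) (k : ℤ) (x y : Eu n)
    (hx : (2:ℝ) ^ (k - 1) ≤ ‖x‖) (hx' : ‖x‖ ≤ 2 ^ k) (hy : (2:ℝ) ^ (k - 1) ≤ ‖y‖)
    (hy' : ‖y‖ ≤ 2 ^ k) : |(k:ℝ) * (s x - s y)| ≤ C := by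
  rw [abs_mul, mul_comm]
  rcases le_total 0 k with hk | hk
  · rw [abs_of_nonneg (by exact_mod_cast hk : (0:ℝ) ≤ k)]
    exact h.1 k x y hk hx hy
  · rw [abs_of_nonpos (by exact_mod_cast hk : (k:ℝ) ≤ 0)]
    exact h.2 k x y hk hx' hy'

lemma regB_compare {n : ℕ} {s : Eu n → ℝ} {C c0 : ℝ} (hC : 0 ≤ C) (h : RegB s C)
    (hs : ∀ x, c0 ≤ s x) (j k : ℤ) (hjk : j ≤ k) (xj xk : Eu n) (hj : ‖xj‖ = 2 ^ j)
    (hk : ‖xk‖ = 2 ^ k) :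
    j * s xj - k * s xk ≤ ((j:ℝ) - k) * c0 + C := by
  have hjk' : (j:ℝ) ≤ k := by exact_mod_cast hjk
  have a1 := hs xj
  have a2 := hs xk
  have hm : (2:ℝ) ^ j ≤ 2 ^ k := zpow_le_zpow_right₀ (by norm_num) hjk
  have hm1 : (2:ℝ) ^ (j - 1) ≤ 2 ^ j := zpow_le_zpow_right₀ (by norm_num) (by omega)
  rcases le_total 0 j with h0 | h0
  · have h0' : (0:ℝ) ≤ j := by exact_mod_cast h0
    have := h.1 j xj xk h0 (by rw [hj]; exact hm1) (by rw [hk]; exact hm1.trans hm)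
    have h1 := le_abs_self (s xj - s xk)
    nlinarith
  · have h0' : (j:ℝ) ≤ 0 := by exact_mod_cast h0
    rcases le_total 0 k with h2 | h2
    · have h2' : (0:ℝ) ≤ k := by exact_mod_cast h2
      nlinarith
    · have h2' : (k:ℝ) ≤ 0 := by exact_mod_cast h2
      have := h.2 k xj xk h2 (by rw [hj]; exact hm) (by rw [hk])
      have h1 := neg_abs_le (s xj - s xk)
      nlinarith

lemma exists_norm_eq {n : ℕ} (hn : 0 < n) (k : ℤ) : ∃ x : Eu n, ‖x‖ = 2 ^ k := by
  refine ⟨EuclideanSpace.single ⟨0, hn⟩ ((2:ℝ) ^ k), ?_⟩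
  simp

lemma abs_inv_sub_inv_le {a b : ℝ} (ha : 1 ≤ a) (hb : 1 ≤ b) : |1 / a - 1 / b| ≤ |a - b| := by
  have : 1 / a - 1 / b = (b - a) / (a * b) := by field_simp
  rw [this, abs_div, abs_sub_comm]
  refine div_le_self (abs_nonneg _) ?_
  rw [abs_of_nonneg (by positivity)]
  nlinarith

end HM

namespace HM

lemma jensen_set {α : Type*} [MeasurableSpace α] (μ : Measure α) {P : ℝ} (hP : 1 ≤ P)
    {H : α → ℝ≥0∞} (hH : Measurable H) :
    (∫⁻ y, H y ∂μ) ^ P ≤ (∫⁻ y, H y ^ P ∂μ) * (μ Set.univ) ^ (P - 1) := by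
  rcases eq_or_lt_of_le hP with rfl | hP1
  · simp
  have hpq := Real.HolderConjugate.conjExponent hP1
  have h := ENNReal.lintegral_mul_le_Lp_mul_Lq μ hpq hH.aemeasurable
    (measurable_const (a := (1:ℝ≥0∞))).aemeasurable
  simp only [Pi.mul_apply, mul_one, ENNReal.one_rpow, lintegral_const, one_mul] at h
  have hP0 : 0 < P := by linarith
  calc _ ≤ ((∫⁻ y, H y ^ P ∂μ) ^ (1 / P) * (μ Set.univ) ^ (1 / P.conjExponent)) ^ P :=
        ENNReal.rpow_le_rpow h hP0.le
    _ = _ := by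
      rw [ENNReal.mul_rpow_of_nonneg _ _ hP0.le, ← ENNReal.rpow_mul, ← ENNReal.rpow_mul,
        one_div_mul_cancel hP0.ne', ENNReal.rpow_one]
      congr 2
      unfold Real.conjExponent
      field_simp

lemma av_jensen {n : ℕ} (i : ℤ) {P : ℝ} (hP : 1 ≤ P) {H : Eu n → ℝ≥0∞} (hH : Measurable H)
    (z : Eu n) : (av i H z) ^ P ≤ (vb n) ^ (P - 1) * av i (fun y => H y ^ P) z := by
  unfold av
  have hP0 : 0 ≤ P := by linarith
  rw [ENNReal.mul_rpow_of_nonneg _ _ hP0]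
  calc _ ≤ tw (-(i * n)) ^ P * ((∫⁻ y in closedBall z ((2:ℝ) ^ i), H y ^ P) *
            (volume (closedBall z ((2:ℝ) ^ i))) ^ (P - 1)) := by
        gcongr
        have := jensen_set (volume.restrict (closedBall z ((2:ℝ) ^ i))) hP hH
        rwa [Measure.restrict_apply_univ] at this
    _ = _ := by
        rw [vol_closedBall_two, ENNReal.mul_rpow_of_nonneg _ _ (by linarith : 0 ≤ P - 1),
          tw_rpow, tw_rpow]
        have : tw (-((i:ℝ) * n)) = tw (-((i:ℝ) * n) * P) * tw ((i:ℝ) * n * (P - 1)) := by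
          rw [← tw_add]; congr 1; ring
        rw [this]
        ring

lemma av_add_one {n : ℕ} (i : ℤ) (H : Eu n → ℝ≥0∞) (z : Eu n) :
    av i (fun y => H y + 1) z = av i H z + vb n := by
  unfold av
  rw [lintegral_add_right _ measurable_const, setLIntegral_const, one_mul, mul_add,
    vol_closedBall_two, ← mul_assoc (tw _), mul_comm (tw _) (tw _), tw_mul_tw_neg, one_mul]

lemma av_le_int {n : ℕ} (i : ℤ) (H : Eu n → ℝ≥0∞) (z : Eu n) :
    av i H z ≤ tw (-(i * n)) * ∫⁻ y, H y := by
  unfold av; gcongr; exact Measure.restrict_le_self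

lemma diening {n : ℕ} {p : Eu n → ℝ} {Q C : ℝ} (hp1 : ∀ x, 1 ≤ p x) (hpQ : ∀ x, p x ≤ Q)
    (hC : 0 ≤ C) (hreg : RegA p C) (K : ℝ≥0∞) (hK : K ≠ ⊤) :
    ∃ D : ℝ≥0∞, 1 ≤ D ∧ D ≠ ⊤ ∧ ∀ (k i : ℤ) (H : Eu n → ℝ≥0∞) (z : Eu n), i ≤ k - 4 →
      Measurable H → (∀ y, H y ≠ 0 → y ∈ Ek n k) →
      ∫⁻ y, H y ^ p y ≤ K * tw (k * n) → z ∈ Ek n k →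
      (av i H z) ^ p z ≤ D * (av i (fun y => H y ^ p y) z + 1) := by
  set v : ℝ≥0∞ := (vb n + 1) ^ Q with hv
  have hQ : 1 ≤ Q := (hp1 0).trans (hpQ 0)
  have hvt : v ≠ ⊤ := by
    rw [hv]; exact ENNReal.rpow_ne_top_of_nonneg (by linarith) (by simp [vb_ne_top])
  have hv1 : 1 ≤ v := ENNReal.one_le_rpow le_add_self (by linarith)
  have hvbv : vb n ≤ v := by
    calc vb n ≤ vb n + 1 := le_self_add
      _ = (vb n + 1) ^ (1:ℝ) := by simp
      _ ≤ _ := rpow_le_self_of_one_le le_add_self hQ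
  set c2 : ℝ≥0∞ := v * v with hc2
  have hc21 : 1 ≤ c2 := one_le_mul hv1 hv1
  set c3 : ℝ≥0∞ := c2 * (K + 1) with hc3
  have hc31 : 1 ≤ c3 := one_le_mul hc21 le_add_self
  have hc3t : c3 ≠ ⊤ := by rw [hc3, hc2]; finiteness
  set c4 : ℝ≥0∞ := c3 ^ C * tw (n * C) with hc4
  have hc4t : c4 ≠ ⊤ := ENNReal.mul_ne_top (ENNReal.rpow_ne_top_of_nonneg hC hc3t) (tw_ne_top _)
  have hc41 : 1 ≤ c4 := one_le_mul (by simpa using rpow_le_self_of_one_le hc31 hC) (one_le_tw (by positivity))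
  refine ⟨c2 * c4, one_le_mul hc21 hc41, by rw [hc2]; finiteness, ?_⟩
  intro k i H z hik hH hsupp hint hz
  set W := av i (fun y => H y ^ p y) z with hW
  set A := av i H z with hA
  have hik' : (4:ℝ) ≤ k - i := by
    have : (i:ℝ) ≤ k - 4 := by exact_mod_cast hik
    linarith
  rcases le_total A 1 with hA1 | hA1
  · calc A ^ p z ≤ 1 := ENNReal.rpow_le_one hA1 (by linarith [hp1 z])
      _ ≤ 1 * (W + 1) := by rw [one_mul]; exact le_add_self
      _ ≤ _ := by gcongr; exact one_le_mul hc21 hc41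
  set ω := C / (k - i) with hω
  set P := max 1 (p z - ω) with hPdef
  have hP1 : 1 ≤ P := le_max_left _ _
  have hω0 : 0 ≤ ω := by rw [hω]; apply div_nonneg hC; linarith
  have hPz : P ≤ p z := max_le (hp1 z) (by linarith)
  have hPd : p z - P ≤ ω := by
    have := le_max_right 1 (p z - ω); linarith
  have hPQ : P ≤ Q := hPz.trans (hpQ z)
  have hlow : ∀ y ∈ closedBall z ((2:ℝ) ^ i), H y ^ P ≤ H y ^ p y + 1 := by
    intro y hy
    by_cases h0 : H y = 0
    · rw [h0, ENNReal.zero_rpow_of_pos (by linarith)]; exact zero_le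
    have hyE := hsupp y h0
    have := hreg k i z y hz hyE hik (by rw [dist_comm]; exact hy)
    have hle : p z - p y ≤ ω := by
      rw [hω, le_div_iff₀ (by linarith)]
      refine le_trans ?_ this
      gcongr
      exact le_abs_self _
    exact rpow_le_rpow_add_one (by linarith) (max_le (hp1 y) (by linarith))
  have hAP : A ^ P ≤ c2 * (W + 1) := by
    calc A ^ P ≤ (vb n) ^ (P - 1) * av i (fun y => H y ^ P) z := av_jensen i hP1 hH z
      _ ≤ v * av i (fun y => H y ^ p y + 1) z := by
          gcongr
          · calc vb n ^ (P - 1) ≤ (vb n + 1) ^ (P - 1) := by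
                  exact ENNReal.rpow_le_rpow le_self_add (by linarith)
              _ ≤ _ := rpow_le_self_of_one_le le_add_self (by linarith)
          · unfold av
            refine mul_le_mul' le_rfl ?_
            exact setLIntegral_mono' isClosed_closedBall.measurableSet hlow
      _ = v * (W + vb n) := by rw [av_add_one]
      _ ≤ v * (v * (W + 1)) := by
          gcongr
          rw [mul_add, mul_one]
          gcongr
          calc W = 1 * W := (one_mul _).symm
            _ ≤ _ := by gcongr
      _ = _ := by rw [hc2, mul_assoc]
  have hWle : W ≤ K * tw ((k - i) * n) := by
    calc W ≤ tw (-(i * n)) * ∫⁻ y, H y ^ p y := av_le_int _ _ _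
      _ ≤ tw (-(i * n)) * (K * tw (k * n)) := by gcongr
      _ = K * (tw (-(i * n)) * tw (k * n)) := by ring
      _ = _ := by rw [← tw_add]; congr 2; ring
  have hA3 : A ≤ c3 * tw ((k - i) * n) := by
    calc A = A ^ (1:ℝ) := by simp
      _ ≤ A ^ P := rpow_le_self_of_one_le hA1 hP1
      _ ≤ c2 * (W + 1) := hAP
      _ ≤ c2 * (K * tw ((k - i) * n) + tw ((k - i) * n)) := by
          gcongr
          apply one_le_tw
          have : (0:ℝ) ≤ n := by positivity
          nlinarith
      _ = _ := by rw [hc3]; ring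
  have hωC : ω ≤ C := by
    rw [hω]; apply div_le_self hC; linarith
  have hfac : A ^ (p z - P) ≤ c4 := by
    calc A ^ (p z - P) ≤ A ^ ω := rpow_le_self_of_one_le hA1 hPd
      _ ≤ (c3 * tw ((k - i) * n)) ^ ω := ENNReal.rpow_le_rpow hA3 hω0
      _ = c3 ^ ω * tw ((k - i) * n * ω) := by rw [ENNReal.mul_rpow_of_nonneg _ _ hω0, tw_rpow]
      _ ≤ c4 := by
          rw [hc4]
          have e : ((k:ℝ) - i) * n * ω = n * C := by
            rw [hω]; field_simp
          rw [e]
          exact mul_le_mul' (rpow_le_self_of_one_le hc31 hωC) le_rfl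
  calc A ^ p z = A ^ (P + (p z - P)) := by congr 1; ring
    _ = A ^ P * A ^ (p z - P) := ENNReal.rpow_add_of_nonneg _ _ (by linarith) (by linarith)
    _ ≤ (c2 * (W + 1)) * c4 := by gcongr
    _ = _ := by ring

end HM

namespace HM

/-- s-average -/
noncomputable def sv {n : ℕ} (s : ℝ) (i : ℤ) (h : Eu n → ℝ≥0∞) (z : Eu n) : ℝ≥0∞ :=
  (av i (fun y => h y ^ s) z) ^ (1 / s)

/-- majorant -/
noncomputable def Th {n : ℕ} (q : Eu n → ℝ) (s : ℝ) (h : Eu n → ℝ≥0∞) (z : Eu n) : ℝ≥0∞ :=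
  (mx (fun y => h y ^ (q y / s)) z + 1) ^ s

lemma measurableSet_Ek (n : ℕ) (k : ℤ) : MeasurableSet (Ek n k) := by
  unfold Ek
  exact (measurableSet_le measurable_const measurable_norm).inter
    (measurableSet_le measurable_norm measurable_const)

/-- volume constant -/
noncomputable def vE (n : ℕ) : ℝ≥0∞ := tw (2 * n) * vb n

lemma vE_ne_top (n : ℕ) : vE n ≠ ⊤ := ENNReal.mul_ne_top (tw_ne_top _) (vb_ne_top n)

lemma vol_Ek_le (n : ℕ) (k : ℤ) : volume (Ek n k) ≤ vE n * tw (k * n) := by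
  calc volume (Ek n k) ≤ volume (closedBall (0:Eu n) ((2:ℝ) ^ (k + 2))) := by
        apply measure_mono
        intro x hx
        rw [mem_closedBall, dist_zero_right]
        exact hx.2
    _ = _ := by
        rw [vol_closedBall_two, vE]
        push_cast
        rw [add_mul, tw_add]
        ring

lemma lower_power_int {n : ℕ} {q p : Eu n → ℝ} (hp0 : ∀ x, 0 < p x) (hpq : ∀ x, p x ≤ q x)
    {K : ℝ≥0∞} (k : ℤ) {h : Eu n → ℝ≥0∞} (hsupp : ∀ y, h y ≠ 0 → y ∈ Ek n k)
    (hint : ∫⁻ y, h y ^ q y ≤ K * tw (k * n)) :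
    ∫⁻ y, h y ^ p y ≤ (K + vE n) * tw (k * n) := by
  calc ∫⁻ y, h y ^ p y ≤ ∫⁻ y, h y ^ q y + (Ek n k).indicator (fun _ => 1) y := by
        refine lintegral_mono fun y => ?_
        by_cases h0 : h y = 0
        · simp [h0, ENNReal.zero_rpow_of_pos (hp0 y)]
        · simp only [Set.indicator_of_mem (hsupp y h0)]
          exact rpow_le_rpow_add_one (hp0 y).le (hpq y)
    _ = (∫⁻ y, h y ^ q y) + volume (Ek n k) := by
        rw [lintegral_add_right _ (measurable_const.indicator (measurableSet_Ek n k)),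
          lintegral_indicator (measurableSet_Ek n k), setLIntegral_const, one_mul]
    _ ≤ K * tw (k * n) + vE n * tw (k * n) := add_le_add hint (vol_Ek_le n k)
    _ = _ := by ring

lemma theta {n : ℕ} (hn : 0 < n) {q : Eu n → ℝ} {s Q C : ℝ} (hs : 1 < s) (hqm : Measurable q)
    (hq1 : ∀ x, s * s ≤ q x) (hqQ : ∀ x, q x ≤ Q) (hC : 0 ≤ C) (hreg : RegA q C)
    (K : ℝ≥0∞) (hK : K ≠ ⊤) :
    ∃ D : ℝ≥0∞, 1 ≤ D ∧ D ≠ ⊤ ∧ ∀ (k : ℤ) (h : Eu n → ℝ≥0∞), Measurable h →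
      (∀ y, h y ≠ 0 → y ∈ Ek n k) → ∫⁻ y, h y ^ q y ≤ K * tw (k * n) →
      (∀ z ∈ Ek n k, ∀ i ≤ k - 4, (sv s i h z) ^ q z ≤ D * Th q s h z) ∧
      (∀ z ∈ Ek n k, ∀ i ≤ k - 4, (sv s i h z) ^ q z ≤ D * tw ((k - i) * n)) ∧
      ∫⁻ z in Ek n k, Th q s h z ≤ D * tw (k * n) := by
  have hs0 : 0 < s := by linarith
  have hss : 0 < s * s := by positivity
  have hq0 : ∀ x, 0 < q x := fun x => hss.trans_le (hq1 x)
  -- first exponent q / s^2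
  obtain ⟨D1, hD1, hD1t, H1⟩ := diening (p := fun x => q x / (s * s)) (Q := Q / (s * s))
    (C := 1 / (s * s) * C)
    (fun x => by rw [le_div_iff₀ hss]; linarith [hq1 x]) (fun x => by gcongr; exact hqQ x)
    (by positivity) (regA_trans hreg (by positivity) (fun x y => by
      rw [← sub_div, abs_div, abs_of_pos hss]; exact le_of_eq (by ring)))
    (K + vE n) (by have := vE_ne_top n; finiteness)
  obtain ⟨D2, hD2, hD2t, H2⟩ := diening (p := fun x => q x / s) (Q := Q / s)
    (C := 1 / s * C)
    (fun x => by rw [le_div_iff₀ hs0]; nlinarith [hq1 x]) (fun x => by gcongr; exact hqQ x)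
    (by positivity) (regA_trans hreg (by positivity) (fun x y => by
      rw [← sub_div, abs_div, abs_of_pos hs0]; exact le_of_eq (by ring)))
    K hK
  set D3 : ℝ≥0∞ := 2 ^ s * (Cmx n s * K + vE n) with hD3
  have hD3t : D3 ≠ ⊤ := by
    have := vE_ne_top n
    have := Cmx_ne_top n hs
    have : (2:ℝ≥0∞) ^ s ≠ ⊤ := ENNReal.rpow_ne_top_of_nonneg hs0.le (by simp)
    rw [hD3]; finiteness
  have hD1s : D1 ^ s ≠ ⊤ := ENNReal.rpow_ne_top_of_nonneg hs0.le hD1t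
  refine ⟨D1 ^ s + D2 * (K + 1) + D3, ?_, by finiteness, ?_⟩
  · calc (1:ℝ≥0∞) ≤ D1 ^ s := ENNReal.one_le_rpow hD1 hs0
      _ ≤ _ := by rw [add_assoc]; exact le_self_add
  intro k h hh hsupp hint
  have hsupp' : ∀ y, (h y) ^ s ≠ 0 → y ∈ Ek n k := by
    intro y hy
    apply hsupp
    intro h0
    exact hy (by rw [h0, ENNReal.zero_rpow_of_pos hs0])
  have e1 : ∀ y, (h y ^ s) ^ (q y / (s * s)) = h y ^ (q y / s) := by
    intro y; rw [← ENNReal.rpow_mul]; congr 1; field_simp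
  have e2 : ∀ y, (h y ^ s) ^ (q y / s) = h y ^ (q y) := by
    intro y; rw [← ENNReal.rpow_mul]; congr 1; field_simp
  refine ⟨?_, ?_, ?_⟩
  · intro z hz i hi
    have h1 := H1 k i (fun y => h y ^ s) z hi (hh.pow_const s) hsupp' (by
      simp only [e1]
      exact lower_power_int (fun x => div_pos (hq0 x) hs0)
        (fun x => div_le_self (hq0 x).le hs.le) k hsupp hint) hz
    simp only [e1] at h1
    calc (sv s i h z) ^ q z = ((av i (fun y => h y ^ s) z) ^ (q z / (s * s))) ^ s := by
          unfold sv; rw [← ENNReal.rpow_mul, ← ENNReal.rpow_mul]; congr 1; field_simp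
      _ ≤ (D1 * (mx (fun y => h y ^ (q y / s)) z + 1)) ^ s := by
          refine ENNReal.rpow_le_rpow (h1.trans ?_) hs0.le
          gcongr
          exact av_le_mx _ _ _
      _ = D1 ^ s * Th q s h z := by rw [ENNReal.mul_rpow_of_nonneg _ _ hs0.le, Th]
      _ ≤ _ := by
          refine mul_le_mul' ?_ le_rfl
          rw [add_assoc]; exact le_self_add
  · intro z hz i hi
    have h1 := H2 k i (fun y => h y ^ s) z hi (hh.pow_const s) hsupp' (by
      simp only [e2]; exact hint) hz
    simp only [e2] at h1
    calc (sv s i h z) ^ q z = (av i (fun y => h y ^ s) z) ^ (q z / s) := by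
          unfold sv; rw [← ENNReal.rpow_mul]; congr 1; field_simp
      _ ≤ D2 * (K * tw ((k - i) * n) + tw ((k - i) * n)) := by
          refine h1.trans ?_
          refine mul_le_mul' le_rfl (add_le_add ?_ ?_)
          · calc _ ≤ tw (-(i * n)) * ∫⁻ y, h y ^ q y := av_le_int _ _ _
              _ ≤ tw (-(i * n)) * (K * tw (k * n)) := by gcongr
              _ = K * (tw (-(i * n)) * tw (k * n)) := by ring
              _ = _ := by rw [← tw_add]; congr 2; ring
          · apply one_le_tw
            have : (0:ℝ) ≤ n := by positivity
            have : (i:ℝ) ≤ k - 4 := by exact_mod_cast hi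
            apply mul_nonneg <;> linarith
      _ = D2 * (K + 1) * tw ((k - i) * n) := by ring
      _ ≤ _ := by
          refine mul_le_mul' ?_ le_rfl
          rw [add_right_comm]; exact le_add_self
  · have hmeas : Measurable (fun y => h y ^ (q y / s)) := hh.pow (hqm.div_const s)
    calc ∫⁻ z in Ek n k, Th q s h z
        ≤ ∫⁻ z in Ek n k, 2 ^ s * ((mx (fun y => h y ^ (q y / s)) z) ^ s + 1) := by
          refine lintegral_mono fun z => ?_
          unfold Th
          set X := mx (fun y => h y ^ (q y / s)) z
          calc (X + 1) ^ s ≤ (2 * max X 1) ^ s := by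
                refine ENNReal.rpow_le_rpow ?_ hs0.le
                rw [two_mul]
                exact add_le_add (le_max_left _ _) (le_max_right _ _)
            _ = 2 ^ s * (max X 1) ^ s := ENNReal.mul_rpow_of_nonneg _ _ hs0.le
            _ ≤ _ := by
                refine mul_le_mul' le_rfl ?_
                rcases max_choice X 1 with h | h <;> rw [h]
                · exact le_self_add
                · rw [ENNReal.one_rpow]; exact le_add_self
      _ = 2 ^ s * ((∫⁻ z in Ek n k, (mx (fun y => h y ^ (q y / s)) z) ^ s) + volume (Ek n k)) := by
          rw [lintegral_const_mul' _ _ (ENNReal.rpow_ne_top_of_nonneg hs0.le (by simp)),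
            lintegral_add_right _ measurable_const, setLIntegral_const, one_mul]
      _ ≤ 2 ^ s * (Cmx n s * (K * tw (k * n)) + vE n * tw (k * n)) := by
          refine mul_le_mul' le_rfl (add_le_add ?_ (vol_Ek_le n k))
          calc _ ≤ ∫⁻ z, (mx (fun y => h y ^ (q y / s)) z) ^ s :=
                lintegral_mono' Measure.restrict_le_self le_rfl
            _ ≤ Cmx n s * ∫⁻ z, (h z ^ (q z / s)) ^ s := strong_type hn hs hmeas
            _ = Cmx n s * ∫⁻ z, h z ^ q z := by
                congr 2; funext z; rw [← ENNReal.rpow_mul]; congr 1; field_simp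
            _ ≤ _ := by gcongr
      _ = D3 * tw (k * n) := by rw [hD3]; ring
      _ ≤ _ := mul_le_mul' le_add_self le_rfl

end HM

namespace HM

lemma Cg_antitone {a b : ℝ} (h : a ≤ b) : Cg b ≤ Cg a := by
  unfold Cg
  exact ENNReal.inv_le_inv.2 (tsub_le_tsub_left (tw_mono (by linarith)) _)

lemma le_of_rpow_le_mul {a D X : ℝ≥0∞} {q : ℝ} (hq : 1 ≤ q) (hD : 1 ≤ D) (h : a ^ q ≤ D * X) :
    a ≤ D * X ^ (1 / q) := by
  have hq0 : 0 < q := by linarith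
  calc a = (a ^ q) ^ (1 / q) := by
        rw [← ENNReal.rpow_mul, mul_one_div_cancel hq0.ne', ENNReal.rpow_one]
    _ ≤ (D * X) ^ (1 / q) := ENNReal.rpow_le_rpow h (by positivity)
    _ = D ^ (1 / q) * X ^ (1 / q) := ENNReal.mul_rpow_of_nonneg _ _ (by positivity)
    _ ≤ _ := by
      refine mul_le_mul' ?_ le_rfl
      calc D ^ (1 / q) ≤ D ^ (1:ℝ) := rpow_le_self_of_one_le hD (by rw [div_le_one hq0]; exact hq)
        _ = D := ENNReal.rpow_one D

/-- Hedberg's trick -/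
lemma hedberg {n : ℕ} (hn : 0 < n) {β Q q1 q2 : ℝ} (hβ : 0 < β) (hq1 : 1 ≤ q1) (hq2 : 1 ≤ q2)
    (hQ : q2 ≤ Q) (hqq : 1 / q1 - 1 / q2 = β / n) {D : ℝ≥0∞} (hD : 1 ≤ D) (k : ℤ)
    (a : ℤ → ℝ≥0∞) {Θ : ℝ≥0∞} (hΘ : 1 ≤ Θ)
    (h1 : ∀ i ≤ k - 4, a i ^ q1 ≤ D * Θ) (h2 : ∀ i ≤ k - 4, a i ^ q1 ≤ D * tw ((k - i) * n)) :
    (∑' i : ℤ, if i ≤ k - 4 then tw ((i - k) * β) * a i else 0) ^ q2 ≤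
      (D * (Cg β + Cg (n / Q)) + 1) ^ Q * Θ := by
  have hn0 : (0:ℝ) < n := by exact_mod_cast hn
  have hq10 : 0 < q1 := by linarith
  have hq20 : 0 < q2 := by linarith
  have hQ0 : 0 < Q := by linarith
  by_cases hΘt : Θ = ⊤
  · rw [hΘt, ENNReal.mul_top]
    · exact le_top
    · have : (1:ℝ≥0∞) ≤ (D * (Cg β + Cg (n / Q)) + 1) ^ Q := ENNReal.one_le_rpow le_add_self hQ0
      exact (lt_of_lt_of_le one_pos this).ne'
  have hΘ0 : Θ ≠ 0 := (lt_of_lt_of_le one_pos hΘ).ne'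
  set X : ℝ≥0∞ := tw k * Θ ^ (-(1 / (n:ℝ))) with hX
  have hXr : ∀ t : ℝ, X ^ t = tw (k * t) * Θ ^ (-(t / n)) := by
    intro t
    rw [hX, ENNReal.mul_rpow_of_ne_top (tw_ne_top _) (ENNReal.rpow_ne_top_of_ne_zero hΘ0 hΘt), tw_rpow,
      ← ENNReal.rpow_mul]
    congr 2; ring
  have key : ∀ i : ℤ, (if i ≤ k - 4 then tw ((i - k) * β) * a i else 0) ≤
      (if tw i ≤ X then tw (i * β) else 0) * (tw (-(k * β)) * (D * Θ ^ (1 / q1))) +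
      (if X ≤ tw i then tw (-(i * (n / q2))) else 0) * (D * tw (k * (n / q2))) := by
    intro i
    split_ifs with hi hc1 hc2 hc2
    · refine le_trans ?_ le_self_add
      rw [← mul_assoc, ← tw_add]
      have : (i:ℝ) * β + -(k * β) = (i - k) * β := by ring
      rw [this]
      exact mul_le_mul' le_rfl (le_of_rpow_le_mul hq1 hD (h1 i hi))
    · refine le_trans ?_ le_self_add
      rw [← mul_assoc, ← tw_add]
      have : (i:ℝ) * β + -(k * β) = (i - k) * β := by ring
      rw [this]
      exact mul_le_mul' le_rfl (le_of_rpow_le_mul hq1 hD (h1 i hi))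
    · refine le_trans ?_ le_add_self
      have h3 := le_of_rpow_le_mul hq1 hD (h2 i hi)
      rw [tw_rpow] at h3
      calc _ ≤ tw ((i - k) * β) * (D * tw ((k - i) * n * (1 / q1))) := mul_le_mul' le_rfl h3
        _ = D * (tw ((i - k) * β) * tw ((k - i) * n * (1 / q1))) := by ring
        _ = D * (tw (-(i * (n / q2))) * tw (k * (n / q2))) := by
            rw [← tw_add, ← tw_add]; congr 2
            have : β = n * (1 / q1 - 1 / q2) := by rw [hqq]; field_simp
            rw [this]; ring
        _ = _ := by ring
    · exact absurd (le_of_lt (not_le.1 hc1)) hc2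
    all_goals exact zero_le
  have hsum : (∑' i : ℤ, if i ≤ k - 4 then tw ((i - k) * β) * a i else 0) ≤
      D * (Cg β + Cg (n / Q)) * Θ ^ (1 / q2) := by
    calc _ ≤ ∑' i : ℤ, ((if tw i ≤ X then tw (i * β) else 0) * (tw (-(k * β)) * (D * Θ ^ (1 / q1))) +
      (if X ≤ tw i then tw (-(i * (n / q2))) else 0) * (D * tw (k * (n / q2)))) :=
          ENNReal.tsum_le_tsum key
      _ = (∑' i : ℤ, if tw i ≤ X then tw (i * β) else 0) * (tw (-(k * β)) * (D * Θ ^ (1 / q1))) +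
        (∑' i : ℤ, if X ≤ tw i then tw (-(i * (n / q2))) else 0) * (D * tw (k * (n / q2))) := by
          rw [ENNReal.tsum_add, ENNReal.tsum_mul_right, ENNReal.tsum_mul_right]
      _ ≤ (Cg β * X ^ β) * (tw (-(k * β)) * (D * Θ ^ (1 / q1))) +
        (Cg (n / q2) * X ^ (-(n / q2))) * (D * tw (k * (n / q2))) := by
          refine add_le_add (mul_le_mul' (geom_small hβ X) le_rfl)
            (mul_le_mul' (geom_large (by positivity) X) le_rfl)
      _ = D * Cg β * ((tw (k * β) * tw (-(k * β))) * (Θ ^ (-(β / n)) * Θ ^ (1 / q1))) +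
          D * Cg (n / q2) * ((tw (k * (n / q2)) * tw (-(k * (n / q2)))) * Θ ^ (1 / q2)) := by
          rw [hXr, hXr]
          have e1 : -(-(n / q2) / n) = 1 / q2 := by field_simp
          have e2 : (k:ℝ) * -(n / q2) = -(k * (n / q2)) := by ring
          rw [e1, e2]
          ring
      _ = D * (Cg β + Cg (n / q2)) * Θ ^ (1 / q2) := by
          rw [tw_mul_tw_neg, tw_mul_tw_neg, ← ENNReal.rpow_add _ _ hΘ0 hΘt]
          have e1 : -(β / n) + 1 / q1 = 1 / q2 := by rw [← hqq]; ring
          rw [e1]; ring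
      _ ≤ _ := by
          refine mul_le_mul' (mul_le_mul' le_rfl (add_le_add le_rfl (Cg_antitone ?_))) le_rfl
          gcongr
  calc _ ≤ (D * (Cg β + Cg (n / Q)) * Θ ^ (1 / q2)) ^ q2 := ENNReal.rpow_le_rpow hsum hq20.le
    _ = (D * (Cg β + Cg (n / Q))) ^ q2 * Θ := by
        rw [ENNReal.mul_rpow_of_nonneg _ _ hq20.le, ← ENNReal.rpow_mul,
          one_div_mul_cancel hq20.ne', ENNReal.rpow_one]
    _ ≤ (D * (Cg β + Cg (n / Q)) + 1) ^ q2 * Θ :=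
        mul_le_mul' (ENNReal.rpow_le_rpow le_self_add hq20.le) le_rfl
    _ ≤ _ := mul_le_mul' (rpow_le_self_of_one_le le_add_self hQ) le_rfl

lemma one_le_Th {n : ℕ} (q : Eu n → ℝ) {s : ℝ} (hs : 0 < s) (h : Eu n → ℝ≥0∞) (z : Eu n) :
    1 ≤ Th q s h z := ENNReal.one_le_rpow le_add_self hs

lemma near_sum {n : ℕ} (hn : 0 < n) {β Q q1 q2 : ℝ} (hβ : 0 < β) (hq1 : 1 ≤ q1) (hq2 : 1 < q2)
    (hQ : q2 ≤ Q) (hqq : 1 / q1 - 1 / q2 = β / n) {D : ℝ≥0∞} (hD : 1 ≤ D) (k : ℤ)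
    (a a' : ℤ → ℝ≥0∞) {Θ Θ' : ℝ≥0∞} (hΘ : 1 ≤ Θ)
    (h1 : ∀ i ≤ k - 4, a i ^ q1 ≤ D * Θ) (h2 : ∀ i ≤ k - 4, a i ^ q1 ≤ D * tw ((k - i) * n))
    (h3 : ∀ i ≤ k - 4, a' i ^ (q2 / (q2 - 1)) ≤ D * Θ') :
    (∑' i : ℤ, if i ≤ k - 4 then tw ((i - k) * β) * (a i * a' i) else 0) ≤
      (D * (Cg β + Cg (n / Q)) + 1) ^ Q * Θ + D * Θ' := by
  have hpq : q2.HolderConjugate (q2 / (q2 - 1)) := Real.HolderConjugate.conjExponent hq2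
  have hq' : 0 < q2 / (q2 - 1) := hpq.symm.pos
  have hq'1 : 1 < q2 / (q2 - 1) := hpq.symm.lt
  set A := (D * Θ') ^ (1 / (q2 / (q2 - 1))) with hA
  set I := ∑' i : ℤ, if i ≤ k - 4 then tw ((i - k) * β) * a i else 0 with hI
  have hAq : A ^ (q2 / (q2 - 1)) = D * Θ' := by
    rw [hA, ← ENNReal.rpow_mul, one_div_mul_cancel hq'.ne', ENNReal.rpow_one]
  calc _ ≤ ∑' i : ℤ, (if i ≤ k - 4 then tw ((i - k) * β) * a i else 0) * A := by
        refine ENNReal.tsum_le_tsum fun i => ?_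
        split_ifs with hi
        · rw [← mul_assoc]
          refine mul_le_mul' le_rfl ?_
          rw [hA, one_div, ENNReal.le_rpow_inv_iff hq']
          exact h3 i hi
        · exact zero_le
    _ = I * A := ENNReal.tsum_mul_right
    _ ≤ I ^ q2 / ENNReal.ofReal q2 + A ^ (q2 / (q2 - 1)) / ENNReal.ofReal (q2 / (q2 - 1)) :=
        ENNReal.young_inequality I A hpq
    _ ≤ I ^ q2 + A ^ (q2 / (q2 - 1)) := by
        refine add_le_add ?_ ?_
        · exact ENNReal.div_le_of_le_mul (le_mul_of_one_le_right zero_le (by simpa using hq2.le))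
        · exact ENNReal.div_le_of_le_mul (le_mul_of_one_le_right zero_le (by simpa using hq'1.le))
    _ ≤ _ := by
        rw [hAq]
        exact add_le_add (hedberg hn hβ hq1 hq2.le hQ hqq hD k a hΘ h1 h2) le_rfl

end HM

namespace HM

/-- collected parameters and their properties -/
structure Par (n : ℕ) (q1 q2 : Eu n → ℝ) (β s Q C : ℝ) (N : ℕ) : Prop where
  hn : 0 < n
  hβ : 0 < β
  hβn : β < n
  hs : 1 < s
  hconj : s.HolderConjugate (N:ℝ)
  hN : Q ≤ N
  hq1m : Measurable q1
  hq1l : ∀ x, s * s ≤ q1 x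
  hq1u : ∀ x, q1 x ≤ Q
  hq2m : Measurable q2
  hq2l : ∀ x, 1 < q2 x
  hq2u : ∀ x, q2 x ≤ Q
  hq2l' : ∀ x, s * s ≤ q2 x / (q2 x - 1)
  hq2u' : ∀ x, q2 x / (q2 x - 1) ≤ Q
  hqq : ∀ x, 1 / q1 x - 1 / q2 x = β / n
  hC : 0 ≤ C
  hr1 : RegA q1 C
  hr2 : RegA (fun x => q2 x / (q2 x - 1)) C

/-- kernel -/
noncomputable def ker {n : ℕ} (β : ℝ) (p : Eu n × Eu n) : ℝ≥0∞ :=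
  ENNReal.ofReal (‖p.1 - p.2‖ ^ (β - (n:ℝ)))

/-- near kernel -/
noncomputable def nk {n : ℕ} (β : ℝ) (k : ℤ) (p : Eu n × Eu n) : ℝ≥0∞ :=
  if dist p.1 p.2 ≤ (2:ℝ) ^ (k - 4) then ker β p else 0

lemma measurable_ker {n : ℕ} (β : ℝ) : Measurable (ker β : Eu n × Eu n → ℝ≥0∞) := by
  unfold ker
  exact ENNReal.measurable_ofReal.comp ((measurable_fst.sub measurable_snd).norm.pow_const _)

lemma measurable_nk {n : ℕ} (β : ℝ) (k : ℤ) : Measurable (nk β k : Eu n × Eu n → ℝ≥0∞) := by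
  unfold nk
  exact Measurable.ite (measurableSet_le (measurable_fst.dist measurable_snd) measurable_const)
    (measurable_ker β) measurable_const

/-- the square indicator -/
noncomputable def sq {n : ℕ} (i : ℤ) (z : Eu n) (p : Eu n × Eu n) : ℝ≥0∞ :=
  (closedBall z ((2:ℝ) ^ i) ×ˢ closedBall z ((2:ℝ) ^ i)).indicator (fun _ => 1) p

lemma measurable_sq {n : ℕ} (i : ℤ) :
    Measurable (fun r : (Eu n × Eu n) × Eu n => sq i r.2 r.1) := by
  have : (fun r : (Eu n × Eu n) × Eu n => sq i r.2 r.1) =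
      {r : (Eu n × Eu n) × Eu n | dist r.1.1 r.2 ≤ (2:ℝ) ^ i ∧ dist r.1.2 r.2 ≤ (2:ℝ) ^ i}.indicator
        (fun _ => (1:ℝ≥0∞)) := by
    funext r
    unfold sq
    by_cases hr : dist r.1.1 r.2 ≤ (2:ℝ) ^ i ∧ dist r.1.2 r.2 ≤ (2:ℝ) ^ i
    · rw [Set.indicator_of_mem (by exact hr), Set.indicator_of_mem (by exact hr)]
    · rw [Set.indicator_of_notMem (by exact hr), Set.indicator_of_notMem (by exact hr)]
  rw [this]
  refine measurable_const.indicator ?_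
  exact (measurableSet_le ((measurable_fst.comp measurable_fst).dist measurable_snd) measurable_const).inter
    (measurableSet_le ((measurable_snd.comp measurable_fst).dist measurable_snd) measurable_const)

lemma nk_le {n : ℕ} {β : ℝ} (hβn : β < n) (k : ℤ) (p : Eu n × Eu n) :
    nk β k p ≤ (tw (2 * n - β) * (vb n)⁻¹) * ∑' i : ℤ, (if i ≤ k - 4 then
      tw (i * (β - 2 * n)) * ∫⁻ z, sq i z p else 0) := by
  obtain ⟨x, y⟩ := p
  unfold nk
  split_ifs with hd
  swap
  · exact zero_le
  simp only at hd
  rcases eq_or_ne x y with rfl | hxy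
  · have : β - (n:ℝ) ≠ 0 := by linarith
    unfold ker
    simp [Real.zero_rpow this]
  have hdp : 0 < dist x y := dist_pos.2 hxy
  obtain ⟨i, hi1, hi2⟩ := exists_tw_bracket' (X := ENNReal.ofReal (dist x y))
    (by simpa using hxy) ENNReal.ofReal_ne_top
  have hi1' : (2:ℝ) ^ i < dist x y := by
    rw [← ofReal_two_zpow, ENNReal.ofReal_lt_ofReal_iff hdp] at hi1; exact hi1
  have hi2' : dist x y ≤ (2:ℝ) ^ (i + 1) := by
    have : tw ((i:ℝ) + 1) = tw ((i + 1 : ℤ):ℝ) := by push_cast; rfl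
    rw [this, ← ofReal_two_zpow, ENNReal.ofReal_le_ofReal_iff (by positivity)] at hi2; exact hi2
  have hik : i + 1 ≤ k - 4 := by
    have := (zpow_lt_zpow_iff_right₀ (by norm_num : (1:ℝ) < 2)).1 (hi1'.trans_le hd)
    omega
  have hvol : tw (i * n) * vb n ≤ ∫⁻ z, sq (i + 1) z (x, y) := by
    set c := midpoint ℝ x y
    calc tw (i * n) * vb n = volume (closedBall c ((2:ℝ) ^ i)) := (vol_closedBall_two _ _).symm
      _ = ∫⁻ z, (closedBall c ((2:ℝ) ^ i)).indicator (fun _ => 1) z := by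
          rw [lintegral_indicator isClosed_closedBall.measurableSet, setLIntegral_const, one_mul]
      _ ≤ _ := by
          refine lintegral_mono fun z => ?_
          by_cases hz : z ∈ closedBall c ((2:ℝ) ^ i)
          swap
          · rw [Set.indicator_of_notMem hz]; exact zero_le
          rw [Set.indicator_of_mem hz]
          have h2 : (2:ℝ) ^ (i + 1) = 2 * 2 ^ i := by rw [zpow_add_one₀ (by norm_num)]; ring
          have hz' : dist z c ≤ (2:ℝ) ^ i := hz
          have d1 : dist x c ≤ (2:ℝ) ^ i := by
            rw [dist_left_midpoint]; norm_num; linarith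
          have d2 : dist y c ≤ (2:ℝ) ^ i := by
            rw [dist_right_midpoint]; norm_num; linarith
          unfold sq
          rw [Set.indicator_of_mem]
          constructor
          · simp only [mem_closedBall]
            linarith [dist_triangle_right x z c]
          · simp only [mem_closedBall]
            linarith [dist_triangle_right y z c]
  have hker : ker β (x, y) ≤ tw (i * (β - n)) := by
    unfold ker
    rw [← tw_rpow, ← ofReal_two_zpow, ENNReal.ofReal_rpow_of_pos (by positivity)]
    apply ENNReal.ofReal_le_ofReal
    rw [← dist_eq_norm]
    exact Real.rpow_le_rpow_of_nonpos (by positivity) hi1'.le (by linarith)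
  calc ker β (x, y) ≤ tw (i * (β - n)) := hker
    _ = (tw (2 * n - β) * (vb n)⁻¹) * (tw ((i + 1) * (β - 2 * n)) * (tw (i * n) * vb n)) := by
        have e : (tw (2 * n - β) * (vb n)⁻¹) * (tw ((i + 1) * (β - 2 * n)) * (tw (i * n) * vb n)) =
          (tw (2 * n - β) * (tw ((i + 1) * (β - 2 * n)) * tw (i * n))) * ((vb n)⁻¹ * vb n) := by ring
        rw [e, ENNReal.inv_mul_cancel (vb_ne_zero n) (vb_ne_top n), mul_one, ← tw_add, ← tw_add]
        congr 1; ring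
    _ ≤ (tw (2 * n - β) * (vb n)⁻¹) * (tw ((i + 1) * (β - 2 * n)) * ∫⁻ z, sq (i + 1) z (x, y)) := by
        gcongr
    _ ≤ _ := by
        refine mul_le_mul' le_rfl ?_
        have := ENNReal.le_tsum (f := fun i : ℤ => (if i ≤ k - 4 then
          tw (i * (β - 2 * n)) * ∫⁻ z, sq i z (x, y) else 0)) (i + 1)
        simp only [hik, if_true] at this
        push_cast at this
        exact this

/-- constant -/
noncomputable def Cb (n m N : ℕ) : ℝ≥0∞ := Cw n (m * N) * (vb n * vb n) + 1

lemma Cb_ne_top (n m N : ℕ) : Cb n m N ≠ ⊤ := by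
  have := Cw_ne_top n (m * N)
  have := vb_ne_top n
  unfold Cb; finiteness

lemma holder_ball {n : ℕ} {s : ℝ} {N : ℕ} (hconj : s.HolderConjugate (N:ℝ)) (m : ℕ)
    {b : Eu n → ℝ} (hb : BMO1 b) (hbm : Measurable b) {g h : Eu n → ℝ≥0∞} (hg : Measurable g)
    (hh : Measurable h) (i : ℤ) (z : Eu n) :
    ∫⁻ p, g p.1 * h p.2 * ‖b p.1 - b p.2‖ₑ ^ m * sq i z p ≤
      Cb n m N * (tw (i * (2 * n)) * (sv s i h z * sv s i g z)) := by
  set B := closedBall z ((2:ℝ) ^ i) with hB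
  have hBm : MeasurableSet B := isClosed_closedBall.measurableSet
  have hs0 : 0 < s := hconj.pos
  have hN0 : (0:ℝ) < N := hconj.symm.pos
  have e1 : ∫⁻ p, g p.1 * h p.2 * ‖b p.1 - b p.2‖ₑ ^ m * sq i z p =
      ∫⁻ p in B ×ˢ B, g p.1 * h p.2 * ‖b p.1 - b p.2‖ₑ ^ m := by
    rw [← lintegral_indicator (hBm.prod hBm)]
    refine lintegral_congr fun p => ?_
    unfold sq
    by_cases hp : p ∈ B ×ˢ B
    · rw [Set.indicator_of_mem hp, Set.indicator_of_mem hp, mul_one]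
    · rw [Set.indicator_of_notMem hp, Set.indicator_of_notMem hp, mul_zero]
  rw [e1, Measure.volume_eq_prod, ← Measure.prod_restrict]
  set μ := (volume : Measure (Eu n)).restrict B with hμ
  have m1 : Measurable (fun p : Eu n × Eu n => g p.1 * h p.2) :=
    (hg.comp measurable_fst).mul (hh.comp measurable_snd)
  have m2 : Measurable (fun p : Eu n × Eu n => ‖b p.1 - b p.2‖ₑ ^ m) :=
    (((hbm.comp measurable_fst).sub (hbm.comp measurable_snd)).enorm).pow_const m
  have H := ENNReal.lintegral_mul_le_Lp_mul_Lq (μ.prod μ) hconj m1.aemeasurable m2.aemeasurable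
  simp only [Pi.mul_apply] at H
  refine H.trans ?_
  have I1 : ∫⁻ p, (g p.1 * h p.2) ^ s ∂(μ.prod μ) =
      (tw (i * n) * av i (fun y => g y ^ s) z) * (tw (i * n) * av i (fun y => h y ^ s) z) := by
    have : ∀ p : Eu n × Eu n, (g p.1 * h p.2) ^ s = (g p.1 ^ s) * (h p.2 ^ s) := fun p =>
      ENNReal.mul_rpow_of_nonneg _ _ hs0.le
    simp only [this]
    rw [lintegral_prod_mul (hg.pow_const s).aemeasurable (hh.pow_const s).aemeasurable]
    have hav : ∀ u : Eu n → ℝ≥0∞, tw (i * n) * av i u z = ∫⁻ y, u y ∂μ := by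
      intro u
      unfold av
      rw [← mul_assoc, tw_mul_tw_neg, one_mul]
    rw [hav, hav]
  have I2 : ∫⁻ p, (‖b p.1 - b p.2‖ₑ ^ m) ^ (N:ℝ) ∂(μ.prod μ) ≤
      Cb n m N * tw (i * (2 * n)) := by
    have : ∀ p : Eu n × Eu n, (‖b p.1 - b p.2‖ₑ ^ m) ^ (N:ℝ) = ‖b p.1 - b p.2‖ₑ ^ (m * N) := by
      intro p; rw [ENNReal.rpow_natCast, ← pow_mul]
    simp only [this]
    have m3 : Measurable (fun p : Eu n × Eu n => ‖b p.1 - b p.2‖ₑ ^ (m * N)) :=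
      (((hbm.comp measurable_fst).sub (hbm.comp measurable_snd)).enorm).pow_const (m * N)
    rw [lintegral_prod _ m3.aemeasurable]
    refine (double_moment_ball hb hbm (m * N) z (r := (2:ℝ) ^ i) (by positivity)).trans ?_
    rw [vol_closedBall_two, Cb]
    have e : tw ((i:ℝ) * (2 * n)) = tw (i * n) * tw (i * n) := by rw [← tw_add]; congr 1; ring
    rw [e]
    calc _ = Cw n (m * N) * (vb n * vb n) * (tw (i * n) * tw (i * n)) := by ring
      _ ≤ _ := mul_le_mul' le_self_add le_rfl
  rw [I1]
  have hN1 : 1 ≤ (N:ℝ) := hconj.symm.lt.le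
  have hCb1 : 1 ≤ Cb n m N := le_add_self
  calc _ ≤ ((tw (i * n) * av i (fun y => g y ^ s) z) * (tw (i * n) * av i (fun y => h y ^ s) z)) ^ (1 / s) *
        (Cb n m N * tw (i * (2 * n))) ^ (1 / (N:ℝ)) :=
        mul_le_mul' le_rfl (ENNReal.rpow_le_rpow I2 (by positivity))
    _ ≤ (tw (i * n * (1 / s)) * sv s i g z) * (tw (i * n * (1 / s)) * sv s i h z) *
        (Cb n m N * tw (i * (2 * n) * (1 / (N:ℝ)))) := by
        have h0 : 0 ≤ 1 / s := by positivity
        refine mul_le_mul' (le_of_eq ?_) ?_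
        · rw [ENNReal.mul_rpow_of_nonneg _ _ h0, ENNReal.mul_rpow_of_nonneg _ _ h0,
            ENNReal.mul_rpow_of_nonneg _ _ h0, tw_rpow]; rfl
        · rw [ENNReal.mul_rpow_of_nonneg _ _ (by positivity), tw_rpow]
          refine mul_le_mul' ?_ le_rfl
          calc _ ≤ (Cb n m N) ^ (1:ℝ) := rpow_le_self_of_one_le hCb1 (by
                rw [div_le_one hN0]; exact hN1)
            _ = _ := ENNReal.rpow_one _
    _ = Cb n m N * ((tw (i * n * (1 / s)) * tw (i * n * (1 / s)) * tw (i * (2 * n) * (1 / (N:ℝ)))) *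
        (sv s i h z * sv s i g z)) := by ring
    _ = _ := by
        rw [← tw_add, ← tw_add]
        congr 3
        have := hconj.inv_add_inv_eq_one
        have e2 : 1 / s + 1 / (N:ℝ) = 1 := by rw [one_div, one_div]; exact this
        calc _ = (i:ℝ) * (2 * n) * (1 / s + 1 / (N:ℝ)) := by ring
          _ = _ := by rw [e2, mul_one]

end HM

namespace HM

/-- near part of the operator -/
noncomputable def Tn {n : ℕ} (β : ℝ) (m : ℕ) (b : Eu n → ℝ) (k : ℤ) (h : Eu n → ℝ≥0∞) (x : Eu n) :
    ℝ≥0∞ := ∫⁻ y, h y * ‖b x - b y‖ₑ ^ m * nk β k (x, y)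

lemma measurable_w {n : ℕ} {b : Eu n → ℝ} (hbm : Measurable b) (m : ℕ) :
    Measurable (fun p : Eu n × Eu n => ‖b p.1 - b p.2‖ₑ ^ m) :=
  (((hbm.comp measurable_fst).sub (hbm.comp measurable_snd)).enorm).pow_const m

lemma measurable_Tn {n : ℕ} (β : ℝ) (m : ℕ) {b : Eu n → ℝ} (hbm : Measurable b) (k : ℤ)
    {h : Eu n → ℝ≥0∞} (hh : Measurable h) : Measurable (Tn β m b k h) := by
  unfold Tn
  exact Measurable.lintegral_prod_right'
    (f := fun p : Eu n × Eu n => h p.2 * ‖b p.1 - b p.2‖ₑ ^ m * nk β k p)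
    (((hh.comp measurable_snd).mul (measurable_w hbm m)).mul (measurable_nk β k))

lemma measurable_sv {n : ℕ} (s : ℝ) (i : ℤ) {h : Eu n → ℝ≥0∞} (hh : Measurable h) :
    Measurable (sv s i h) := (measurable_av i (hh.pow_const s)).pow_const _

lemma measurable_Th {n : ℕ} {q : Eu n → ℝ} (hq : Measurable q) (s : ℝ) {h : Eu n → ℝ≥0∞}
    (hh : Measurable h) : Measurable (Th q s h) :=
  ((measurable_mx (hh.pow (hq.div_const s))).add_const 1).pow_const s

lemma annulus_subset_Ek (n : ℕ) (k j : ℤ) (h1 : k - 1 ≤ j) (h2 : j ≤ k + 1) :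
    annulus n j ⊆ Ek n k := by
  intro x hx
  have hx1 : ‖x‖ ≤ (2:ℝ) ^ j := by simpa using hx.1
  have hx2 : (2:ℝ) ^ (j - 1) < ‖x‖ := by simpa using hx.2
  constructor
  · exact (zpow_le_zpow_right₀ (by norm_num) (by omega)).trans hx2.le
  · exact hx1.trans (zpow_le_zpow_right₀ (by norm_num) (by omega))

lemma sv_zero {n : ℕ} {s : ℝ} (hs : 0 < s) {k i : ℤ} (hi : i ≤ k - 4) {g : Eu n → ℝ≥0∞}
    (hg : ∀ y, g y ≠ 0 → y ∈ annulus n k) {z : Eu n} (hz : z ∉ Ek n k) : sv s i g z = 0 := by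
  have : ∫⁻ y in closedBall z ((2:ℝ) ^ i), g y ^ s = 0 := by
    rw [setLIntegral_congr_fun (g := fun _ => 0) isClosed_closedBall.measurableSet]
    · simp
    intro y hy
    have : g y = 0 := by
      by_contra h0
      have hx := hg y h0
      have hx1 : ‖y‖ ≤ (2:ℝ) ^ k := by simpa using hx.1
      have hx2 : (2:ℝ) ^ (k - 1) < ‖y‖ := by simpa using hx.2
      have hd : ‖y - z‖ ≤ (2:ℝ) ^ (k - 4) := by
        rw [← dist_eq_norm]
        exact (mem_closedBall.1 hy).trans (zpow_le_zpow_right₀ (by norm_num) hi)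
      apply hz
      have e1 : (2:ℝ) ^ (k - 1) = 8 * 2 ^ (k - 4) := by
        rw [show k - 1 = (k - 4) + 3 by ring, zpow_add₀ (by norm_num)]; norm_num; ring
      have e2 : (2:ℝ) ^ (k - 2) = 4 * 2 ^ (k - 4) := by
        rw [show k - 2 = (k - 4) + 2 by ring, zpow_add₀ (by norm_num)]; norm_num; ring
      have e3 : (2:ℝ) ^ k = 16 * 2 ^ (k - 4) := by
        rw [show k = (k - 4) + 4 by ring, zpow_add₀ (by norm_num)]; norm_num; ring
      have e4 : (2:ℝ) ^ (k + 2) = 64 * 2 ^ (k - 4) := by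
        rw [show k + 2 = (k - 4) + 6 by ring, zpow_add₀ (by norm_num)]; norm_num; ring
      have hp : (0:ℝ) < 2 ^ (k - 4) := by positivity
      have t1 := norm_sub_norm_le y z
      have t2 := norm_sub_norm_le z y
      rw [norm_sub_rev] at t2
      constructor <;> linarith
    simp only [this, ENNReal.zero_rpow_of_pos hs]
  unfold sv av
  simp only [this, mul_zero]
  exact ENNReal.zero_rpow_of_pos (by positivity)

lemma swap_sq {n : ℕ} (i : ℤ) {G : Eu n × Eu n → ℝ≥0∞} (hGm : Measurable G) :
    ∫⁻ p, G p * ∫⁻ z, sq i z p = ∫⁻ z, ∫⁻ p, G p * sq i z p := by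
  have hm : Measurable (Function.uncurry fun (p : Eu n × Eu n) (z : Eu n) => G p * sq i z p) :=
    (hGm.comp measurable_fst).mul (measurable_sq i)
  have : ∀ p : Eu n × Eu n, G p * ∫⁻ z, sq i z p = ∫⁻ z, G p * sq i z p := by
    intro p
    have hz : Measurable (fun z => sq i z p) :=
      Measurable.comp (g := fun r : (Eu n × Eu n) × Eu n => sq i r.2 r.1) (f := fun z => (p, z))
        (measurable_sq i) measurable_prodMk_left
    exact (lintegral_const_mul (G p) hz).symm
  rw [lintegral_congr this]
  exact lintegral_lintegral_swap hm.aemeasurable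

set_option maxHeartbeats 1000000 in
lemma near_bilinear {n : ℕ} {q1 q2 : Eu n → ℝ} {β s Q C : ℝ} {N : ℕ} (P : Par n q1 q2 β s Q C N)
    (m : ℕ) (K : ℝ≥0∞) (hK : K ≠ ⊤) :
    ∃ D : ℝ≥0∞, D ≠ ⊤ ∧ ∀ (b : Eu n → ℝ), BMO1 b → Measurable b → ∀ (k : ℤ) (h g : Eu n → ℝ≥0∞),
      Measurable h → Measurable g → (∀ y, h y ≠ 0 → y ∈ Ek n k) →
      (∀ y, g y ≠ 0 → y ∈ annulus n k) → ∫⁻ y, h y ^ q1 y ≤ K * tw (k * n) →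
      ∫⁻ y, g y ^ (q2 y / (q2 y - 1)) ≤ tw (k * n) →
      ∫⁻ x, g x * Tn β m b k h x ≤ D * tw (k * (β + n)) := by
  have hs0 : 0 < s := by linarith [P.hs]
  have hq2m' : Measurable (fun x => q2 x / (q2 x - 1)) := P.hq2m.div (P.hq2m.sub_const 1)
  obtain ⟨D1, hD1, hD1t, H1⟩ := theta P.hn P.hs P.hq1m P.hq1l P.hq1u P.hC P.hr1 K hK
  obtain ⟨D2, hD2, hD2t, H2⟩ := theta P.hn P.hs hq2m' P.hq2l' P.hq2u' P.hC P.hr2 1 (by simp)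
  set D := D1 + D2 with hD
  have hDt : D ≠ ⊤ := by finiteness
  have hDD : 1 ≤ D := hD1.trans le_self_add
  set D3 : ℝ≥0∞ := (D * (Cg β + Cg (n / Q)) + 1) ^ Q with hD3
  have hQ0 : 0 < Q := by linarith [P.hq2l 0, P.hq2u 0]
  have hn0 : (0:ℝ) < n := by exact_mod_cast P.hn
  have hD3t : D3 ≠ ⊤ := by
    have := Cg_ne_top P.hβ
    have := Cg_ne_top (div_pos hn0 hQ0)
    exact ENNReal.rpow_ne_top_of_nonneg hQ0.le (by finiteness)
  set c : ℝ≥0∞ := tw (2 * n - β) * (vb n)⁻¹ with hc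
  have hct : c ≠ ⊤ := ENNReal.mul_ne_top (tw_ne_top _) (ENNReal.inv_ne_top.2 (vb_ne_zero n))
  have hCbt := Cb_ne_top n m N
  refine ⟨c * Cb n m N * (D3 * D1 + D * D2), by finiteness, ?_⟩
  intro b hb hbm k h g hh hg hsh hsg hih hig
  obtain ⟨A1, A2, A3⟩ := H1 k h hh hsh hih
  obtain ⟨B1, B2, B3⟩ := H2 k g hg (fun y hy => annulus_subset_Ek n k k (by omega) (by omega) (hsg y hy))
    (by rw [one_mul]; exact hig)
  set G : Eu n × Eu n → ℝ≥0∞ := fun p => g p.1 * h p.2 * ‖b p.1 - b p.2‖ₑ ^ m with hG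
  have hGm : Measurable G :=
    ((hg.comp measurable_fst).mul (hh.comp measurable_snd)).mul (measurable_w hbm m)
  have step1 : ∫⁻ x, g x * Tn β m b k h x = ∫⁻ p, G p * nk β k p := by
    have hGn : Measurable (fun p => G p * nk β k p) := hGm.mul (measurable_nk β k)
    rw [Measure.volume_eq_prod, lintegral_prod _ hGn.aemeasurable]
    refine lintegral_congr fun x => ?_
    unfold Tn
    rw [← lintegral_const_mul _ (by
      exact ((hh.mul ((measurable_w hbm m).comp measurable_prodMk_left)).mul
        ((measurable_nk β k).comp measurable_prodMk_left)))]
    refine lintegral_congr fun y => ?_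
    simp only [hG]; ring
  have step2 : ∀ i : ℤ, ∫⁻ p, G p * ∫⁻ z, sq i z p =
      ∫⁻ z, ∫⁻ p, G p * sq i z p := by
    exact fun i => swap_sq i hGm
  have msq : ∀ i : ℤ, Measurable (fun p : Eu n × Eu n => ∫⁻ z, sq i z p) := fun i =>
    (measurable_sq i).lintegral_prod_right'
  have mterm : ∀ i : ℤ, Measurable (fun p : Eu n × Eu n => if i ≤ k - 4 then
      tw (i * (β - 2 * n)) * ∫⁻ z, sq i z p else 0) := by
    intro i
    split_ifs
    · exact (msq i).const_mul _
    · exact measurable_const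
  calc ∫⁻ x, g x * Tn β m b k h x = ∫⁻ p, G p * nk β k p := step1
    _ ≤ ∫⁻ p, c * ∑' i : ℤ, G p * (if i ≤ k - 4 then
      tw (i * (β - 2 * n)) * ∫⁻ z, sq i z p else 0) := by
        refine lintegral_mono fun p => ?_
        rw [ENNReal.tsum_mul_left, mul_left_comm]
        exact mul_le_mul' le_rfl (nk_le P.hβn k p)
    _ = c * ∑' i : ℤ, ∫⁻ p, G p * (if i ≤ k - 4 then
      tw (i * (β - 2 * n)) * ∫⁻ z, sq i z p else 0) := by
        rw [lintegral_const_mul' _ _ hct, lintegral_tsum]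
        intro i
        exact (hGm.mul (mterm i)).aemeasurable
    _ ≤ c * ∑' i : ℤ, ∫⁻ z, Cb n m N * tw (k * β) * (if i ≤ k - 4 then
          tw ((i - k) * β) * (sv s i h z * sv s i g z) else 0) := by
        refine mul_le_mul' le_rfl (ENNReal.tsum_le_tsum fun i => ?_)
        split_ifs with hi
        · calc _ = tw (i * (β - 2 * n)) * ∫⁻ p, G p * ∫⁻ z, sq i z p := by
                rw [← lintegral_const_mul' _ _ (tw_ne_top _)]
                refine lintegral_congr fun p => ?_
                ring
            _ = ∫⁻ z, tw (i * (β - 2 * n)) * ∫⁻ p, G p * sq i z p := by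
                rw [step2, lintegral_const_mul' _ _ (tw_ne_top _)]
            _ ≤ _ := by
                refine lintegral_mono fun z => ?_
                calc _ ≤ tw (i * (β - 2 * n)) *
                      (Cb n m N * (tw (i * (2 * n)) * (sv s i h z * sv s i g z))) :=
                      mul_le_mul' le_rfl (holder_ball P.hconj m hb hbm hg hh i z)
                  _ = Cb n m N * (tw (i * (β - 2 * n)) * tw (i * (2 * n))) *
                      (sv s i h z * sv s i g z) := by ring
                  _ = Cb n m N * (tw (k * β) * tw ((i - k) * β)) *
                      (sv s i h z * sv s i g z) := by
                      rw [← tw_add, ← tw_add]; congr 3; ring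
                  _ = _ := by ring
        · simp
    _ = c * ∫⁻ z, Cb n m N * tw (k * β) * ∑' i : ℤ, (if i ≤ k - 4 then
          tw ((i - k) * β) * (sv s i h z * sv s i g z) else 0) := by
        rw [← lintegral_tsum]
        · simp only [ENNReal.tsum_mul_left]
        · intro i
          refine Measurable.aemeasurable (Measurable.const_mul ?_ _)
          split_ifs
          · exact ((measurable_sv s i hh).mul (measurable_sv s i hg)).const_mul _
          · exact measurable_const
    _ = c * (Cb n m N * tw (k * β)) * ∫⁻ z, ∑' i : ℤ, (if i ≤ k - 4 then
          tw ((i - k) * β) * (sv s i h z * sv s i g z) else 0) := by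
        rw [lintegral_const_mul' _ _ (ENNReal.mul_ne_top hCbt (tw_ne_top _)), ← mul_assoc c]
    _ ≤ c * (Cb n m N * tw (k * β)) * ∫⁻ z in Ek n k, (D3 * Th q1 s h z +
          D * Th (fun x => q2 x / (q2 x - 1)) s g z) := by
        refine mul_le_mul' le_rfl ?_
        rw [← lintegral_indicator (measurableSet_Ek n k)]
        refine lintegral_mono fun z => ?_
        by_cases hz : z ∈ Ek n k
        · rw [Set.indicator_of_mem hz]
          refine near_sum P.hn P.hβ ?_ (P.hq2l z) (P.hq2u z) (P.hqq z) hDD k _ _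
            (one_le_Th _ hs0 _ _) ?_ ?_ ?_
          · nlinarith [P.hq1l z, P.hs]
          · intro i hi
            exact (A1 z hz i hi).trans (mul_le_mul' le_self_add le_rfl)
          · intro i hi
            exact (A2 z hz i hi).trans (mul_le_mul' le_self_add le_rfl)
          · intro i hi
            exact (B1 z hz i hi).trans (mul_le_mul' le_add_self le_rfl)
        · rw [Set.indicator_of_notMem hz]
          refine le_of_eq (ENNReal.tsum_eq_zero.2 fun i => ?_)
          split_ifs with hi
          · rw [sv_zero hs0 hi hsg hz]; simp
          · rfl
    _ = c * (Cb n m N * tw (k * β)) * (D3 * (∫⁻ z in Ek n k, Th q1 s h z) +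
          D * ∫⁻ z in Ek n k, Th (fun x => q2 x / (q2 x - 1)) s g z) := by
        rw [lintegral_add_left ((measurable_Th P.hq1m s hh).const_mul _),
          lintegral_const_mul' _ _ hD3t, lintegral_const_mul' _ _ hDt]
    _ ≤ c * (Cb n m N * tw (k * β)) * (D3 * (D1 * tw (k * n)) + D * (D2 * tw (k * n))) := by
        gcongr
    _ = c * Cb n m N * (D3 * D1 + D * D2) * (tw (k * β) * tw (k * n)) := by ring
    _ = _ := by rw [← tw_add]; congr 2; ring

end HM

namespace HM

lemma duality_bdd {n : ℕ} {q : Eu n → ℝ} {Q : ℝ} (hqm : Measurable q) (hq1 : ∀ x, 1 < q x)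
    (hqQ : ∀ x, q x ≤ Q) {H : Eu n → ℝ≥0∞} (hH : Measurable H) {V K : ℝ≥0∞}
    (hV0 : V ≠ 0) (hV : V ≠ ⊤) (hK : K ≠ ⊤)
    (hfin : ∫⁻ x, (H x / (tw Q * (K + 1))) ^ q x ≠ ⊤)
    (hHt : ∀ x, H x ≠ ⊤)
    (hdual : ∀ g : Eu n → ℝ≥0∞, Measurable g → (∀ x, H x = 0 → g x = 0) →
      ∫⁻ x, (g x) ^ (q x / (q x - 1)) ≤ V → ∫⁻ x, g x * H x ≤ K * V) :
    ∫⁻ x, (H x / (tw Q * (K + 1))) ^ q x ≤ V := by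
  by_contra hcon
  push Not at hcon
  set C : ℝ≥0∞ := tw Q * (K + 1) with hC
  have hC0 : C ≠ 0 := mul_ne_zero (tw_ne_zero _) (by simp)
  have hCt : C ≠ ⊤ := ENNReal.mul_ne_top (tw_ne_top _) (by finiteness)
  let ρ : ℕ → ℝ≥0∞ := fun l => ∫⁻ x, (H x / (C * tw l)) ^ q x
  have h0 : ρ 0 = ∫⁻ x, (H x / C) ^ q x := by simp [ρ, tw_zero]
  have hdiv : ∀ (l : ℕ) x, H x / (C * tw l) = (H x / C) * tw (-(l:ℝ)) := by
    intro l x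
    rw [ENNReal.div_eq_inv_mul, ENNReal.mul_inv (Or.inl hC0) (Or.inl hCt), tw_inv,
      ENNReal.div_eq_inv_mul]; ring
  have hdecay : ∀ l : ℕ, ρ l ≤ tw (-(l:ℝ)) * ρ 0 := by
    intro l
    rw [h0, ← lintegral_const_mul' _ _ (tw_ne_top _)]
    refine lintegral_mono fun x => ?_
    simp only
    rw [hdiv, ENNReal.mul_rpow_of_nonneg _ _ (by linarith [hq1 x]), mul_comm]
    refine mul_le_mul' ?_ le_rfl
    rw [tw_rpow]; apply tw_mono
    have : (0:ℝ) ≤ l := l.cast_nonneg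
    nlinarith [hq1 x]
  have hex : ∃ l : ℕ, ρ l ≤ V := by
    have hr : ρ 0 / V ≠ ⊤ := by rw [h0]; exact ENNReal.div_ne_top hfin hV0
    obtain ⟨l, hl⟩ := ENNReal.exists_nat_gt hr
    refine ⟨l, (hdecay l).trans ?_⟩
    have h2 : (l:ℝ≥0∞) ≤ tw l := by
      have : (l:ℝ≥0∞) ≤ (2:ℝ≥0∞)^l := by exact_mod_cast (Nat.lt_two_pow_self (n := l)).le
      rw [tw, ENNReal.rpow_natCast]; exact this
    have h3 : ρ 0 ≤ tw l * V := by
      rw [← ENNReal.div_le_iff hV0 hV]; exact hl.le.trans h2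
    calc tw (-(l:ℝ)) * ρ 0 ≤ tw (-(l:ℝ)) * (tw l * V) := mul_le_mul' le_rfl h3
      _ = V := by rw [← mul_assoc, mul_comm (tw _), tw_mul_tw_neg, one_mul]
  classical
  obtain ⟨l, hl1, hl2⟩ : ∃ l : ℕ, ρ (l+1) ≤ V ∧ V < ρ l := by
    have hne : Nat.find hex ≠ 0 := by
      intro hz
      have := Nat.find_spec hex
      rw [hz, h0] at this
      exact absurd this (not_le.2 hcon)
    obtain ⟨l, hl⟩ := Nat.exists_eq_succ_of_ne_zero hne
    refine ⟨l, ?_, ?_⟩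
    · have := Nat.find_spec hex
      rw [hl] at this; exact this
    · have := Nat.find_min hex (m := l) (by omega)
      exact not_le.1 this
  set η : ℝ≥0∞ := C * tw ((l+1 : ℕ):ℝ) with hη
  have hη0 : η ≠ 0 := mul_ne_zero hC0 (tw_ne_zero _)
  have hηt : η ≠ ⊤ := ENNReal.mul_ne_top hCt (tw_ne_top _)
  have hstep : ρ l ≤ tw Q * ρ (l+1) := by
    simp only [ρ]
    rw [← lintegral_const_mul' _ _ (tw_ne_top _)]
    refine lintegral_mono fun x => ?_
    simp only
    have : H x / (C * tw l) = tw 1 * (H x / (C * tw ((l+1:ℕ):ℝ))) := by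
      rw [hdiv, hdiv, mul_comm (tw 1), mul_assoc, ← tw_add]; congr 2; push_cast; ring
    rw [this, ENNReal.mul_rpow_of_nonneg _ _ (by linarith [hq1 x]), tw_rpow]
    refine mul_le_mul' (tw_mono ?_) le_rfl
    linarith [hqQ x]
  let g : Eu n → ℝ≥0∞ := fun x => (H x / η) ^ (q x - 1)
  have hgm : Measurable g := (hH.div_const _).pow (hqm.sub_const 1)
  have hg1 : ∫⁻ x, (g x) ^ (q x / (q x - 1)) ≤ V := by
    refine le_trans (le_of_eq ?_) hl1
    simp only [ρ, g]
    refine lintegral_congr fun x => ?_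
    rw [← ENNReal.rpow_mul]; congr 1
    have : q x - 1 ≠ 0 := by linarith [hq1 x]
    field_simp
  have hg2 := hdual g hgm (by
    intro x hx
    simp only [g, hx, ENNReal.zero_div]
    exact ENNReal.zero_rpow_of_pos (by linarith [hq1 x])) hg1
  have hg3 : ∫⁻ x, g x * H x = η * ρ (l+1) := by
    simp only [ρ]
    rw [← lintegral_const_mul' _ _ hηt]
    refine lintegral_congr fun x => ?_
    have e : H x = η * (H x / η) := (ENNReal.mul_div_cancel hη0 hηt).symm
    simp only [g]
    by_cases hx : H x = 0
    · simp [hx, ENNReal.zero_rpow_of_pos (show 0 < q x by linarith [hq1 x])]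
    have hy0 : H x / η ≠ 0 := (ENNReal.div_pos hx hηt).ne'
    have hyt : H x / η ≠ ⊤ := ENNReal.div_ne_top (hHt x) hη0
    calc (H x / η) ^ (q x - 1) * H x = (H x / η) ^ (q x - 1) * (η * (H x / η)) := by rw [← e]
      _ = η * ((H x / η) ^ (q x - 1) * (H x / η)^(1:ℝ)) := by rw [ENNReal.rpow_one]; ring
      _ = η * (H x / η) ^ (q x) := by rw [← ENNReal.rpow_add _ _ hy0 hyt]; congr 2; ring
  rw [hg3] at hg2
  have h5 : C * V ≤ tw Q * (K * V) := by
    calc C * V ≤ η * (tw Q * ρ (l+1)) := by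
          refine mul_le_mul' ?_ (hl2.le.trans hstep)
          rw [hη]
          calc C = C * 1 := by simp
            _ ≤ _ := mul_le_mul' le_rfl (one_le_tw (by positivity))
      _ = tw Q * (η * ρ (l+1)) := by ring
      _ ≤ _ := mul_le_mul' le_rfl hg2
  rw [hC, mul_assoc, ENNReal.mul_le_mul_iff_right (tw_ne_zero _) (tw_ne_top _),
    ENNReal.mul_le_mul_iff_left hV0 hV] at h5
  have : K < K + 1 := ENNReal.lt_add_right hK (by simp)
  exact absurd h5 (not_le.2 this)

lemma duality {n : ℕ} {q : Eu n → ℝ} {Q : ℝ} (hqm : Measurable q) (hq1 : ∀ x, 1 < q x)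
    (hqQ : ∀ x, q x ≤ Q) {A : Set (Eu n)} (hA : MeasurableSet A) (hAt : volume A ≠ ⊤)
    {F : Eu n → ℝ≥0∞} (hF : Measurable F) {V K : ℝ≥0∞}
    (hV0 : V ≠ 0) (hV : V ≠ ⊤) (hK : K ≠ ⊤)
    (hdual : ∀ g : Eu n → ℝ≥0∞, Measurable g → (∀ x, x ∉ A → g x = 0) →
      ∫⁻ x, (g x) ^ (q x / (q x - 1)) ≤ V → ∫⁻ x, g x * F x ≤ K * V) :
    ∫⁻ x in A, (F x / (tw Q * (K + 1))) ^ q x ≤ V := by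
  set C : ℝ≥0∞ := tw Q * (K + 1) with hC
  have hC0 : C ≠ 0 := mul_ne_zero (tw_ne_zero _) (by simp)
  have hCt : C ≠ ⊤ := ENNReal.mul_ne_top (tw_ne_top _) (by finiteness)
  have hC1 : 1 ≤ C := by
    have hQ : 0 ≤ Q := by linarith [hq1 0, hqQ 0]
    calc (1:ℝ≥0∞) = 1 * 1 := by simp
      _ ≤ C := mul_le_mul' (one_le_tw hQ) (by simp)
  let H : ℕ → Eu n → ℝ≥0∞ := fun N => A.indicator (fun x => min (F x) N)
  have hHm : ∀ N, Measurable (H N) := fun N => (hF.min measurable_const).indicator hA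
  have hb : ∀ N, ∫⁻ x, (H N x / C) ^ q x ≤ V := by
    intro N
    refine duality_bdd hqm hq1 hqQ (hHm N) hV0 hV hK ?_ ?_ ?_
    · have : ∫⁻ x, (H N x / C) ^ q x ≤ ∫⁻ x, A.indicator (fun _ => tw 0 * ((N:ℝ≥0∞)+1)^Q) x := by
        refine lintegral_mono fun x => ?_
        by_cases hx : x ∈ A
        · simp only [H, Set.indicator_of_mem hx, tw_zero, one_mul]
          calc (min (F x) N / C) ^ q x ≤ ((N:ℝ≥0∞)+1) ^ q x := by
                refine ENNReal.rpow_le_rpow ?_ (by linarith [hq1 x])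
                refine ENNReal.div_le_of_le_mul ?_
                calc min (F x) N ≤ (N:ℝ≥0∞) := min_le_right _ _
                  _ ≤ ((N:ℝ≥0∞)+1) * 1 := by simp
                  _ ≤ _ := mul_le_mul' le_rfl hC1
            _ ≤ _ := ENNReal.rpow_le_rpow_of_exponent_le (by simp) (hqQ x)
        · simp only [H, Set.indicator_of_notMem hx, ENNReal.zero_div]
          rw [ENNReal.zero_rpow_of_pos (by linarith [hq1 x])]
      refine ne_top_of_le_ne_top ?_ this
      rw [lintegral_indicator hA, lintegral_const]
      refine ENNReal.mul_ne_top ?_ (by simpa using hAt)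
      rw [tw_zero, one_mul]
      exact ENNReal.rpow_ne_top_of_nonneg (by linarith [hq1 0, hqQ 0]) (by finiteness)
    · intro x
      simp only [H, Set.indicator]
      split_ifs
      · exact ne_top_of_le_ne_top (by finiteness) (min_le_right (F x) (N:ℝ≥0∞))
      · simp
    · intro g hg hg0 hgV
      have h1 := hdual g hg (fun x hx => hg0 x (by simp [H, hx])) hgV
      refine le_trans (lintegral_mono fun x => mul_le_mul' le_rfl ?_) h1
      simp only [H, Set.indicator]
      split_ifs
      · exact min_le_left _ _
      · exact zero_le
  have hlim : ∫⁻ x in A, (F x / C) ^ q x = ⨆ N, ∫⁻ x, (H N x / C) ^ q x := by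
    rw [← lintegral_iSup]
    · rw [← lintegral_indicator hA]
      refine lintegral_congr fun x => ?_
      by_cases hx : x ∈ A
      · simp only [H, Set.indicator_of_mem hx]
        have hs : F x = ⨆ N : ℕ, min (F x) (N:ℝ≥0∞) := by
          rw [← inf_iSup_eq, ENNReal.iSup_natCast]; simp
        have hq0 : 0 < q x := by linarith [hq1 x]
        have := (ENNReal.orderIsoRpow (q x) hq0).map_iSup (fun N : ℕ => min (F x) (N:ℝ≥0∞) / C)
        simp only [ENNReal.orderIsoRpow_apply] at this
        rw [← this, ← ENNReal.iSup_div, ← hs]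
      · simp only [H, Set.indicator_of_notMem hx, ENNReal.zero_div]
        rw [ENNReal.zero_rpow_of_pos (by linarith [hq1 x])]; simp
    · intro N
      exact ((hHm N).div_const _).pow hqm
    · intro N N' hNN x
      refine ENNReal.rpow_le_rpow (ENNReal.div_le_div_right ?_ _) (by linarith [hq1 x])
      simp only [H]
      refine Set.indicator_le_indicator ?_
      exact min_le_min le_rfl (by exact_mod_cast hNN)
  rw [hlim]
  exact iSup_le hb

end HM

namespace HM

/-- the positive commutator -/
noncomputable def Tf {n : ℕ} (β : ℝ) (m : ℕ) (b : Eu n → ℝ) (h : Eu n → ℝ≥0∞) (x : Eu n) : ℝ≥0∞ :=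
  ∫⁻ y, h y * ‖b x - b y‖ₑ ^ m * ker β (x, y)

lemma measurable_Tf {n : ℕ} (β : ℝ) (m : ℕ) {b : Eu n → ℝ} (hbm : Measurable b)
    {h : Eu n → ℝ≥0∞} (hh : Measurable h) : Measurable (Tf β m b h) := by
  unfold Tf
  exact Measurable.lintegral_prod_right'
    (f := fun p : Eu n × Eu n => h p.2 * ‖b p.1 - b p.2‖ₑ ^ m * ker β p)
    (((hh.comp measurable_snd).mul (measurable_w hbm m)).mul (measurable_ker β))

lemma measurableSet_annulus (n : ℕ) (k : ℤ) : MeasurableSet (annulus n k) :=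
  isClosed_closedBall.measurableSet.diff isClosed_closedBall.measurableSet

lemma vol_annulus_le (n : ℕ) (k : ℤ) : volume (annulus n k) ≤ vb n * tw (k * n) := by
  rw [mul_comm, ← vol_closedBall_two (0 : Eu n) k]
  exact measure_mono Set.sdiff_subset

lemma combine_two {X u v E L : ℝ≥0∞} {q : ℝ} (hq : 1 ≤ q)
    (h : X ≤ E * L * (u + v)) : (X / (4 * E * L)) ^ q ≤ 2⁻¹ * (u ^ q + v ^ q) := by
  have h1 : X / (4 * E * L) ≤ max u v / 2 := by
    refine ENNReal.div_le_of_le_mul ?_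
    calc X ≤ E * L * (u + v) := h
      _ ≤ E * L * (2 * max u v) := by
        refine mul_le_mul' le_rfl ?_
        rw [two_mul]; exact add_le_add (le_max_left _ _) (le_max_right _ _)
      _ = (max u v / 2) * (4 * E * L) := by
        have : max u v / 2 * 4 = 2 * max u v := by
          rw [show (4:ℝ≥0∞) = 2 * 2 by norm_num, ← mul_assoc,
            ENNReal.div_mul_cancel (by norm_num) (by norm_num), mul_comm]
        calc _ = (2 * max u v) * E * L := by ring
          _ = _ := by rw [← this]; ring
  calc (X / (4 * E * L)) ^ q ≤ (max u v / 2) ^ q := ENNReal.rpow_le_rpow h1 (by linarith)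
    _ ≤ 2⁻¹ * (max u v) ^ q := div_rpow_le (by norm_num) hq
    _ ≤ _ := by
      refine mul_le_mul' le_rfl ?_
      rcases le_total u v with hh | hh
      · rw [max_eq_right hh]; exact le_add_self
      · rw [max_eq_left hh]; exact le_self_add

/-- near part, strong form -/
lemma near_strong {n : ℕ} {q1 q2 : Eu n → ℝ} {β s Q C : ℝ} {N : ℕ}
    (P : Par n q1 q2 β s Q C N) (m : ℕ) : ∃ D : ℝ≥0∞, D ≠ ⊤ ∧ D ≠ 0 ∧
      ∀ b : Eu n → ℝ, BMO1 b → Measurable b → ∀ (j k : ℤ), k - 1 ≤ j → j ≤ k + 1 →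
      ∀ h : Eu n → ℝ≥0∞, Measurable h → (∀ y, h y ≠ 0 → y ∈ annulus n j) →
      ∫⁻ y, h y ^ q1 y ≤ tw (j * n) →
      ∫⁻ x in annulus n k, (tw (-(k * β)) * Tn β m b k h x / D) ^ q2 x ≤ tw (k * n) := by
  obtain ⟨D, hD, H⟩ := near_bilinear P m (tw n) (tw_ne_top _)
  refine ⟨tw Q * (D + 1), ENNReal.mul_ne_top (tw_ne_top _) (by finiteness),
    mul_ne_zero (tw_ne_zero _) (by simp), ?_⟩
  intro b hb hbm j k h1 h2 h hh hs hi
  refine duality P.hq2m P.hq2l P.hq2u (measurableSet_annulus n k)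
    (ne_top_of_le_ne_top (ENNReal.mul_ne_top (vb_ne_top n) (tw_ne_top _)) (vol_annulus_le n k))
    ((measurable_Tn β m hbm k hh).const_mul _) (tw_ne_zero _) (tw_ne_top _) hD ?_
  intro g hg hg0 hgV
  have := H b hb hbm k h g hh hg (fun y hy => annulus_subset_Ek n k j h1 h2 (hs y hy))
    (fun y hy => by by_contra hc; exact hy (hg0 y hc)) (hi.trans (by
      rw [← tw_add]; apply tw_mono
      have : (j:ℝ) ≤ k + 1 := by exact_mod_cast h2
      have hn : (0:ℝ) ≤ n := n.cast_nonneg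
      nlinarith)) hgV
  calc ∫⁻ x, g x * (tw (-(k * β)) * Tn β m b k h x)
      = tw (-(k * β)) * ∫⁻ x, g x * Tn β m b k h x := by
        rw [← lintegral_const_mul' _ _ (tw_ne_top _)]
        refine lintegral_congr fun x => ?_
        ring
    _ ≤ tw (-(k * β)) * (D * tw (k * (β + n))) := mul_le_mul' le_rfl this
    _ = D * (tw (-(k * β)) * tw (k * (β + n))) := by ring
    _ = D * tw (k * n) := by rw [← tw_add]; congr 2; ring

/-- far part, strong form -/
lemma far_strong {n : ℕ} {q1 q2 : Eu n → ℝ} {β s Q C : ℝ} {N : ℕ}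
    (P : Par n q1 q2 β s Q C N) (m : ℕ) : ∃ D : ℝ≥0∞, D ≠ ⊤ ∧ D ≠ 0 ∧
      ∀ b : Eu n → ℝ, BMO1 b → Measurable b → ∀ (j k : ℤ),
      ∀ h : Eu n → ℝ≥0∞, Measurable h → (∀ y, h y ≠ 0 → y ∈ annulus n j) →
      ∫⁻ y, h y ^ q1 y ≤ tw (j * n) →
      ∫⁻ x in annulus n k, (tw (-(j * n)) * (∫⁻ y, h y * ‖b x - b y‖ₑ ^ m) /
        (1 + ((j - k).natAbs : ℝ≥0∞)) ^ m / D) ^ q2 x ≤ tw (k * n) := by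
  have hs0 : 0 < s := by linarith [P.hs]
  have hNpos : (0:ℝ) < N := P.hconj.symm.pos
  have hconj := P.hconj
  set c : ℝ≥0∞ := (1 + vb n) ^ ((N:ℝ) - 1) * Cw n (m * N) * vb n * vb n with hc
  have hct : c ≠ ⊤ := by
    rw [hc]
    refine ENNReal.mul_ne_top (ENNReal.mul_ne_top (ENNReal.mul_ne_top ?_ (Cw_ne_top _ _)) (vb_ne_top n)) (vb_ne_top n)
    refine ENNReal.rpow_ne_top_of_nonneg ?_ (by simp [vb_ne_top])
    have := hconj.symm.lt; linarith
  refine ⟨c + vb n + 1, by simp [hct, vb_ne_top], by simp, ?_⟩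
  intro b hb hbm j k h hh hs hi
  set L : ℝ≥0∞ := 1 + ((j - k).natAbs : ℝ≥0∞) with hL
  have hL0 : L ≠ 0 := by simp [hL]
  have hLt : L ≠ ⊤ := by rw [hL]; finiteness
  have hq2pos : ∀ x, 0 < q2 x := fun x => by linarith [P.hq2l x]
  set G : Eu n → ℝ≥0∞ := fun x => tw (-(j * n)) * ∫⁻ y, h y * ‖b x - b y‖ₑ ^ m with hG
  -- Hölder
  have hint_s : ∫⁻ y, h y ^ s ≤ (1 + vb n) * tw (j * n) := by
    calc ∫⁻ y, h y ^ s ≤ ∫⁻ y, (h y ^ q1 y + (annulus n j).indicator (fun _ => 1) y) := by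
          refine lintegral_mono fun y => ?_
          by_cases hy : h y = 0
          · simp [hy, ENNReal.zero_rpow_of_pos hs0]
          · simp only [Set.indicator_of_mem (hs y hy)]
            refine rpow_le_rpow_add_one hs0.le ?_
            have := P.hq1l y; nlinarith [P.hs]
      _ = (∫⁻ y, h y ^ q1 y) + volume (annulus n j) := by
          rw [lintegral_add_right _ (measurable_const.indicator (measurableSet_annulus n j)),
            lintegral_indicator (measurableSet_annulus n j)]
          simp
      _ ≤ tw (j * n) + vb n * tw (j * n) := add_le_add hi (vol_annulus_le n j)
      _ = _ := by ring
  have hGN : ∀ x, G x ^ (N:ℝ) ≤ (1 + vb n) ^ ((N:ℝ) - 1) * tw (-(j * n)) *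
      ∫⁻ y in closedBall 0 ((2:ℝ) ^ j), ‖b x - b y‖ₑ ^ (m * N) := by
    intro x
    have hwm : Measurable (fun y => ‖b x - b y‖ₑ ^ m) :=
      (measurable_w hbm m).comp measurable_prodMk_left
    have e1 : ∫⁻ y, h y * ‖b x - b y‖ₑ ^ m =
        ∫⁻ y in closedBall 0 ((2:ℝ) ^ j), (h * fun y => ‖b x - b y‖ₑ ^ m) y := by
      rw [← lintegral_indicator isClosed_closedBall.measurableSet]
      refine lintegral_congr fun y => ?_
      by_cases hy : h y = 0
      · have : (h * fun y => ‖b x - b y‖ₑ ^ m) y = 0 := by simp [hy]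
        by_cases hz : y ∈ closedBall (0 : Eu n) ((2:ℝ) ^ j)
        · rw [Set.indicator_of_mem hz, this]; simp [hy]
        · rw [Set.indicator_of_notMem hz]; simp [hy]
      · rw [Set.indicator_of_mem (hs y hy).1]; rfl
    have e2 := ENNReal.lintegral_mul_le_Lp_mul_Lq
      (volume.restrict (closedBall (0 : Eu n) ((2:ℝ) ^ j))) hconj hh.aemeasurable hwm.aemeasurable
    rw [← e1] at e2
    have e3 : ∫⁻ y in closedBall (0 : Eu n) ((2:ℝ) ^ j), h y ^ s ≤ (1 + vb n) * tw (j * n) :=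
      (setLIntegral_le_lintegral _ _).trans hint_s
    have e4 : ∀ y, (‖b x - b y‖ₑ ^ m) ^ (N:ℝ) = ‖b x - b y‖ₑ ^ (m * N) := by
      intro y; rw [ENNReal.rpow_natCast, pow_mul]
    simp only [e4] at e2
    set W := ∫⁻ y in closedBall 0 ((2:ℝ) ^ j), ‖b x - b y‖ₑ ^ (m * N)
    have hsN : 1 / s * N = N - 1 := by
      have := hconj.inv_add_inv_eq_one
      have h1 : s⁻¹ = 1 - (N:ℝ)⁻¹ := by linarith
      rw [one_div, h1]; field_simp
    have hN1 : (0:ℝ) ≤ (N:ℝ) - 1 := by have := hconj.symm.lt; linarith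
    calc G x ^ (N:ℝ) ≤ (tw (-(j * n)) * (((1 + vb n) * tw (j * n)) ^ (1 / s) * W ^ (1 / (N:ℝ)))) ^ (N:ℝ) := by
          refine ENNReal.rpow_le_rpow ?_ hNpos.le
          refine mul_le_mul' le_rfl (e2.trans ?_)
          refine mul_le_mul' (ENNReal.rpow_le_rpow e3 (by positivity)) le_rfl
      _ = tw (-(j * n) * N) * (((1 + vb n) ^ ((N:ℝ) - 1) * tw (j * n * (N - 1))) * W) := by
          rw [ENNReal.mul_rpow_of_nonneg _ _ hNpos.le, ENNReal.mul_rpow_of_nonneg _ _ hNpos.le,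
            ← ENNReal.rpow_mul, ← ENNReal.rpow_mul, hsN, tw_rpow,
            ENNReal.mul_rpow_of_nonneg _ _ hN1, tw_rpow, one_div_mul_cancel hNpos.ne', ENNReal.rpow_one]
      _ = (1 + vb n) ^ ((N:ℝ) - 1) * (tw (-(j * n) * N) * tw (j * n * (N - 1))) * W := by ring
      _ = _ := by rw [← tw_add]; congr 3; ring
  have hint : ∫⁻ x in annulus n k, G x ^ (N:ℝ) ≤ c * L ^ (m * N) * tw (k * n) := by
    have hcst : (1 + vb n) ^ ((N:ℝ) - 1) * tw (-(j * n)) ≠ ⊤ := by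
      refine ENNReal.mul_ne_top ?_ (tw_ne_top _)
      refine ENNReal.rpow_ne_top_of_nonneg ?_ (by simp [vb_ne_top])
      have := hconj.symm.lt; linarith
    calc ∫⁻ x in annulus n k, G x ^ (N:ℝ)
        ≤ ∫⁻ x in closedBall (0 : Eu n) ((2:ℝ) ^ k), G x ^ (N:ℝ) := lintegral_mono_set Set.sdiff_subset
      _ ≤ ∫⁻ x in closedBall (0 : Eu n) ((2:ℝ) ^ k), (1 + vb n) ^ ((N:ℝ) - 1) * tw (-(j * n)) *
          ∫⁻ y in closedBall 0 ((2:ℝ) ^ j), ‖b x - b y‖ₑ ^ (m * N) := lintegral_mono hGN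
      _ ≤ (1 + vb n) ^ ((N:ℝ) - 1) * tw (-(j * n)) * (Cw n (m * N) * L ^ (m * N) *
            (tw (k * n) * vb n * (tw (j * n) * vb n))) := by
          rw [lintegral_const_mul' _ _ hcst]
          refine mul_le_mul' le_rfl ?_
          rw [← vol_closedBall_two (0 : Eu n) k, ← vol_closedBall_two (0 : Eu n) j]
          exact double_moment_dyadic hb hbm (m * N) k j
      _ = c * L ^ (m * N) * tw (k * n) * (tw (j * n) * tw (-(j * n))) := by rw [hc]; ring
      _ = _ := by rw [tw_mul_tw_neg, mul_one]
  have hint2 : ∫⁻ x in annulus n k, (G x / L ^ m) ^ (N:ℝ) ≤ c * tw (k * n) := by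
    have hLm : L ^ (m * N) ≠ ⊤ := ENNReal.pow_ne_top hLt
    have hLm0 : L ^ (m * N) ≠ 0 := pow_ne_zero _ hL0
    calc ∫⁻ x in annulus n k, (G x / L ^ m) ^ (N:ℝ)
        = (L ^ (m * N))⁻¹ * ∫⁻ x in annulus n k, G x ^ (N:ℝ) := by
          rw [← lintegral_const_mul' _ _ (ENNReal.inv_ne_top.2 hLm0)]
          refine lintegral_congr fun x => ?_
          rw [ENNReal.div_rpow_of_nonneg _ _ hNpos.le, ENNReal.rpow_natCast (L ^ m), ← pow_mul,
            ENNReal.div_eq_inv_mul]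
      _ ≤ (L ^ (m * N))⁻¹ * (c * L ^ (m * N) * tw (k * n)) := mul_le_mul' le_rfl hint
      _ = (L ^ (m * N))⁻¹ * L ^ (m * N) * (c * tw (k * n)) := by ring
      _ = _ := by rw [ENNReal.inv_mul_cancel hLm0 hLm, one_mul]
  refine modular_div_le (by simp) (by simp [hct, vb_ne_top]) (fun x => (P.hq2l x).le) ?_
  calc ∫⁻ x in annulus n k, (G x / L ^ m) ^ q2 x
      ≤ ∫⁻ x in annulus n k, ((G x / L ^ m) ^ (N:ℝ) + 1) :=
        lintegral_mono fun x => rpow_le_rpow_add_one (hq2pos x).le ((P.hq2u x).trans P.hN)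
    _ = (∫⁻ x in annulus n k, (G x / L ^ m) ^ (N:ℝ)) + volume (annulus n k) := by
        rw [lintegral_add_right _ measurable_const]; simp
    _ ≤ c * tw (k * n) + vb n * tw (k * n) := add_le_add hint2 (vol_annulus_le n k)
    _ ≤ (c + vb n + 1) * tw (k * n) := by rw [← add_mul]; exact mul_le_mul' le_self_add le_rfl

lemma ker_far {n : ℕ} {β : ℝ} (hβn : β < n) (j k : ℤ) {x y : Eu n}
    (hx : x ∈ annulus n k) (hy : y ∈ annulus n j) :
    ker β (x, y) ≤ (if k - 1 ≤ j ∧ j ≤ k + 1 then nk β k (x, y) else 0) +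
      tw (5 * (n - β)) * tw (((max j k : ℤ):ℝ) * (β - n)) := by
  have hx1 : ‖x‖ ≤ (2:ℝ) ^ k := by simpa using hx.1
  have hx2 : (2:ℝ) ^ (k - 1) < ‖x‖ := by simpa using hx.2
  have hy1 : ‖y‖ ≤ (2:ℝ) ^ j := by simpa using hy.1
  have hy2 : (2:ℝ) ^ (j - 1) < ‖y‖ := by simpa using hy.2
  have key : (2:ℝ) ^ (max j k - 5) ≤ ‖x - y‖ →
      ker β (x, y) ≤ tw (5 * (n - β)) * tw (((max j k : ℤ):ℝ) * (β - n)) := by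
    intro hd
    unfold ker
    rw [← tw_add, ← ofReal_two_rpow]
    apply ENNReal.ofReal_le_ofReal
    have := Real.rpow_le_rpow_of_nonpos (by positivity) hd (show β - (n:ℝ) ≤ 0 by linarith)
    refine this.trans (le_of_eq ?_)
    rw [← Real.rpow_intCast, ← Real.rpow_mul (by norm_num)]
    congr 1; push_cast; ring
  by_cases hc : k - 1 ≤ j ∧ j ≤ k + 1
  · rw [if_pos hc]
    by_cases hd : dist x y ≤ (2:ℝ) ^ (k - 4)
    · unfold nk; rw [if_pos (by exact hd)]; exact le_self_add
    · push Not at hd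
      refine (key ?_).trans le_add_self
      rw [← dist_eq_norm]
      refine le_trans (zpow_le_zpow_right₀ (by norm_num) ?_) hd.le
      omega
  · rw [if_neg hc, zero_add]
    apply key
    rcases not_and_or.1 hc with h | h
    · have h1 : (2:ℝ) ^ j ≤ (2:ℝ) ^ (k - 2) := zpow_le_zpow_right₀ (by norm_num) (by omega)
      have h2 : (2:ℝ) ^ (k - 1) = 2 * (2:ℝ) ^ (k - 2) := by
        rw [show k - 1 = (k - 2) + 1 by ring, zpow_add_one₀ (by norm_num)]; ring
      have h3 : (2:ℝ) ^ (max j k - 5) ≤ (2:ℝ) ^ (k - 2) := zpow_le_zpow_right₀ (by norm_num) (by omega)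
      have h4 := norm_sub_norm_le x y
      linarith
    · have h1 : (2:ℝ) ^ k ≤ (2:ℝ) ^ (j - 2) := zpow_le_zpow_right₀ (by norm_num) (by omega)
      have h2 : (2:ℝ) ^ (j - 1) = 2 * (2:ℝ) ^ (j - 2) := by
        rw [show j - 1 = (j - 2) + 1 by ring, zpow_add_one₀ (by norm_num)]; ring
      have h3 : (2:ℝ) ^ (max j k - 5) ≤ (2:ℝ) ^ (j - 2) := zpow_le_zpow_right₀ (by norm_num) (by omega)
      have h4 := norm_sub_norm_le y x
      rw [norm_sub_rev] at h4
      linarith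

set_option maxHeartbeats 1000000 in
/-- the normalised single annulus estimate -/
lemma normalized {n : ℕ} {q1 q2 : Eu n → ℝ} {β s Q C : ℝ} {N : ℕ}
    (P : Par n q1 q2 β s Q C N) (m : ℕ) : ∃ D : ℝ≥0∞, D ≠ ⊤ ∧ D ≠ 0 ∧
      ∀ b : Eu n → ℝ, BMO1 b → Measurable b → ∀ (j k : ℤ),
      ∀ h : Eu n → ℝ≥0∞, Measurable h → (∀ y, h y ≠ 0 → y ∈ annulus n j) →
      ∫⁻ y, h y ^ q1 y ≤ tw (j * n) →
      ∫⁻ x in annulus n k, (tw (-(((max j k : ℤ):ℝ) * β) + (((max j k : ℤ):ℝ) - j) * n) * Tf β m b h x /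
        (D * (1 + ((j - k).natAbs : ℝ≥0∞)) ^ m)) ^ q2 x ≤ tw (k * n) := by
  obtain ⟨D1, hD1t, hD10, H1⟩ := near_strong P m
  obtain ⟨D2, hD2t, hD20, H2⟩ := far_strong P m
  set E : ℝ≥0∞ := tw n * D1 + tw (5 * (n - β)) * D2 with hE
  have hEt : E ≠ ⊤ := by
    rw [hE]
    exact ENNReal.add_ne_top.2 ⟨ENNReal.mul_ne_top (tw_ne_top _) hD1t, ENNReal.mul_ne_top (tw_ne_top _) hD2t⟩
  have hE0 : E ≠ 0 := by
    rw [hE]; simp [tw_ne_zero, hD10]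
  refine ⟨4 * E, ENNReal.mul_ne_top (by norm_num) hEt, mul_ne_zero (by norm_num) hE0, ?_⟩
  intro b hb hbm j k h hh hs hi
  set L : ℝ≥0∞ := 1 + ((j - k).natAbs : ℝ≥0∞) with hL
  have hLm1 : 1 ≤ L ^ m := one_le_pow₀ (by simp [hL])
  have hLm0 : L ^ m ≠ 0 := (lt_of_lt_of_le one_pos hLm1).ne'
  have hLmt : L ^ m ≠ ⊤ := ENNReal.pow_ne_top (by rw [hL]; finiteness)
  set u : Eu n → ℝ≥0∞ := fun x => if k - 1 ≤ j ∧ j ≤ k + 1 then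
    tw (-(k * β)) * Tn β m b k h x / D1 else 0 with hu
  set I : Eu n → ℝ≥0∞ := fun x => ∫⁻ y, h y * ‖b x - b y‖ₑ ^ m with hI
  set v : Eu n → ℝ≥0∞ := fun x => tw (-(j * n)) * I x / L ^ m / D2 with hv
  have hq2pos : ∀ x, 0 < q2 x := fun x => by linarith [P.hq2l x]
  have iu : ∫⁻ x in annulus n k, u x ^ q2 x ≤ tw (k * n) := by
    by_cases hc : k - 1 ≤ j ∧ j ≤ k + 1
    · simp only [hu, if_pos hc]; exact H1 b hb hbm j k hc.1 hc.2 h hh hs hi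
    · simp only [hu, if_neg hc, ENNReal.zero_rpow_of_pos (hq2pos _)]; simp
  have iv : ∫⁻ x in annulus n k, v x ^ q2 x ≤ tw (k * n) := H2 b hb hbm j k h hh hs hi
  have hum : Measurable u := by
    rw [hu]
    by_cases hc : k - 1 ≤ j ∧ j ≤ k + 1
    · simp only [if_pos hc]; exact ((measurable_Tn β m hbm k hh).const_mul _).div_const _
    · simp only [if_neg hc]; exact measurable_const
  set M : ℝ := ((max j k : ℤ):ℝ) with hM
  have hMk : (k:ℝ) ≤ M := by rw [hM]; exact_mod_cast le_max_right j k
  have hn0 : (0:ℝ) ≤ n := n.cast_nonneg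
  have hpt : ∀ x ∈ annulus n k, tw (-(M * β) + (M - j) * n) * Tf β m b h x ≤ E * L ^ m * (u x + v x) := by
    intro x hx
    have hwm : Measurable (fun y => ‖b x - b y‖ₑ ^ m) :=
      (measurable_w hbm m).comp measurable_prodMk_left
    have hT : Tf β m b h x ≤ (if k - 1 ≤ j ∧ j ≤ k + 1 then Tn β m b k h x else 0) +
        tw (5 * (n - β)) * tw (M * (β - n)) * I x := by
      calc Tf β m b h x ≤ ∫⁻ y, (h y * ‖b x - b y‖ₑ ^ m * (if k - 1 ≤ j ∧ j ≤ k + 1 then nk β k (x, y) else 0)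
            + tw (5 * (n - β)) * tw (M * (β - n)) * (h y * ‖b x - b y‖ₑ ^ m)) := by
            refine lintegral_mono fun y => ?_
            by_cases hy : h y = 0
            · simp [hy]
            · simp only
              refine le_trans (mul_le_mul' le_rfl (ker_far P.hβn j k hx (hs y hy))) (le_of_eq ?_)
              rw [← hM]; ring
        _ = _ := by
            have hhw : Measurable (fun y => h y * ‖b x - b y‖ₑ ^ m) := hh.mul hwm
            rw [lintegral_add_right _ (hhw.const_mul _), lintegral_const_mul _ hhw]
            congr 1
            by_cases hc : k - 1 ≤ j ∧ j ≤ k + 1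
            · simp only [if_pos hc]; rfl
            · simp only [if_neg hc]; simp
    have p1 : tw (-(M * β) + (M - j) * n) * (if k - 1 ≤ j ∧ j ≤ k + 1 then Tn β m b k h x else 0)
        ≤ tw n * D1 * u x := by
      by_cases hc : k - 1 ≤ j ∧ j ≤ k + 1
      · simp only [hu, if_pos hc]
        have hMj : M ≤ j + 1 := by rw [hM]; exact_mod_cast (by omega : max j k ≤ j + 1)
        calc tw (-(M * β) + (M - j) * n) * Tn β m b k h x
            ≤ tw (n + -(k * β)) * Tn β m b k h x := by
              refine mul_le_mul' (tw_mono ?_) le_rfl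
              nlinarith [P.hβ]
          _ = tw n * (tw (-(k * β)) * Tn β m b k h x) := by rw [tw_add]; ring
          _ = _ := by rw [mul_assoc, ENNReal.mul_div_cancel hD10 hD1t]
      · simp only [if_neg hc]; simp
    have p2 : tw (-(M * β) + (M - j) * n) * (tw (5 * (n - β)) * tw (M * (β - n)) * I x)
        ≤ tw (5 * (n - β)) * D2 * L ^ m * v x := by
      have e1 : tw (-(M * β) + (M - j) * n) * tw (M * (β - n)) = tw (-(j * n)) := by
        rw [← tw_add]; congr 1; ring
      have e2 : D2 * L ^ m * v x = tw (-(j * n)) * I x := by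
        rw [hv]; simp only
        rw [mul_comm D2, mul_assoc, ENNReal.mul_div_cancel hD20 hD2t, ENNReal.mul_div_cancel hLm0 hLmt]
      calc _ = tw (5 * (n - β)) * (tw (-(M * β) + (M - j) * n) * tw (M * (β - n)) * I x) := by ring
        _ = tw (5 * (n - β)) * (D2 * L ^ m * v x) := by rw [e1, e2]
        _ ≤ _ := by apply le_of_eq; ring
    calc tw (-(M * β) + (M - j) * n) * Tf β m b h x ≤ _ := mul_le_mul' le_rfl hT
      _ ≤ tw n * D1 * u x + tw (5 * (n - β)) * D2 * L ^ m * v x := by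
          rw [mul_add]; exact add_le_add p1 p2
      _ ≤ E * L ^ m * u x + E * L ^ m * v x := by
          refine add_le_add (mul_le_mul' ?_ le_rfl) (mul_le_mul' (mul_le_mul' ?_ le_rfl) le_rfl)
          · calc tw n * D1 = tw n * D1 * 1 := by simp
              _ ≤ _ := mul_le_mul' le_self_add hLm1
          · exact le_add_self
      _ = _ := by ring
  calc ∫⁻ x in annulus n k, (tw (-(M * β) + (M - j) * n) * Tf β m b h x / (4 * E * L ^ m)) ^ q2 x
      ≤ ∫⁻ x in annulus n k, 2⁻¹ * (u x ^ q2 x + v x ^ q2 x) :=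
        setLIntegral_mono' (measurableSet_annulus n k) fun x hx => combine_two (P.hq2l x).le (hpt x hx)
    _ = 2⁻¹ * ((∫⁻ x in annulus n k, u x ^ q2 x) + ∫⁻ x in annulus n k, v x ^ q2 x) := by
        rw [lintegral_const_mul' _ _ (by simp), lintegral_add_left (hum.pow P.hq2m)]
    _ ≤ 2⁻¹ * (tw (k * n) + tw (k * n)) := mul_le_mul' le_rfl (add_le_add iu iv)
    _ = tw (k * n) := by
        rw [← two_mul, ← mul_assoc, ENNReal.inv_mul_cancel (by norm_num) (by norm_num), one_mul]

end HM

namespace HM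

/-- Luxemburg norm of an extended nonnegative function -/
noncomputable def vN {n : ℕ} (q : Eu n → ℝ) (F : Eu n → ℝ≥0∞) : ℝ≥0∞ :=
  sInf {η : ℝ≥0∞ | η ≠ 0 ∧ ∫⁻ x, (F x / η) ^ (q x) ≤ 1}

lemma vLpNorm_eq {n : ℕ} (q : Eu n → ℝ) (f : Eu n → ℝ) :
    vLpNorm q f = vN q (fun x => ‖f x‖ₑ) := rfl

lemma vN_le {n : ℕ} {q : Eu n → ℝ} {F : Eu n → ℝ≥0∞} {η : ℝ≥0∞} (h0 : η ≠ 0)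
    (h : ∫⁻ x, (F x / η) ^ (q x) ≤ 1) : vN q F ≤ η := sInf_le ⟨h0, h⟩

lemma modular_of_lt {n : ℕ} {q : Eu n → ℝ} (hq : ∀ x, 0 ≤ q x) {F : Eu n → ℝ≥0∞} {η : ℝ≥0∞}
    (h : vN q F < η) : ∫⁻ x, (F x / η) ^ (q x) ≤ 1 := by
  obtain ⟨θ, ⟨_, hθ⟩, hlt⟩ := sInf_lt_iff.1 h
  refine (lintegral_mono fun x => ?_).trans hθ
  exact ENNReal.rpow_le_rpow (ENNReal.div_le_div_left hlt.le _) (hq x)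

lemma vN_mono_ae {n : ℕ} {q : Eu n → ℝ} (hq : ∀ x, 0 ≤ q x) {F G : Eu n → ℝ≥0∞}
    (h : ∀ᵐ x, F x ≤ G x) : vN q F ≤ vN q G := by
  refine le_sInf fun η hη => vN_le hη.1 (le_trans (lintegral_mono_ae ?_) hη.2)
  filter_upwards [h] with x hx
  exact ENNReal.rpow_le_rpow (ENNReal.div_le_div_right hx _) (hq x)

lemma jensen_fin {ι : Type*} (s : Finset ι) {p : ℝ} (hp : 1 ≤ p) (w f : ι → ℝ≥0∞)
    (hw : ∑ i ∈ s, w i ≤ 1) : (∑ i ∈ s, w i * f i) ^ p ≤ ∑ i ∈ s, w i * f i ^ p := by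
  have hp0 : 0 < p := by linarith
  have h := ENNReal.inner_le_weight_mul_Lp_of_nonneg s hp w f
  have h2 : ∑ i ∈ s, w i * f i ≤ (∑ i ∈ s, w i * f i ^ p) ^ p⁻¹ := by
    refine h.trans ?_
    calc _ ≤ 1 * (∑ i ∈ s, w i * f i ^ p) ^ p⁻¹ := by
          refine mul_le_mul' ?_ le_rfl
          refine ENNReal.rpow_le_one hw ?_
          have := inv_le_one_of_one_le₀ hp; linarith
      _ = _ := one_mul _
  exact (ENNReal.le_rpow_inv_iff hp0).1 h2

lemma jensen_tsum {ι : Type*} {p : ℝ} (hp : 1 ≤ p) (w f : ι → ℝ≥0∞)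
    (hw : ∑' i, w i ≤ 1) : (∑' i, w i * f i) ^ p ≤ ∑' i, w i * f i ^ p := by
  have hp0 : 0 < p := by linarith
  rw [ENNReal.tsum_eq_iSup_sum]
  have := (ENNReal.orderIsoRpow p hp0).map_iSup (fun s : Finset ι => ∑ i ∈ s, w i * f i)
  simp only [ENNReal.orderIsoRpow_apply] at this
  rw [this]
  refine iSup_le fun s => ?_
  exact (jensen_fin s hp w f ((ENNReal.sum_le_tsum s).trans hw)).trans (ENNReal.sum_le_tsum s)

lemma vN_tsum_le {n : ℕ} {ι : Type*} [Countable ι] {q : Eu n → ℝ} (hq : ∀ x, 1 ≤ q x)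
    (hqm : Measurable q) {F : ι → Eu n → ℝ≥0∞} (hF : ∀ j, Measurable (F j)) :
    vN q (fun x => ∑' j, F j x) ≤ ∑' j, vN q (F j) := by
  refine ENNReal.le_of_forall_pos_le_add ?_
  intro ε hε htop
  obtain ⟨ε', hε', hsum⟩ := ENNReal.exists_pos_sum_of_countable (ε := (ε:ℝ≥0∞)) (by simpa using hε.ne') ι
  set a : ι → ℝ≥0∞ := fun j => vN q (F j) + ε' j with ha
  have hat : ∀ j, a j ≠ ⊤ := fun j => by
    have := ENNReal.ne_top_of_tsum_ne_top htop.ne j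
    simp [ha, this]
  have ha0 : ∀ j, a j ≠ 0 := fun j => by
    have := (hε' j).ne'
    simp [ha, this]
  have hS : ∑' j, a j ≤ ∑' j, vN q (F j) + ε := by
    rw [ha, ENNReal.tsum_add]; exact add_le_add le_rfl hsum.le
  set S := ∑' j, vN q (F j) + (ε:ℝ≥0∞) with hSdef
  have hS0 : S ≠ 0 := by simp [hSdef, hε.ne']
  have hSt : S ≠ ⊤ := by simp [hSdef, htop.ne]
  refine vN_le hS0 ?_
  have hmod : ∀ j, ∫⁻ x, (F j x / a j) ^ q x ≤ 1 := by
    intro j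
    refine modular_of_lt (fun x => by linarith [hq x]) ?_
    refine ENNReal.lt_add_right (ENNReal.ne_top_of_tsum_ne_top htop.ne j) ?_
    simpa using (hε' j).ne'
  have hw : ∑' j, a j / S ≤ 1 := by
    simp_rw [div_eq_mul_inv]
    rw [ENNReal.tsum_mul_right, ← div_eq_mul_inv]
    exact ENNReal.div_le_of_le_mul (by rw [one_mul]; exact hS)
  calc ∫⁻ x, ((∑' j, F j x) / S) ^ q x ≤ ∫⁻ x, ∑' j, (a j / S) * (F j x / a j) ^ q x := by
        refine lintegral_mono fun x => ?_
        refine le_trans (le_of_eq ?_) (jensen_tsum (hq x) (fun j => a j / S) (fun j => F j x / a j) hw)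
        congr 1
        rw [div_eq_mul_inv, ← ENNReal.tsum_mul_right]
        refine tsum_congr fun j => ?_
        calc F j x * S⁻¹ = (a j * (F j x / a j)) * S⁻¹ := by
              rw [ENNReal.mul_div_cancel (ha0 j) (hat j)]
          _ = _ := by rw [div_eq_mul_inv (a j) S]; ring
    _ = ∑' j, (a j / S) * ∫⁻ x, (F j x / a j) ^ q x := by
        rw [lintegral_tsum]
        · refine tsum_congr fun j => ?_
          rw [lintegral_const_mul' _ _ (ENNReal.div_ne_top (hat j) hS0)]
        · intro j
          exact ((((hF j).div_const _).pow hqm).const_mul _).aemeasurable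
    _ ≤ ∑' j, (a j / S) * 1 := ENNReal.tsum_le_tsum fun j => mul_le_mul' le_rfl (hmod j)
    _ ≤ 1 := by simpa using hw

lemma Tf_const_mul {n : ℕ} (β : ℝ) (m : ℕ) (b : Eu n → ℝ) {c : ℝ≥0∞} (hc : c ≠ ⊤)
    (h : Eu n → ℝ≥0∞) (x : Eu n) : Tf β m b (fun y => c * h y) x = c * Tf β m b h x := by
  unfold Tf
  rw [← lintegral_const_mul' _ _ hc]
  refine lintegral_congr fun y => ?_
  ring

/-- decay exponent -/
noncomputable def ex (n : ℕ) (δ₁ δ₂ : ℝ) (j k : ℤ) : ℝ :=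
  if j ≤ k then ((j:ℝ) - k) * (n * δ₁) else ((k:ℝ) - j) * (n * δ₂)

set_option maxHeartbeats 1000000 in
lemma annulus_bound {n : ℕ} {q1 q2 : Eu n → ℝ} {β s Q C : ℝ} {N : ℕ}
    (P : Par n q1 q2 β s Q C N) {CB δ₁ δ₂ : ℝ} (hCB : 0 ≤ CB)
    (hB : RegB (fun x => 1 / q1 x) CB) (hd1 : ∀ x, δ₁ ≤ 1 - 1 / q1 x) (hd2 : ∀ x, δ₂ ≤ 1 / q2 x)
    (m : ℕ) : ∃ D : ℝ≥0∞, D ≠ ⊤ ∧ D ≠ 0 ∧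
      ∀ b : Eu n → ℝ, BMO1 b → Measurable b → ∀ (j k : ℤ),
      ∀ h : Eu n → ℝ≥0∞, Measurable h → (∀ y, h y ≠ 0 → y ∈ annulus n j) →
      vN q2 ((annulus n k).indicator (Tf β m b h)) ≤
        D * (1 + ((j - k).natAbs : ℝ≥0∞)) ^ m * tw (ex n δ₁ δ₂ j k) * vN q1 h := by
  obtain ⟨D, hDt, hD0, H⟩ := normalized P m
  refine ⟨D * tw (3 * (n * CB)), ENNReal.mul_ne_top hDt (tw_ne_top _), mul_ne_zero hD0 (tw_ne_zero _), ?_⟩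
  intro b hb hbm j k h hh hs
  set L : ℝ≥0∞ := (1 + ((j - k).natAbs : ℝ≥0∞)) ^ m with hL
  have hL0 : L ≠ 0 := pow_ne_zero _ (by simp)
  have hLt : L ≠ ⊤ := ENNReal.pow_ne_top (by finiteness)
  have hn0 : (0:ℝ) < n := by exact_mod_cast P.hn
  have hq1pos : ∀ x, 0 < q1 x := fun x => by have := P.hq1l x; nlinarith [P.hs]
  have hq2pos : ∀ x, 0 < q2 x := fun x => by linarith [P.hq2l x]
  obtain ⟨xj, hxj⟩ := exists_norm_eq P.hn j
  obtain ⟨xk, hxk⟩ := exists_norm_eq P.hn k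
  have hB1 : RegB (fun x => 1 - 1 / q1 x) CB := by
    have := regB_trans (p := fun x => 1 - 1 / q1 x) hB zero_le_one (fun x y => by
      rw [one_mul, ← abs_neg]; apply le_of_eq; congr 1; ring)
    rwa [one_mul] at this
  have h2e : ∀ x, 1 / q2 x = 1 / q1 x - β / n := fun x => by have := P.hqq x; linarith
  have hB2 : RegB (fun x => 1 / q2 x) CB := by
    have := regB_trans (p := fun x => 1 / q2 x) hB zero_le_one (fun x y => by
      rw [one_mul]; apply le_of_eq; rw [h2e x, h2e y]; congr 1; ring)
    rwa [one_mul] at this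
  set M : ℝ := ((max j k : ℤ):ℝ) with hM
  -- the exponent inequality
  have hexp : M * β - (M - j) * n - j * n * (1 / q1 xj) + k * n * (1 / q2 xk) ≤
      ex n δ₁ δ₂ j k + n * CB := by
    unfold ex
    split_ifs with hjk
    · have hMk : M = k := by rw [hM, max_eq_right hjk]
      have := regB_compare hCB hB1 hd1 j k hjk xj xk hxj hxk
      have h3 := mul_le_mul_of_nonneg_left this hn0.le
      rw [hMk, h2e xk]
      have e : (k:ℝ) * n * (1 / q1 xk - β / n) = k * n * (1 / q1 xk) - k * β := by
        field_simp
      rw [e]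
      nlinarith
    · have hMk : M = j := by rw [hM, max_eq_left (by omega)]
      have := regB_compare hCB hB2 hd2 k j (by omega) xk xj hxk hxj
      have h3 := mul_le_mul_of_nonneg_left this hn0.le
      rw [hMk]
      have e : (j:ℝ) * n * (1 / q1 xj) = j * n * (1 / q2 xj) + j * β := by
        rw [h2e xj]; field_simp; ring
      rw [e]
      nlinarith
  set R : ℝ≥0∞ := D * tw (3 * (n * CB)) * L * tw (ex n δ₁ δ₂ j k) with hR
  have hR0 : R ≠ 0 := mul_ne_zero (mul_ne_zero (mul_ne_zero hD0 (tw_ne_zero _)) hL0) (tw_ne_zero _)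
  have hRt : R ≠ ⊤ := ENNReal.mul_ne_top (ENNReal.mul_ne_top (ENNReal.mul_ne_top hDt (tw_ne_top _)) hLt) (tw_ne_top _)
  rw [mul_comm R, ← ENNReal.div_le_iff hR0 hRt]
  refine le_of_forall_gt_imp_ge_of_dense fun η hη => ?_
  rw [ENNReal.div_le_iff hR0 hRt]
  by_cases hηt : η = ⊤
  · rw [hηt, ENNReal.top_mul hR0]; exact le_top
  have hη0 : η ≠ 0 := (lt_of_le_of_lt zero_le hη).ne'
  have hmod := modular_of_lt (fun x => (hq1pos x).le) hη
  -- normalised function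
  set c : ℝ≥0∞ := η⁻¹ * tw (j * n * (1 / q1 xj) - n * CB) with hc
  have hct : c ≠ ⊤ := ENNReal.mul_ne_top (ENNReal.inv_ne_top.2 hη0) (tw_ne_top _)
  have hi : ∫⁻ y, (c * h y) ^ q1 y ≤ tw (j * n) := by
    calc ∫⁻ y, (c * h y) ^ q1 y ≤ ∫⁻ y, tw (j * n) * (h y / η) ^ q1 y := by
          refine lintegral_mono fun y => ?_
          by_cases hy : h y = 0
          · simp [hy, ENNReal.zero_rpow_of_pos (hq1pos y)]
          have hyA := hs y hy
          have hy1 : ‖y‖ ≤ (2:ℝ) ^ j := by simpa using hyA.1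
          have hy2 : (2:ℝ) ^ (j - 1) < ‖y‖ := by simpa using hyA.2
          have hr := regB_annulus hB j xj y (by
            rw [hxj]; exact zpow_le_zpow_right₀ (by norm_num) (by omega)) hxj.le hy2.le hy1
          have hr2 := (abs_le.1 hr).2
          simp only
          have e : c * h y = tw (j * n * (1 / q1 xj) - n * CB) * (h y / η) := by
            rw [hc, ENNReal.div_eq_inv_mul]; ring
          rw [e, ENNReal.mul_rpow_of_nonneg _ _ (hq1pos y).le, tw_rpow]
          refine mul_le_mul' (tw_mono ?_) le_rfl
          have h5 : (j:ℝ) * n * (1 / q1 xj) - n * CB ≤ j * n * (1 / q1 y) := by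
            have := mul_le_mul_of_nonneg_left hr2 hn0.le
            nlinarith
          calc _ ≤ (j:ℝ) * n * (1 / q1 y) * q1 y := mul_le_mul_of_nonneg_right h5 (hq1pos y).le
            _ = j * n := by have := (hq1pos y).ne'; field_simp
      _ = tw (j * n) * ∫⁻ y, (h y / η) ^ q1 y := lintegral_const_mul' _ _ (tw_ne_top _)
      _ ≤ tw (j * n) * 1 := mul_le_mul' le_rfl hmod
      _ = _ := mul_one _
  have H1 := H b hb hbm j k (fun y => c * h y) (hh.const_mul c)
    (fun y hy => hs y (fun h0 => hy (by simp [h0]))) hi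
  rw [← hL, ← hM] at H1
  refine vN_le (mul_ne_zero hη0 hR0) ?_
  have hA := measurableSet_annulus n k
  calc ∫⁻ x, ((annulus n k).indicator (Tf β m b h) x / (η * R)) ^ q2 x
      = ∫⁻ x in annulus n k, (Tf β m b h x / (η * R)) ^ q2 x := by
        rw [← lintegral_indicator hA]
        refine lintegral_congr fun x => ?_
        by_cases hx : x ∈ annulus n k
        · simp [hx]
        · simp [hx, ENNReal.zero_rpow_of_pos (hq2pos x)]
    _ ≤ ∫⁻ x in annulus n k, tw (-(k * n)) * (tw (-(M * β) + (M - j) * n) *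
          Tf β m b (fun y => c * h y) x / (D * L)) ^ q2 x := by
        refine setLIntegral_mono' hA fun x hx => ?_
        have hx1 : ‖x‖ ≤ (2:ℝ) ^ k := by simpa using hx.1
        have hx2 : (2:ℝ) ^ (k - 1) < ‖x‖ := by simpa using hx.2
        have hr := regB_annulus hB2 k xk x (by
            rw [hxk]; exact zpow_le_zpow_right₀ (by norm_num) (by omega)) hxk.le hx2.le hx1
        have hr2 := (abs_le.1 hr).1
        rw [Tf_const_mul β m b hct]
        have e1 : tw (-(k * n)) = tw (-(k * n * (1 / q2 x))) ^ q2 x := by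
          rw [tw_rpow]; congr 1; have := (hq2pos x).ne'; field_simp
        rw [e1, ← ENNReal.mul_rpow_of_nonneg _ _ (hq2pos x).le]
        refine ENNReal.rpow_le_rpow ?_ (hq2pos x).le
        set X := Tf β m b h x
        have e2 : X / (η * R) = tw (-(3 * (n * CB) + ex n δ₁ δ₂ j k)) * (X * η⁻¹ * (D * L)⁻¹) := by
          rw [← tw_inv, tw_add, div_eq_mul_inv]
          have : η * R = η * (D * L) * (tw (3 * (n * CB)) * tw (ex n δ₁ δ₂ j k)) := by rw [hR]; ring
          rw [this, ENNReal.mul_inv (Or.inl (mul_ne_zero hη0 (mul_ne_zero hD0 hL0)))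
            (Or.inl (ENNReal.mul_ne_top hηt (ENNReal.mul_ne_top hDt hLt))),
            ENNReal.mul_inv (Or.inl hη0) (Or.inl hηt)]
          ring
        have e3 : tw (-(k * n * (1 / q2 x))) * (tw (-(M * β) + (M - j) * n) * (c * X) / (D * L)) =
            tw (-(k * n * (1 / q2 x)) + (-(M * β) + (M - j) * n) + (j * n * (1 / q1 xj) - n * CB)) *
              (X * η⁻¹ * (D * L)⁻¹) := by
          rw [tw_add (-(k * n * (1 / q2 x)) + (-(M * β) + (M - j) * n)), tw_add (-(k * n * (1 / q2 x))), hc,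
            ENNReal.div_eq_inv_mul]; ring
        rw [e2, e3]
        refine mul_le_mul' (tw_mono ?_) le_rfl
        have h6 := mul_le_mul_of_nonneg_left hr2 hn0.le
        nlinarith
    _ = tw (-(k * n)) * ∫⁻ x in annulus n k, (tw (-(M * β) + (M - j) * n) *
          Tf β m b (fun y => c * h y) x / (D * L)) ^ q2 x := lintegral_const_mul' _ _ (tw_ne_top _)
    _ ≤ tw (-(k * n)) * tw (k * n) := mul_le_mul' le_rfl H1
    _ = 1 := by rw [mul_comm, tw_mul_tw_neg]

end HM

namespace HM

lemma mem_annulus_iff {n : ℕ} {k : ℤ} {x : Eu n} :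
    x ∈ annulus n k ↔ (2:ℝ) ^ (k - 1) < ‖x‖ ∧ ‖x‖ ≤ (2:ℝ) ^ k := by
  constructor
  · intro hx; exact ⟨by simpa using hx.2, by simpa using hx.1⟩
  · intro hx; exact ⟨by simpa using hx.2, by simpa using hx.1⟩

lemma annulus_unique {n : ℕ} {j k : ℤ} {x : Eu n} (hj : x ∈ annulus n j) (hk : x ∈ annulus n k) :
    j = k := by
  rw [mem_annulus_iff] at hj hk
  have h1 : j - 1 < k := (zpow_lt_zpow_iff_right₀ (by norm_num : (1:ℝ) < 2)).1 (hj.1.trans_le hk.2)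
  have h2 : k - 1 < j := (zpow_lt_zpow_iff_right₀ (by norm_num : (1:ℝ) < 2)).1 (hk.1.trans_le hj.2)
  omega

lemma exists_annulus {n : ℕ} {x : Eu n} (hx : x ≠ 0) : ∃ j, x ∈ annulus n j := by
  obtain ⟨i, hi⟩ := exists_mem_Ioc_zpow (norm_pos_iff.2 hx) (by norm_num : (1:ℝ) < 2)
  refine ⟨i + 1, mem_annulus_iff.2 ⟨?_, hi.2⟩⟩
  rw [add_sub_cancel_right]; exact hi.1

lemma tsum_annulus {n : ℕ} (h : Eu n → ℝ≥0∞) {x : Eu n} (hx : x ≠ 0) :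
    ∑' j : ℤ, (annulus n j).indicator h x = h x := by
  obtain ⟨j, hj⟩ := exists_annulus hx
  rw [tsum_eq_single j, Set.indicator_of_mem hj]
  intro k hk
  rw [Set.indicator_of_notMem]
  intro hc; exact hk (annulus_unique hc hj)

lemma Tf_tsum {n : ℕ} (hn : 0 < n) (β : ℝ) (m : ℕ) {b : Eu n → ℝ} (hbm : Measurable b)
    {h : Eu n → ℝ≥0∞} (hh : Measurable h) (x : Eu n) :
    Tf β m b h x = ∑' j : ℤ, Tf β m b ((annulus n j).indicator h) x := by
  unfold Tf
  rw [← lintegral_tsum]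
  · refine lintegral_congr_ae ?_
    haveI : Nonempty (Fin n) := ⟨⟨0, hn⟩⟩
    haveI : Nontrivial (Eu n) := inferInstance
    have hae : ∀ᵐ y : Eu n, y ≠ 0 := by
      have : volume ({0} : Set (Eu n)) = 0 := measure_singleton 0
      exact measure_eq_zero_iff_ae_notMem.1 this
    filter_upwards [hae] with y hy
    rw [ENNReal.tsum_mul_right, ENNReal.tsum_mul_right, tsum_annulus h hy]
  · intro j
    have hwm : Measurable (fun y => ‖b x - b y‖ₑ ^ m) :=
      (measurable_w hbm m).comp measurable_prodMk_left
    have hk : Measurable (fun y => ker β (x, y)) := (measurable_ker β).comp measurable_prodMk_left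
    exact (((hh.indicator (measurableSet_annulus n j)).mul hwm).mul hk).aemeasurable

set_option maxHeartbeats 1000000 in
lemma main_pos {n : ℕ} {q1 q2 : Eu n → ℝ} {β s Q C : ℝ} {N : ℕ}
    (P : Par n q1 q2 β s Q C N) {CB δ₁ δ₂ α lam : ℝ} (hCB : 0 ≤ CB)
    (hB : RegB (fun x => 1 / q1 x) CB) (hd1 : ∀ x, δ₁ ≤ 1 - 1 / q1 x) (hd2 : ∀ x, δ₂ ≤ 1 / q2 x)
    (hα₁ : lam - n * δ₂ < α) (hα₂ : α < lam + n * δ₁)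
    (m : ℕ) : ∃ D : ℝ≥0∞, D ≠ ⊤ ∧
      ∀ b : Eu n → ℝ, BMO1 b → Measurable b →
      ∀ h : Eu n → ℝ≥0∞, Measurable h → ∀ A : ℝ≥0∞,
      (∀ j : ℤ, tw (j * α) * vN q1 ((annulus n j).indicator h) ≤ A * tw (j * lam)) →
      ∀ k : ℤ, tw (k * α) * vN q2 ((annulus n k).indicator (Tf β m b h)) ≤ D * A * tw (k * lam) := by
  obtain ⟨D, hDt, hD0, H⟩ := annulus_bound P hCB hB hd1 hd2 m
  set ε : ℝ := min (lam + n * δ₁ - α) (α + n * δ₂ - lam) with hε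
  have hε0 : 0 < ε := lt_min (by linarith) (by linarith)
  set Sg : ℝ≥0∞ := ∑' l : ℤ, (1 + (l.natAbs : ℝ≥0∞)) ^ m * tw (-(l.natAbs * ε)) with hSg
  have hSgt : Sg ≠ ⊤ := decay_sum_ne_top m hε0
  refine ⟨D * Sg, ENNReal.mul_ne_top hDt hSgt, ?_⟩
  intro b hb hbm h hh A hA k
  have hq2 : ∀ x, 1 ≤ q2 x := fun x => (P.hq2l x).le
  have e1 : (annulus n k).indicator (Tf β m b h) =
      fun x => ∑' j : ℤ, (annulus n k).indicator (Tf β m b ((annulus n j).indicator h)) x := by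
    funext x
    by_cases hx : x ∈ annulus n k
    · simp only [Set.indicator_of_mem hx]; exact Tf_tsum P.hn β m hbm hh x
    · simp only [Set.indicator_of_notMem hx]; simp
  have hhj : ∀ j : ℤ, Measurable ((annulus n j).indicator h) := fun j =>
    hh.indicator (measurableSet_annulus n j)
  have hterm : ∀ j : ℤ, tw (k * α) * vN q2 ((annulus n k).indicator (Tf β m b ((annulus n j).indicator h)))
      ≤ D * A * tw (k * lam) * ((1 + ((j - k).natAbs : ℝ≥0∞)) ^ m * tw (-((j - k).natAbs * ε))) := by
    intro j
    have hb1 := H b hb hbm j k _ (hhj j) (fun y hy => by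
      by_contra hc; exact hy (Set.indicator_of_notMem hc _))
    have hv : vN q1 ((annulus n j).indicator h) ≤ tw (-(j * α)) * (A * tw (j * lam)) := by
      calc vN q1 ((annulus n j).indicator h)
          = tw (-(j * α)) * (tw (j * α) * vN q1 ((annulus n j).indicator h)) := by
            rw [← mul_assoc, mul_comm (tw (-(j * α))), tw_mul_tw_neg, one_mul]
        _ ≤ _ := mul_le_mul' le_rfl (hA j)
    set L : ℝ≥0∞ := (1 + ((j - k).natAbs : ℝ≥0∞)) ^ m
    calc _ ≤ tw (k * α) * (D * L * tw (ex n δ₁ δ₂ j k) * (tw (-(j * α)) * (A * tw (j * lam)))) :=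
          mul_le_mul' le_rfl (hb1.trans (mul_le_mul' le_rfl hv))
      _ = D * A * L * (tw (k * α) * tw (ex n δ₁ δ₂ j k) * tw (-(j * α)) * tw (j * lam)) := by ring
      _ = D * A * L * tw (k * α + ex n δ₁ δ₂ j k + -(j * α) + j * lam) := by
          rw [tw_add (k * α + ex n δ₁ δ₂ j k + -(j * α)), tw_add (k * α + ex n δ₁ δ₂ j k), tw_add (k * α)]
      _ ≤ D * A * L * tw (k * lam + -((j - k).natAbs * ε)) := by
          refine mul_le_mul' le_rfl (tw_mono ?_)
          unfold ex
          have hcast : (((j - k).natAbs : ℕ) : ℝ) = |(j:ℝ) - k| := by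
            rw [Nat.cast_natAbs]; push_cast; rfl
          rw [hcast]
          split_ifs with hjk
          · have : (j:ℝ) ≤ k := by exact_mod_cast hjk
            rw [abs_of_nonpos (by linarith)]
            have h1 : ε ≤ lam + n * δ₁ - α := min_le_left _ _
            nlinarith
          · have : (k:ℝ) ≤ j := by exact_mod_cast (by omega : k ≤ j)
            rw [abs_of_nonneg (by linarith)]
            have h1 : ε ≤ α + n * δ₂ - lam := min_le_right _ _
            nlinarith
      _ = _ := by rw [tw_add]; ring
  calc tw (k * α) * vN q2 ((annulus n k).indicator (Tf β m b h))
      ≤ tw (k * α) * ∑' j : ℤ, vN q2 ((annulus n k).indicator (Tf β m b ((annulus n j).indicator h))) := by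
        rw [e1]
        exact mul_le_mul' le_rfl (vN_tsum_le hq2 P.hq2m fun j =>
          (measurable_Tf β m hbm (hhj j)).indicator (measurableSet_annulus n k))
    _ = ∑' j : ℤ, tw (k * α) * vN q2 ((annulus n k).indicator (Tf β m b ((annulus n j).indicator h))) :=
        ENNReal.tsum_mul_left.symm
    _ ≤ ∑' j : ℤ, D * A * tw (k * lam) *
          ((1 + ((j - k).natAbs : ℝ≥0∞)) ^ m * tw (-((j - k).natAbs * ε))) := ENNReal.tsum_le_tsum hterm
    _ = D * A * tw (k * lam) * Sg := by
        rw [ENNReal.tsum_mul_left, hSg]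
        congr 1
        exact (Equiv.subRight k).tsum_eq (fun l : ℤ => (1 + (l.natAbs : ℝ≥0∞)) ^ m * tw (-(l.natAbs * ε)))
    _ = _ := by ring

/-- single-term bound from the Herz–Morrey norm -/
lemma single_term {n : ℕ} {q : Eu n → ℝ} {α lam p : ℝ} (hp : 0 < p) (f : Eu n → ℝ) (j : ℤ) :
    tw (j * α) * vLpNorm q ((annulus n j).indicator f) ≤ herzMorreyNorm q α lam p f * tw (j * lam) := by
  have h1 : tw (-(j:ℝ) * lam) * (tw (j * α) * vLpNorm q ((annulus n j).indicator f)) ≤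
      herzMorreyNorm q α lam p f := by
    unfold herzMorreyNorm
    refine le_trans ?_ (le_iSup _ j)
    rw [ofReal_two_rpow]
    refine mul_le_mul' le_rfl ?_
    have h2 := ENNReal.le_tsum (f := fun k : {k : ℤ // k ≤ j} =>
      (ENNReal.ofReal ((2:ℝ) ^ (((k:ℤ):ℝ) * α)) *
        vLpNorm q ((annulus n (k:ℤ)).indicator f)) ^ p) ⟨j, le_rfl⟩
    simp only [ofReal_two_rpow] at h2 ⊢
    rw [one_div, ENNReal.le_rpow_inv_iff hp]
    exact h2
  calc _ = tw (j * lam) * tw (-(j * lam)) * (tw (j * α) * vLpNorm q ((annulus n j).indicator f)) := by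
        rw [tw_mul_tw_neg, one_mul]
    _ = (tw (-(j:ℝ) * lam) * (tw (j * α) * vLpNorm q ((annulus n j).indicator f))) * tw (j * lam) := by
        rw [neg_mul]; ring
    _ ≤ _ := mul_le_mul' h1 le_rfl

/-- assembling the Herz–Morrey norm from uniform bounds -/
lemma herz_of_terms {n : ℕ} {q : Eu n → ℝ} {α lam p : ℝ} (hp : 0 < p) (f : Eu n → ℝ) (B : ℝ≥0∞)
    (h : ∀ k : ℤ, tw (k * α) * vLpNorm q ((annulus n k).indicator f) ≤ B * tw (k * lam)) :
    herzMorreyNorm q α lam p f ≤ (Cg (lam * p)) ^ (1 / p) * B := by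
  unfold herzMorreyNorm
  refine iSup_le fun k₀ => ?_
  have h1 : ∑' k : {k : ℤ // k ≤ k₀}, (ENNReal.ofReal ((2:ℝ) ^ (((k:ℤ):ℝ) * α)) *
        vLpNorm q ((annulus n (k:ℤ)).indicator f)) ^ p ≤ B ^ p * (Cg (lam * p) * tw (k₀ * (lam * p))) := by
    calc _ ≤ ∑' k : {k : ℤ // k ≤ k₀}, B ^ p * tw ((k:ℤ) * (lam * p)) := by
          refine ENNReal.tsum_le_tsum fun k => ?_
          rw [ofReal_two_rpow]
          refine (ENNReal.rpow_le_rpow (h k) hp.le).trans (le_of_eq ?_)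
          rw [ENNReal.mul_rpow_of_nonneg _ _ hp.le, tw_rpow]; congr 2; ring
      _ = B ^ p * ∑' k : {k : ℤ // k ≤ k₀}, tw ((k:ℤ) * (lam * p)) := ENNReal.tsum_mul_left
      _ = B ^ p * ∑' k : ℤ, (if k ≤ k₀ then tw (k * (lam * p)) else 0) := by
          congr 1
          have := tsum_subtype {k : ℤ | k ≤ k₀} (fun k : ℤ => tw (k * (lam * p)))
          refine this.trans (tsum_congr fun k => ?_)
          simp [Set.indicator]
      _ = _ := by rw [tsum_geom_le_int]
  have h2 := ENNReal.rpow_le_rpow h1 (show 0 ≤ 1 / p by positivity)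
  rw [ofReal_two_rpow]
  calc _ ≤ tw (-(k₀:ℝ) * lam) * (B ^ p * (Cg (lam * p) * tw (k₀ * (lam * p)))) ^ (1 / p) :=
        mul_le_mul' le_rfl h2
    _ = tw (-(k₀:ℝ) * lam) * (B * (Cg (lam * p) ^ (1 / p) * tw (k₀ * lam))) := by
        rw [ENNReal.mul_rpow_of_nonneg _ _ (by positivity), ENNReal.mul_rpow_of_nonneg _ _ (by positivity),
          ← ENNReal.rpow_mul, mul_one_div_cancel hp.ne', ENNReal.rpow_one, tw_rpow]
        congr 4; field_simp
    _ = (tw (k₀ * lam) * tw (-(k₀ * lam))) * (Cg (lam * p) ^ (1 / p) * B) := by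
        rw [neg_mul]; ring
    _ ≤ _ := by rw [tw_mul_tw_neg, one_mul]

end HM

namespace HM

/-- largest measurable minorant -/
lemma exists_lower_envelope {n : ℕ} (F : Eu n → ℝ≥0∞) :
    ∃ g : Eu n → ℝ≥0∞, Measurable g ∧ (∀ x, g x ≤ F x) ∧
      ∀ h : Eu n → ℝ≥0∞, AEMeasurable h → (∀ᵐ x, h x ≤ F x) → ∀ᵐ x, h x ≤ g x := by
  let μ : Measure (Eu n) := (volume : Measure (Eu n)).toFinite
  have hμ1 : μ ≪ volume := toFinite_absolutelyContinuous _
  have hμ2 : (volume : Measure (Eu n)) ≪ μ := absolutelyContinuous_toFinite _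
  obtain ⟨g', hg'm, hg'le, hg'e⟩ := exists_measurable_le_lintegral_eq μ (fun x => (1 + (F x)⁻¹)⁻¹)
  refine ⟨fun x => ((g' x)⁻¹ - 1)⁻¹, (hg'm.inv.sub measurable_const).inv, fun x => ?_, ?_⟩
  · have h1 := ENNReal.inv_le_inv.2 (hg'le x)
    simp only [inv_inv] at h1
    rw [← inv_inv (F x), ENNReal.inv_le_inv]
    exact ENNReal.le_sub_of_add_le_left (by simp) h1
  · intro h hh hhF
    have hle : ∀ᵐ x ∂μ, max (hh.mk h x + 0) (((fun x => x) (0:ℝ≥0∞))) ≤ F x := by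
      have e1 := hμ1.ae_le hhF
      have e2 := hμ1.ae_le hh.ae_eq_mk
      filter_upwards [e1, e2] with x h1 h2
      simpa [← h2] using h1
    let h' : Eu n → ℝ≥0∞ := fun x => (1 + (hh.mk h x)⁻¹)⁻¹
    have hh'm : Measurable h' := (measurable_const.add hh.measurable_mk.inv).inv
    have hfin : ∫⁻ x, g' x ∂μ ≠ ⊤ := by
      refine ne_top_of_le_ne_top (b := ∫⁻ _, 1 ∂μ) (by simp) (lintegral_mono fun x => ?_)
      refine (hg'le x).trans ?_
      rw [ENNReal.inv_le_one]; exact le_self_add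
    have hmax : ∫⁻ x, max (g' x) (h' x) ∂μ ≤ ∫⁻ x, g' x ∂μ := by
      rw [← hg'e]
      refine lintegral_mono_ae ?_
      filter_upwards [hle] with x hx
      refine max_le (hg'le x) ?_
      have hx : hh.mk h x ≤ F x := by simpa using hx
      exact ENNReal.inv_le_inv.2 (add_le_add le_rfl (ENNReal.inv_le_inv.2 hx))
    have hae : g' =ᵐ[μ] fun x => max (g' x) (h' x) :=
      ae_eq_of_ae_le_of_lintegral_le (Filter.Eventually.of_forall fun x => le_max_left _ _) hfin
        (hg'm.max hh'm).aemeasurable hmax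
    filter_upwards [hμ2.ae_le hae, hh.ae_eq_mk] with x h1 h2
    have h3 : h' x ≤ g' x := by rw [h1]; exact le_max_right _ _
    have h4 := ENNReal.inv_le_inv.2 h3
    simp only [h', inv_inv] at h4
    rw [h2, ← inv_inv (hh.mk h x), ENNReal.inv_le_inv]
    exact tsub_le_iff_left.2 h4

lemma exists_dom {n : ℕ} {β : ℝ} (m : ℕ) (f : Eu n → ℝ) :
    ∃ g : Eu n → ℝ≥0∞, Measurable g ∧ (∀ x, g x ≤ ‖f x‖ₑ) ∧
      ∀ b : Eu n → ℝ, Measurable b → ∀ x, ‖commFracInt β m b f x‖ₑ ≤ Tf β m b g x := by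
  obtain ⟨g, hgm, hgl, hgu⟩ := exists_lower_envelope (fun x => ‖f x‖ₑ)
  refine ⟨g, hgm, hgl, fun b hb x => ?_⟩
  unfold commFracInt
  by_cases hi : Integrable (fun y => f y * (b x - b y) ^ m * ‖x - y‖ ^ (β - (n:ℝ)))
  swap
  · rw [integral_undef hi]; simp
  refine (enorm_integral_le_lintegral_enorm _).trans ?_
  set w : Eu n → ℝ≥0∞ := fun y => ‖b x - b y‖ₑ ^ m * ker β (x, y) with hw
  have hwm : Measurable w := by
    refine Measurable.mul ?_ ((measurable_ker β).comp (measurable_const.prodMk measurable_id))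
    exact (measurable_const.sub hb).enorm.pow_const _
  have hwt : ∀ y, w y ≠ ⊤ := fun y => by simp only [hw, ker]; finiteness
  have e1 : ∀ y, ‖f y * (b x - b y) ^ m * ‖x - y‖ ^ (β - (n:ℝ))‖ₑ = ‖f y‖ₑ * w y := by
    intro y
    rw [enorm_mul, enorm_mul, enorm_pow, mul_assoc]
    congr 2
    rw [Real.enorm_eq_ofReal (by positivity)]; rfl
  have hA : AEMeasurable (fun y => ‖f y‖ₑ * w y) := by
    have := hi.1.enorm
    simpa only [e1] using this
  have hD : AEMeasurable (fun y => ‖f y‖ₑ * w y / w y) := hA.div hwm.aemeasurable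
  have hle := hgu _ hD (Filter.Eventually.of_forall fun y => by
    exact ENNReal.div_le_of_le_mul le_rfl)
  unfold Tf
  refine lintegral_mono_ae ?_
  filter_upwards [hle] with y hy
  rw [e1, mul_assoc]
  change _ ≤ g y * w y
  by_cases h0 : w y = 0
  · simp [h0]
  · refine mul_le_mul' ?_ le_rfl
    rwa [ENNReal.mul_div_cancel_right h0 (hwt y)] at hy

lemma vN_const_mul_le {n : ℕ} (q : Eu n → ℝ) (F : Eu n → ℝ≥0∞) {c : ℝ≥0∞} (h0 : c ≠ 0) (ht : c ≠ ⊤) :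
    vN q (fun x => c * F x) ≤ c * vN q F := by
  rw [mul_comm, ← ENNReal.div_le_iff_le_mul (Or.inl h0) (Or.inl ht)]
  refine le_sInf fun η hη => ?_
  rw [ENNReal.div_le_iff_le_mul (Or.inl h0) (Or.inl ht)]
  refine vN_le (mul_ne_zero hη.1 h0) (le_trans (le_of_eq ?_) hη.2)
  refine lintegral_congr fun x => ?_
  rw [mul_comm c, ENNReal.mul_div_mul_right _ _ h0 ht]

end HM

namespace HM

lemma exists_par {n : ℕ} (hn : 0 < n) {q₁ q₂ : Eu n → ℝ}
    (hq₁meas : Measurable q₁) (hlh : LogHolder q₁)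
    {Qm Qp Q₂p β : ℝ} (hQm : 1 < Qm) (hbounds : ∀ x, Qm ≤ q₁ x ∧ q₁ x ≤ Qp)
    (hQ₂p : ∀ x, q₂ x ≤ Q₂p) (hβ : 0 < β) (hβ' : β < n / Qp)
    (hq₂ : ∀ x, 1 / q₁ x - 1 / q₂ x = β / n) :
    ∃ s Q C N, Par n q₁ q₂ β s Q C N := by
  have hn' : (0:ℝ) < n := by exact_mod_cast hn
  have hQmp : Qm ≤ Qp := (hbounds 0).1.trans (hbounds 0).2
  have hQp0 : 0 < Qp := by linarith
  have hβn1 : β / n < 1 / Qp := by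
    rw [lt_div_iff₀ hQp0] at hβ' ⊢
    rw [div_mul_eq_mul_div, div_lt_one hn']; exact hβ'
  have hβn : β < n := by
    refine hβ'.trans_le (div_le_self hn'.le (by linarith))
  have hβn0 : 0 < β / n := by positivity
  have h1pos : ∀ x, 0 < q₁ x := fun x => by have := (hbounds x).1; linarith
  have hinv : ∀ x, 1 / q₂ x = 1 / q₁ x - β / n := fun x => by have := hq₂ x; linarith
  have hinvpos : ∀ x, 0 < 1 / q₂ x := fun x => by
    rw [hinv]
    have : 1 / Qp ≤ 1 / q₁ x := one_div_le_one_div_of_le (h1pos x) (hbounds x).2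
    linarith
  have h2pos : ∀ x, 0 < q₂ x := fun x => one_div_pos.1 (hinvpos x)
  have h2l : ∀ x, Qm ≤ q₂ x := fun x => by
    refine (hbounds x).1.trans ?_
    refine (one_div_le_one_div (h2pos x) (h1pos x)).1 ?_
    rw [hinv]; linarith
  have h2one : ∀ x, 1 < q₂ x := fun x => hQm.trans_le (h2l x)
  have hQ2 : 1 < Q₂p := (h2one 0).trans_le (hQ₂p 0)
  have hq2' : ∀ x, q₂ x / (q₂ x - 1) = 1 / (1 - 1 / q₁ x + β / n) := fun x => by
    have e : 1 - 1 / q₁ x + β / n = 1 - 1 / q₂ x := by rw [hinv]; ring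
    rw [e]
    have := (h2pos x).ne'
    have : q₂ x - 1 ≠ 0 := by have := h2one x; linarith
    field_simp
  have hup : ∀ x, q₂ x / (q₂ x - 1) ≤ Qm / (Qm - 1) := fun x => by
    have h1 := h2l x
    rw [div_le_div_iff₀ (by linarith) (by linarith)]
    nlinarith
  have hlo : ∀ x, Q₂p / (Q₂p - 1) ≤ q₂ x / (q₂ x - 1) := fun x => by
    have h1 := h2one x
    have h2 := hQ₂p x
    rw [div_le_div_iff₀ (by linarith) (by linarith)]
    nlinarith
  set r := Q₂p / (Q₂p - 1) with hr
  have hr1 : 1 < r := by rw [hr, lt_div_iff₀ (by linarith)]; linarith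
  set Q := max Qp (max Q₂p (Qm / (Qm - 1))) with hQ
  have hQ1 : Qp ≤ Q := le_max_left _ _
  have hQ2' : Q₂p ≤ Q := (le_max_left _ _).trans (le_max_right _ _)
  have hQ3 : Qm / (Qm - 1) ≤ Q := (le_max_right _ _).trans (le_max_right _ _)
  have hQone : 1 < Q := by linarith
  set t := Real.sqrt (min Qm r) with ht
  have ht1 : 1 < t := by
    rw [ht, Real.lt_sqrt (by norm_num)]; simp [hQm, hr1]
  have htt : t * t = min Qm r := Real.mul_self_sqrt (by
    refine le_min ?_ ?_ <;> linarith)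
  obtain ⟨N, hN⟩ := exists_nat_ge (max Q (t / (t - 1)))
  have hNQ : Q ≤ N := (le_max_left _ _).trans hN
  have hNt : t / (t - 1) ≤ N := (le_max_right _ _).trans hN
  have hN1 : (1:ℝ) < N := hQone.trans_le hNQ
  have hst : (N:ℝ) / (N - 1) ≤ t := by
    rw [div_le_iff₀ (by linarith)] at hNt ⊢
    nlinarith
  have hs1 : 1 < (N:ℝ) / (N - 1) := by rw [lt_div_iff₀ (by linarith)]; linarith
  have hss : (N:ℝ) / (N - 1) * ((N:ℝ) / (N - 1)) ≤ min Qm r := by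
    rw [← htt]; exact mul_self_le_mul_self (by linarith) hst
  obtain ⟨C, hC, hreg⟩ := regA_of_logHolder hlh
  have hQQ : 1 ≤ Q * Q := by nlinarith
  refine ⟨(N:ℝ) / (N - 1), Q, Q * Q * C, N, hn, hβ, hβn, hs1, ?_, hNQ, hq₁meas,
    fun x => hss.trans ((min_le_left _ _).trans (hbounds x).1), fun x => (hbounds x).2.trans hQ1,
    ?_, h2one, fun x => (hQ₂p x).trans hQ2', fun x => hss.trans ((min_le_right _ _).trans (hlo x)),
    fun x => (hup x).trans hQ3, hq₂, by positivity, ?_, ?_⟩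
  · rw [Real.holderConjugate_iff]
    refine ⟨hs1, ?_⟩
    have : (N:ℝ) - 1 ≠ 0 := by linarith
    have : (N:ℝ) ≠ 0 := by linarith
    field_simp; ring
  · have : q₂ = fun x => 1 / (1 / q₁ x - β / n) := by
      funext x; rw [← hinv, one_div_one_div]
    rw [this]
    exact measurable_const.div ((measurable_const.div hq₁meas).sub measurable_const)
  · exact regA_trans hreg (by positivity) fun x y => le_mul_of_one_le_left (abs_nonneg _) hQQ
  · refine regA_trans hreg (by positivity) fun x y => ?_
    have hx := hq2' x
    have hy := hq2' y
    have hux := (hup x).trans hQ3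
    have huy := (hup y).trans hQ3
    have i1 : 1 / q₁ x < 1 := by rw [div_lt_one (h1pos x)]; exact hQm.trans_le (hbounds x).1
    have i2 : 1 / q₁ y < 1 := by rw [div_lt_one (h1pos y)]; exact hQm.trans_le (hbounds y).1
    rw [hx, hy] at *
    set u := 1 - 1 / q₁ x + β / n with hu
    set v := 1 - 1 / q₁ y + β / n with hv
    have hu0 : 0 < u := by linarith
    have hv0 : 0 < v := by linarith
    have e : 1 / u - 1 / v = (1 / u) * (1 / v) * (1 / q₁ x - 1 / q₁ y) := by
      have : 1 / q₁ x - 1 / q₁ y = v - u := by rw [hu, hv]; ring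
      rw [this]; field_simp
    rw [e, abs_mul, abs_of_pos (by positivity : 0 < 1 / u * (1 / v))]
    refine mul_le_mul ?_ (abs_inv_sub_inv_le ?_ ?_) (abs_nonneg _) (by positivity)
    · exact mul_le_mul hux huy (by positivity) (by linarith)
    · exact hQm.le.trans (hbounds x).1
    · exact hQm.le.trans (hbounds y).1

lemma bmo1_div {n : ℕ} {b b' : Eu n → ℝ} {M : ℝ} (hM : 0 < M) (hb : LocallyIntegrable b)
    (hbb : b =ᵐ[volume] b')
    (h : ∀ (c : Eu n) (r : ℝ), 0 < r →
        (⨍ x in closedBall c r, |b x - ⨍ y in closedBall c r, b y|) ≤ M) :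
    BMO1 (fun x => M⁻¹ * b' x) := by
  constructor
  · have h1 : LocallyIntegrable (fun x => M⁻¹ * b x) := hb.smul (M⁻¹)
    intro x
    obtain ⟨s, hs, hi⟩ := h1 x
    refine ⟨s, hs, hi.congr_fun_ae ?_⟩
    filter_upwards [ae_restrict_of_ae hbb] with y hy
    simp [hy]
  · intro c r hr
    have h1 := h c r hr
    have e1 : (⨍ y in closedBall c r, M⁻¹ * b' y) = M⁻¹ * ⨍ y in closedBall c r, b y := by
      rw [setAverage_eq, setAverage_eq, integral_const_mul, smul_eq_mul, smul_eq_mul]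
      rw [integral_congr_ae (ae_restrict_of_ae hbb)]; ring
    rw [e1]
    have e2 : (⨍ x in closedBall c r, |M⁻¹ * b' x - M⁻¹ * ⨍ y in closedBall c r, b y|) =
        M⁻¹ * ⨍ x in closedBall c r, |b x - ⨍ y in closedBall c r, b y| := by
      set a := ⨍ y in closedBall c r, b y
      rw [setAverage_eq, setAverage_eq, smul_eq_mul, smul_eq_mul]
      have : ∫ x in closedBall c r, |M⁻¹ * b' x - M⁻¹ * a| = ∫ x in closedBall c r, M⁻¹ * |b x - a| := by
        refine integral_congr_ae ?_
        filter_upwards [ae_restrict_of_ae hbb] with y hy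
        rw [← hy, ← mul_sub, abs_mul, abs_of_pos (inv_pos.2 hM)]
      rw [this, integral_const_mul]; ring
    rw [e2]
    calc _ ≤ M⁻¹ * M := mul_le_mul_of_nonneg_left h1 (inv_pos.2 hM).le
      _ = 1 := inv_mul_cancel₀ hM.ne'

lemma comm_ae {n : ℕ} {b b' : Eu n → ℝ} (β : ℝ) (m : ℕ) (f : Eu n → ℝ) (hbb : b =ᵐ[volume] b') :
    ∀ᵐ x, commFracInt β m b f x = commFracInt β m b' f x := by
  filter_upwards [hbb] with x hx
  unfold commFracInt
  refine integral_congr_ae ?_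
  filter_upwards [hbb] with y hy
  rw [hx, hy]

lemma Tf_scale {n : ℕ} (β : ℝ) (m : ℕ) (b : Eu n → ℝ) {M : ℝ} (hM : 0 < M) (g : Eu n → ℝ≥0∞) (x : Eu n) :
    Tf β m b g x = Tf β m (fun y => M⁻¹ * b y) (fun y => ENNReal.ofReal (M ^ m) * g y) x := by
  unfold Tf
  refine lintegral_congr fun y => ?_
  have e : b x - b y = M * (M⁻¹ * b x - M⁻¹ * b y) := by field_simp
  rw [e, enorm_mul, mul_pow, Real.enorm_eq_ofReal hM.le, ENNReal.ofReal_pow hM.le]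
  ring

end HM

/-- main theorem: let `q₁ : ℝⁿ → (1,∞)` be log-Hölder with
`1 < (q₁)₋ ≤ (q₁)₊ < ∞`, `m ∈ ℕ`, `0 < p₁ ≤ p₂ < ∞`, `λ > 0`, `0 < β < n/(q₁)₊`, and
`1/q₁ - 1/q₂ = β/n`. Let `δ₁ ∈ (0, 1/(q₁')₊)` and `δ₂ ∈ (0, 1/(q₂)₊)` be the regularity
exponents from the characteristic-function estimates for `q₁'` and `q₂`, and assume
`λ - nδ₂ < α < λ + nδ₁`. Then for every `b ∈ BMO(ℝⁿ)` the commutator `I^m_{β,b}` is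
bounded from `MK̇^{α,λ}_{p₁,q₁(·)}(ℝⁿ)` to `MK̇^{α,λ}_{p₂,q₂(·)}(ℝⁿ)`, with
`‖I^m_{β,b} f‖ ≤ C ‖b‖^m_{BMO} ‖f‖`. -/
theorem stmt18 (n : ℕ) (hn : 0 < n) (q₁ q₂ : EuclideanSpace ℝ (Fin n) → ℝ)
    (hq₁meas : Measurable q₁) (hlh : LogHolder q₁)
    (Qm Qp Qp' Q₂p : ℝ) (hQm : 1 < Qm) (hbounds : ∀ x, Qm ≤ q₁ x ∧ q₁ x ≤ Qp)
    (hQp' : ∀ x, q₁ x / (q₁ x - 1) ≤ Qp') (hQ₂p : ∀ x, q₂ x ≤ Q₂p)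
    (m : ℕ) (p₁ p₂ lam α β δ₁ δ₂ : ℝ)
    (hp₁ : 0 < p₁) (hp₁₂ : p₁ ≤ p₂) (hlam : 0 < lam)
    (hβ : 0 < β) (hβ' : β < n / Qp)
    (hq₂ : ∀ x, 1 / q₁ x - 1 / q₂ x = β / n)
    (hδ₁ : 0 < δ₁) (hδ₁' : δ₁ < 1 / Qp')
    (hδ₂ : 0 < δ₂) (hδ₂' : δ₂ < 1 / Q₂p)
    (hδ₁est : ∃ C > 0, ∀ (c : EuclideanSpace ℝ (Fin n)) (r : ℝ), 0 < r →
      ∀ S : Set (EuclideanSpace ℝ (Fin n)), MeasurableSet S → S ⊆ closedBall c r →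
        vLpNorm (fun x => q₁ x / (q₁ x - 1)) (S.indicator fun _ => (1:ℝ)) ≤
          ENNReal.ofReal C * (volume S / volume (closedBall c r)) ^ δ₁ *
            vLpNorm (fun x => q₁ x / (q₁ x - 1))
              ((closedBall c r).indicator fun _ => (1:ℝ)))
    (hδ₂est : ∃ C > 0, ∀ (c : EuclideanSpace ℝ (Fin n)) (r : ℝ), 0 < r →
      ∀ S : Set (EuclideanSpace ℝ (Fin n)), MeasurableSet S → S ⊆ closedBall c r →
        vLpNorm q₂ (S.indicator fun _ => (1:ℝ)) ≤
          ENNReal.ofReal C * (volume S / volume (closedBall c r)) ^ δ₂ *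
            vLpNorm q₂ ((closedBall c r).indicator fun _ => (1:ℝ)))
    (hα₁ : lam - n * δ₂ < α) (hα₂ : α < lam + n * δ₁) :
    ∃ C > 0, ∀ (b : EuclideanSpace ℝ (Fin n) → ℝ) (Mb : ℝ),
      LocallyIntegrable b → 0 ≤ Mb →
      (∀ (c : EuclideanSpace ℝ (Fin n)) (r : ℝ), 0 < r →
        (⨍ x in closedBall c r, |b x - ⨍ y in closedBall c r, b y|) ≤ Mb) →
      ∀ f : EuclideanSpace ℝ (Fin n) → ℝ, herzMorreyNorm q₁ α lam p₁ f ≠ ⊤ →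
        herzMorreyNorm q₂ α lam p₂ (commFracInt β m b f) ≤
          ENNReal.ofReal (C * Mb ^ m) * herzMorreyNorm q₁ α lam p₁ f := by
  obtain ⟨s, Q, C, N, P⟩ := HM.exists_par hn hq₁meas hlh hQm hbounds hQ₂p hβ hβ' hq₂
  obtain ⟨CB, hCB, hB⟩ := HM.regB_of_logHolder hlh
  have hB' : HM.RegB (fun x => 1 / q₁ x) (1 * CB) :=
    HM.regB_trans hB zero_le_one fun x y => by
      rw [one_mul]
      exact HM.abs_inv_sub_inv_le (hQm.le.trans (hbounds x).1) (hQm.le.trans (hbounds y).1)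
  have hd1 : ∀ x, δ₁ ≤ 1 - 1 / q₁ x := fun x => by
    have h1 : 1 < q₁ x := hQm.trans_le (hbounds x).1
    have h2 : 0 < q₁ x / (q₁ x - 1) := div_pos (by linarith) (by linarith)
    have h3 : 1 / Qp' ≤ 1 / (q₁ x / (q₁ x - 1)) := one_div_le_one_div_of_le h2 (hQp' x)
    have h4 : 1 / (q₁ x / (q₁ x - 1)) = 1 - 1 / q₁ x := by
      have : q₁ x ≠ 0 := by linarith
      have : q₁ x - 1 ≠ 0 := by linarith
      field_simp
    linarith
  have hd2 : ∀ x, δ₂ ≤ 1 / q₂ x := fun x => by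
    have h1 := P.hq2l x
    have h3 : 1 / Q₂p ≤ 1 / q₂ x := one_div_le_one_div_of_le (by linarith) (hQ₂p x)
    linarith
  obtain ⟨D, hD, hmain⟩ := HM.main_pos P (by linarith) hB' hd1 hd2 hα₁ hα₂ m
  have hp₂ : 0 < p₂ := hp₁.trans_le hp₁₂
  have hq1n : ∀ x, 0 ≤ q₁ x := fun x => by have := (hbounds x).1; linarith
  have hq2n : ∀ x, 0 ≤ q₂ x := fun x => by have := P.hq2l x; linarith
  set K : ℝ≥0∞ := (HM.Cg (lam * p₂)) ^ (1 / p₂) * D with hK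
  have hKt : K ≠ ⊤ := ENNReal.mul_ne_top
    (ENNReal.rpow_ne_top_of_nonneg (by positivity) (HM.Cg_ne_top (by positivity))) hD
  -- the bound for a positive majorant of the BMO seminorm
  have hpos : ∀ (b : EuclideanSpace ℝ (Fin n) → ℝ) (M : ℝ), LocallyIntegrable b → 0 < M →
      (∀ (c : EuclideanSpace ℝ (Fin n)) (r : ℝ), 0 < r →
        (⨍ x in closedBall c r, |b x - ⨍ y in closedBall c r, b y|) ≤ M) →
      ∀ f : EuclideanSpace ℝ (Fin n) → ℝ, 
        herzMorreyNorm q₂ α lam p₂ (commFracInt β m b f) ≤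
          K * herzMorreyNorm q₁ α lam p₁ f * ENNReal.ofReal (M ^ m) := by
    intro b M hb hM hbM f
    have hbs := hb.aestronglyMeasurable
    have hbb : b =ᵐ[volume] hbs.mk b := hbs.ae_eq_mk
    have hb'm : Measurable (hbs.mk b) := hbs.stronglyMeasurable_mk.measurable
    have hbmo := HM.bmo1_div hM hb hbb hbM
    obtain ⟨g, hgm, hgl, hgu⟩ := HM.exists_dom (β := β) m f
    have hc0 : ENNReal.ofReal (M ^ m) ≠ 0 := by
      rw [Ne, ENNReal.ofReal_eq_zero, not_le]; positivity
    have hct : ENNReal.ofReal (M ^ m) ≠ ⊤ := ENNReal.ofReal_ne_top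
    set c := ENNReal.ofReal (M ^ m) with hc
    have hm2 := hmain _ hbmo (hb'm.const_mul M⁻¹) (fun y => c * g y) (hgm.const_mul c)
      (c * herzMorreyNorm q₁ α lam p₁ f) (fun j => by
        have h1 := HM.single_term (q := q₁) (α := α) (lam := lam) hp₁ f j
        have h2 : HM.vN q₁ ((annulus n j).indicator (fun y => c * g y)) ≤
            c * vLpNorm q₁ ((annulus n j).indicator f) := by
          have e : (annulus n j).indicator (fun y => c * g y) =
              fun y => c * (annulus n j).indicator g y := by
            funext y
            by_cases hy : y ∈ annulus n j <;> simp [hy]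
          rw [e]
          refine (HM.vN_const_mul_le q₁ _ hc0 hct).trans (mul_le_mul' le_rfl ?_)
          rw [HM.vLpNorm_eq]
          refine HM.vN_mono_ae hq1n (Filter.Eventually.of_forall fun y => ?_)
          by_cases hy : y ∈ annulus n j
          · simpa [hy] using hgl y
          · simp [hy]
        calc _ ≤ HM.tw (j * α) * (c * vLpNorm q₁ ((annulus n j).indicator f)) :=
              mul_le_mul' le_rfl h2
          _ = c * (HM.tw (j * α) * vLpNorm q₁ ((annulus n j).indicator f)) := by ring
          _ ≤ c * (herzMorreyNorm q₁ α lam p₁ f * HM.tw (j * lam)) := mul_le_mul' le_rfl h1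
          _ = _ := by ring)
    have h3 := HM.herz_of_terms (q := q₂) (α := α) (lam := lam) hp₂ (commFracInt β m b f)
      (D * (c * herzMorreyNorm q₁ α lam p₁ f)) (fun k => by
        refine le_trans (mul_le_mul' le_rfl ?_) (hm2 k)
        rw [HM.vLpNorm_eq]
        refine HM.vN_mono_ae hq2n ?_
        filter_upwards [HM.comm_ae β m f hbb] with x hx
        by_cases hxk : x ∈ annulus n k
        · simp only [Set.indicator_of_mem hxk]
          rw [hx, ← HM.Tf_scale β m _ hM g x]
          exact hgu _ hb'm x
        · simp [hxk])
    refine h3.trans (le_of_eq ?_)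
    rw [hK]; ring
  refine ⟨K.toReal + 1, by positivity, fun b Mb hb hMb hbM f hf => ?_⟩
  have hlim : herzMorreyNorm q₂ α lam p₂ (commFracInt β m b f) ≤
      K * herzMorreyNorm q₁ α lam p₁ f * ENNReal.ofReal (Mb ^ m) := by
    have ht : Filter.Tendsto (fun ε : ℝ =>
        K * herzMorreyNorm q₁ α lam p₁ f * ENNReal.ofReal ((Mb + ε) ^ m))
        (nhdsWithin 0 (Set.Ioi 0))
        (nhds (K * herzMorreyNorm q₁ α lam p₁ f * ENNReal.ofReal (Mb ^ m))) := by
      refine ENNReal.Tendsto.const_mul ?_ (Or.inr (ENNReal.mul_ne_top hKt hf))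
      have h1 : Continuous (fun ε : ℝ => ENNReal.ofReal ((Mb + ε) ^ m)) :=
        ENNReal.continuous_ofReal.comp (by fun_prop)
      have h2 := (h1.tendsto 0).mono_left (nhdsWithin_le_nhds (s := Set.Ioi 0))
      simpa using h2
    refine ge_of_tendsto ht ?_
    filter_upwards [self_mem_nhdsWithin] with ε hε
    have hε : 0 < ε := hε
    exact hpos b (Mb + ε) hb (by linarith)
      (fun c r hr => (hbM c r hr).trans (by linarith)) f
  refine hlim.trans ?_
  rw [ENNReal.ofReal_mul (by positivity)]
  have hKle : K ≤ ENNReal.ofReal (K.toReal + 1) := by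
    calc K = ENNReal.ofReal K.toReal := (ENNReal.ofReal_toReal hKt).symm
      _ ≤ _ := ENNReal.ofReal_le_ofReal (by linarith)
  calc _ = K * ENNReal.ofReal (Mb ^ m) * herzMorreyNorm q₁ α lam p₁ f := by ring
    _ ≤ _ := mul_le_mul' (mul_le_mul' hKle le_rfl) le_rfl
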